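/- Let X be an irreducible word and A a cyclically irreducible word such that the word X⁻¹AX is freely reduced, and suppose neither the word X⁻¹A nor the word AX contains a (4g−1)-LLFR. Let w ∈ G be the element represented by X⁻¹AX. Then 2|X| + |A| − |w| ≤ 8g, where |X| and |A| are the lengths of the words X and A and |w| is the word length of w. -/

import Mathlib

namespace SG

/-- A letter of the alphabet `S± = {cᵢ^{±1}}`: `(i, true)` is `c_{i+1}`,
`(i, false)` is `c_{i+1}⁻¹`. -/
abbrev Letter (g : ℕ) := Fin (2*g) × Bool

/-- A word in the alphabet `S±`. -/
abbrev Word (g : ℕ) := List (Letter g)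

/-- The surface relator `c₁c₂⋯c_{2g}c₁⁻¹c₂⁻¹⋯c_{2g}⁻¹` in the free group. -/
def relator (g : ℕ) : FreeGroup (Fin (2*g)) :=
  (List.ofFn fun i : Fin (2*g) => FreeGroup.of i).prod *
  (List.ofFn fun i : Fin (2*g) => (FreeGroup.of i)⁻¹).prod

/-- The surface group with the symmetric presentation. -/
abbrev SurfaceGroup (g : ℕ) :=
  PresentedGroup ({relator g} : Set (FreeGroup (Fin (2*g))))

/-- The generator `c_{i+1}` of the surface group. -/
def gen (g : ℕ) (i : Fin (2*g)) : SurfaceGroup g := PresentedGroup.of i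

/-- The inverse of a letter. -/
def invLetter (g : ℕ) (a : Letter g) : Letter g := (a.1, !a.2)

/-- The group element represented by a letter. -/
def evalLetter (g : ℕ) (a : Letter g) : SurfaceGroup g :=
  if a.2 then gen g a.1 else (gen g a.1)⁻¹

/-- The group element represented by a word. -/
def eval (g : ℕ) (W : Word g) : SurfaceGroup g := (W.map (evalLetter g)).prod

/-- The formal inverse `x_n⁻¹ ⋯ x₁⁻¹` of a word `x₁ ⋯ x_n`. -/
def wordInv (g : ℕ) (W : Word g) : Word g := (W.map (invLetter g)).reverse

/-- Word length of a group element: the least `n` such that the element is a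
product of `n` elements of `S ∪ S⁻¹`. -/
noncomputable def len (g : ℕ) (u : SurfaceGroup g) : ℕ :=
  sInf {n | ∃ W : Word g, W.length = n ∧ eval g W = u}

/-- `conjLen g u v` is the minimum of `|x|` over conjugators `x` with `x⁻¹ux = v`. -/
noncomputable def conjLen (g : ℕ) (u v : SurfaceGroup g) : ℕ :=
  sInf {k | ∃ x : SurfaceGroup g, x⁻¹ * u * x = v ∧ len g x = k}

/-- The conjugator length function: `CL g n` is the least `N` such that any
conjugate `u, v` with `|u| + |v| ≤ n` admit a conjugator of length `≤ N`. -/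
noncomputable def CL (g : ℕ) (n : ℕ) : ℕ :=
  sInf {N | ∀ u v : SurfaceGroup g,
    (∃ x : SurfaceGroup g, x⁻¹ * u * x = v) → len g u + len g v ≤ n →
      conjLen g u v ≤ N}

/-- Rank of a letter in the ascending order
`c_{2g} ≺ ⋯ ≺ c₂ ≺ c₁ ≺ c₁⁻¹ ≺ c₂⁻¹ ≺ ⋯ ≺ c_{2g}⁻¹`. -/
def rank (g : ℕ) (a : Letter g) : ℕ :=
  if a.2 then (2*g - 1) - (a.1 : ℕ) else 2*g + (a.1 : ℕ)

/-- The strict order `≺` on letters. -/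
def letterLt (g : ℕ) (a b : Letter g) : Prop := rank g a < rank g b

/-- The length-lexicographical order `≺` on words. -/
def wordLt (g : ℕ) (X Y : Word g) : Prop :=
  X.length < Y.length ∨ (X.length = Y.length ∧ List.Lex (letterLt g) X Y)

/-- A word is irreducible if it is the `≺`-least word representing its element. -/
def IrreducibleWord (g : ℕ) (W : Word g) : Prop :=
  ∀ W' : Word g, eval g W' = eval g W → W' = W ∨ wordLt g W W'

/-- A word is cyclically irreducible if all its cyclic permutations are irreducible. -/
def CyclicallyIrreducibleWord (g : ℕ) (W : Word g) : Prop :=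
  ∀ W' : Word g, List.IsRotated W W' → IrreducibleWord g W'

/-- A word is freely reduced if no letter is followed by its inverse. -/
def FreelyReduced (g : ℕ) (W : Word g) : Prop :=
  List.Chain' (fun a c => c ≠ invLetter g a) W

/-- The normal form of a group element: the `≺`-least word representing it. -/
noncomputable def nf (g : ℕ) (x : SurfaceGroup g) : Word g := by
  classical
  exact if h : ∃ W : Word g, eval g W = x ∧ IrreducibleWord g W then h.choose else []

/-- The word `R = c₁c₂⋯c_{2g}c₁⁻¹c₂⁻¹⋯c_{2g}⁻¹`. -/
def Rword (g : ℕ) : Word g :=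
  (List.ofFn fun i : Fin (2*g) => ((i, true) : Letter g)) ++
  (List.ofFn fun i : Fin (2*g) => ((i, false) : Letter g))

/-- `𝓡`: all cyclic permutations of `R` and of `R⁻¹`. -/
def RSet (g : ℕ) : Set (Word g) :=
  {W | List.IsRotated (Rword g) W ∨ List.IsRotated (wordInv g (Rword g)) W}

/-- `seg g b i k` is the word `b_i b_{i+1} ⋯ b_{i+k-1}`. -/
def seg (g : ℕ) (b : ℕ → Letter g) (i k : ℕ) : Word g :=
  (List.range k).map fun j => b (i + j)

/-- `dseg g b i k` is the descending word `b_i b_{i-1} ⋯ b_{i-k+1}`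
(indices taken modulo `4g`, using periodicity of `b`). -/
def dseg (g : ℕ) (b : ℕ → Letter g) (i k : ℕ) : Word g :=
  (List.range k).map fun j => b (i + 4*g - j)

/-- `b : ℕ → Letter g` is a `4g`-periodic (1-based) enumeration of the letters
`b₁, …, b_{4g}` of some word `b₁⋯b_{4g} ∈ 𝓡`. -/
def RelSeq (g : ℕ) (b : ℕ → Letter g) : Prop :=
  (∀ i, b (i + 4*g) = b i) ∧ seg g b 1 (4*g) ∈ RSet g

/-- The `t`-th power `W^t` of a word. -/
def wpow (g : ℕ) (W : Word g) (t : ℕ) : Word g := (List.replicate t W).flatten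

/-- A `k`-fractional relator: an initial segment of length `k` (with `2 ≤ k ≤ 4g`)
of some word in `𝓡`. -/
def IsFR (g : ℕ) (k : ℕ) (W : Word g) : Prop :=
  2 ≤ k ∧ k ≤ 4*g ∧ ∃ B ∈ RSet g, W = B.take k

/-- `IsLLFROcc g k W P F Q` : the factorization `W = P ++ F ++ Q` exhibits `F`
as a `k`-locally longest fractional relator of `W`. -/
def IsLLFROcc (g : ℕ) (k : ℕ) (W P F Q : Word g) : Prop :=
  W = P ++ F ++ Q ∧ IsFR g k F ∧
  (∀ a, P.getLast? = some a → ¬ IsFR g (k+1) (a :: F)) ∧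
  (∀ a, Q.head? = some a → ¬ IsFR g (k+1) (F ++ [a]))

/-- `W` contains a `k`-LLFR. -/
def HasLLFR (g : ℕ) (k : ℕ) (W : Word g) : Prop :=
  ∃ P F Q, IsLLFROcc g k W P F Q

/-- Length-lexicographical order on pairs of words. -/
def pairLt (g : ℕ) (p q : Word g × Word g) : Prop :=
  wordLt g p.1 q.1 ∨ (p.1 = q.1 ∧ wordLt g p.2 q.2)

/-- A candidate for the reducing-subword pair of `(W₁, W₂)`. -/
def IsRSCand (g : ℕ) (W₁ W₂ C₁ C₂ : Word g) : Prop :=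
  ∃ A B C' : Word g, W₁ = A ++ C₁ ∧ W₂ = C₂ ++ B ∧
    nf g (eval g (W₁ ++ W₂)) = A ++ C' ++ B

/-- `(C₁, C₂)` is the reducing-subword pair `rs(W₁, W₂)`: the `≺`-least candidate. -/
def IsRS (g : ℕ) (W₁ W₂ C₁ C₂ : Word g) : Prop :=
  IsRSCand g W₁ W₂ C₁ C₂ ∧
  ∀ D₁ D₂ : Word g, IsRSCand g W₁ W₂ D₁ D₂ →
    (C₁ = D₁ ∧ C₂ = D₂) ∨ pairLt g (C₁, C₂) (D₁, D₂)

end SG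


namespace SGP

/-- Directions at a vertex of the tiling. -/
abbrev D (g : ℕ) := ZMod (4*g)

/-- the half turn -/
def hf (g : ℕ) : D g := ((2*g : ℕ) : D g)

theorem hf_add (g : ℕ) : hf g + hf g = 0 := by
  have : ((4*g : ℕ) : D g) = 0 := ZMod.natCast_self _
  unfold hf; rw [← this]; push_cast; ring

theorem hf_mul (g : ℕ) : hf g * hf g = 0 := by
  have : ((4*g : ℕ) : D g) = 0 := ZMod.natCast_self _
  have h2 : hf g * hf g = ((4*g : ℕ) : D g) * g := by unfold hf; push_cast; ring
  rw [h2, this, zero_mul]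

theorem cast_ne {g : ℕ} (k : ℤ) (h0 : k ≠ 0) (h1 : k < 4*g) (h2 : -(4*g) < k) :
    ((k : ℤ) : D g) ≠ 0 := by
  intro h
  rw [ZMod.intCast_zmod_eq_zero_iff_dvd] at h
  obtain ⟨c, hc⟩ := h
  push_cast at hc
  rcases lt_trichotomy c 0 with h | h | h
  · nlinarith
  · subst h; omega
  · nlinarith

theorem sm {g : ℕ} (hg : 2 ≤ g) (k : ℤ) (h0 : k ≠ 0) (h1 : k < 8) (h2 : -8 < k) :
    ((k : ℤ) : D g) ≠ 0 := cast_ne k h0 (by omega) (by omega)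

/-- fractional relator path -/
def fr {g : ℕ} (c : D g) : D g → ℕ → List (D g)
  | _, 0 => []
  | s, k+1 => s :: fr c (s+c) k

theorem fr_length {g : ℕ} (c : D g) (s : D g) (k : ℕ) : (fr c s k).length = k := by
  induction k generalizing s with
  | zero => rfl
  | succ k ih => simp [fr, ih]

theorem fr_add {g : ℕ} (c : D g) (s : D g) (k l : ℕ) :
    fr c s (k+l) = fr c s k ++ fr c (s + k*c) l := by
  induction k generalizing s with
  | zero => simp [fr]
  | succ k ih =>
    rw [show k+1+l = (k+l)+1 by ring]
    simp only [fr, List.cons_append, ih]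
    congr 3; push_cast; ring

theorem fr_succ_right {g : ℕ} (c : D g) (s : D g) (k : ℕ) :
    fr c s (k+1) = fr c s k ++ [s + k*c] := by
  rw [fr_add]; simp [fr]

/-- geodesic equivalence -/
inductive E (g : ℕ) : List (D g) → List (D g) → Prop
  | nil : E g [] []
  | cons (s : D g) {Y Z : List (D g)} : E g Y Z → E g (s::Y) (s::Z)
  | flip (s ε : D g) (hε : ε = 1 ∨ ε = -1) {Y Z : List (D g)} (W : List (D g)) :
      E g Y (fr (ε*(hf g+1)) (s+ε*(hf g+1)) (2*g-1) ++ W) →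
      E g Z (fr (-(ε*(hf g+1))) (s-ε-ε*(hf g+1)) (2*g-1) ++ W) → E g (s::Y) ((s-ε)::Z)

theorem E.rfl' {g : ℕ} (Y : List (D g)) : E g Y Y := by
  induction Y with
  | nil => exact .nil
  | cons s Y ih => exact .cons s ih

theorem E.symm' {g : ℕ} {Y Z : List (D g)} (h : E g Y Z) : E g Z Y := by
  induction h with
  | nil => exact .nil
  | cons s _ ih => exact .cons s ih
  | @flip s ε hε Y Z W h1 h2 _ _ =>
    have := E.flip (s-ε) (-ε) (by rcases hε with h | h <;> simp [h]) (Y := Z) (Z := Y) W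
      (by convert h2 using 3 <;> ring) (by convert h1 using 3 <;> ring)
    simpa using this

theorem E.len {g : ℕ} {Y Z : List (D g)} (h : E g Y Z) : Y.length = Z.length := by
  induction h with
  | nil => rfl
  | cons s _ ih => simp [ih]
  | flip s ε hε W h1 h2 ih1 ih2 =>
    simp [fr_length] at ih1 ih2 ⊢; omega

theorem eps_ne {g : ℕ} (hg : 2 ≤ g) {ε : D g} (hε : ε = 1 ∨ ε = -1) : ε ≠ 0 := by
  have h := sm hg 1 (by norm_num) (by norm_num) (by norm_num)
  rcases hε with h' | h' <;> subst h' <;> simpa using h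

theorem E.inv {g : ℕ} {s t : D g} {Y Z : List (D g)} (h : E g (s::Y) (t::Z)) :
    (s = t ∧ E g Y Z) ∨ ∃ ε W, (ε = 1 ∨ ε = -1) ∧ t = s - ε ∧
      E g Y (fr (ε*(hf g+1)) (s+ε*(hf g+1)) (2*g-1) ++ W) ∧
      E g Z (fr (-(ε*(hf g+1))) (s-ε-ε*(hf g+1)) (2*g-1) ++ W) := by
  cases h with
  | cons _ h => exact .inl ⟨rfl, h⟩
  | flip _ ε hε W h1 h2 => exact .inr ⟨ε, W, hε, rfl, h1, h2⟩

theorem E.tail {g : ℕ} (hg : 2 ≤ g) {s : D g} {Y Z : List (D g)} (h : E g (s::Y) (s::Z)) :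
    E g Y Z := by
  rcases h.inv with h | ⟨ε, W, hε, h, _⟩
  · exact h.2
  · exact absurd (by linear_combination h) (eps_ne hg hε)

theorem E.peel {g : ℕ} (hg : 2 ≤ g) (F : List (D g)) {Y Z : List (D g)}
    (h : E g (F++Y) (F++Z)) : E g Y Z := by
  induction F with
  | nil => exact h
  | cons a F ih => exact ih (E.tail hg h)

theorem E.app {g : ℕ} (F : List (D g)) {Y Z : List (D g)}
    (h : E g Y Z) : E g (F++Y) (F++Z) := by
  induction F with
  | nil => exact h
  | cons a F ih => exact .cons a ih

theorem fr_pos {g : ℕ} (c s : D g) (k : ℕ) (hk : 1 ≤ k) : fr c s k = s :: fr c (s+c) (k-1) := by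
  obtain ⟨k, rfl⟩ := Nat.exists_eq_add_of_le' hk
  rfl

/-- no third descent -/
theorem E.no3 {g : ℕ} (hg : 2 ≤ g) {t ε : D g} (hε : ε = 1 ∨ ε = -1) {Y Z : List (D g)}
    (h : E g ((t-ε*(hf g+1))::Y) ((t+ε*(hf g+1))::Z)) : False := by
  have hh := hf_add g
  rcases h.inv with ⟨h, _⟩ | ⟨ε', W, hε', h, _⟩
  · have : (2:D g)*ε = 0 := by linear_combination -h - ε*hh
    have h2 := sm hg 2 (by norm_num) (by norm_num) (by norm_num)
    rcases hε with rfl | rfl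
    · apply h2; push_cast; linear_combination this
    · apply h2; push_cast; linear_combination -this
  · have : (2:D g)*ε + ε' = 0 := by linear_combination h - ε*hh
    have h1 := sm hg 1 (by norm_num) (by norm_num) (by norm_num)
    have h3 := sm hg 3 (by norm_num) (by norm_num) (by norm_num)
    push_cast at h1 h3
    rcases hε with rfl | rfl <;> rcases hε' with rfl | rfl
    · apply h3; linear_combination this
    · apply h1; linear_combination this
    · apply h1; linear_combination -this
    · apply h3; linear_combination -this

theorem E.trans' {g : ℕ} (hg : 2 ≤ g) : ∀ (n : ℕ) {Y Z V : List (D g)}, Y.length = n →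
    E g Y Z → E g Z V → E g Y V := by
  intro n
  induction n with
  | zero =>
    intro Y Z V hn h1 h2
    have e1 : Z = [] := List.eq_nil_of_length_eq_zero (by rw [← h1.len, hn])
    have e2 : V = [] := List.eq_nil_of_length_eq_zero (by rw [← h2.len, e1]; rfl)
    have e3 : Y = [] := List.eq_nil_of_length_eq_zero hn
    subst e1 e2 e3; exact .nil
  | succ n ih =>
    intro Y Z V hn h1 h2
    rcases Y with _ | ⟨s, Y⟩
    · simp at hn
    rcases Z with _ | ⟨t, Z⟩
    · cases h1
    rcases V with _ | ⟨u, V⟩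
    · cases h2
    have hY : Y.length = n := by simpa using hn
    have hZ : Z.length = n := by have := h1.len; simp at this; omega
    have hV : V.length = n := by have := h2.len; simp at this; omega
    rcases h1.inv with ⟨rfl, h1'⟩ | ⟨ε, W, hε, rfl, ha, hb⟩
    · rcases h2.inv with ⟨rfl, h2'⟩ | ⟨ε, W, hε, rfl, ha, hb⟩
      · exact .cons _ (ih hY h1' h2')
      · exact .flip _ ε hε W (ih hY h1' ha) hb
    · rcases h2.inv with ⟨rfl, h2'⟩ | ⟨ε', W', hε', rfl, ha', hb'⟩
      · exact .flip _ ε hε W ha (ih hV h2'.symm' hb)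
      · have key := ih (by rw [← hb.len]; exact hZ) hb.symm' ha'
        have hl := hb.len
        by_cases he : ε' = ε
        · subst he
          exfalso
          rw [fr_pos (-(ε'*(hf g+1))) _ _ (by omega), fr_pos (ε'*(hf g+1)) _ _ (by omega)] at key
          simp only [List.cons_append] at key
          exact E.no3 hg hε key
        · have he' : ε' = -ε := by
            rcases hε with rfl | rfl <;> rcases hε' with rfl | rfl <;> simp_all
          subst he'
          have key2 : E g W W' := by
            apply E.peel hg (fr (-(ε*(hf g+1))) (s-ε-ε*(hf g+1)) (2*g-1))
            convert key using 3 <;> ring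
          have k3 := ih hY ha (E.app _ key2)
          have k4 : E g Y V := ih hY k3 (by
            have := hb'.symm'
            convert this using 3 <;> ring)
          have : s - ε - -ε = s := by ring
          rw [this]; exact .cons _ k4

theorem E.trans {g : ℕ} (hg : 2 ≤ g) {Y Z V : List (D g)}
    (h1 : E g Y Z) (h2 : E g Z V) : E g Y V := E.trans' hg _ rfl h1 h2

/-- reduced words -/
def Red {g : ℕ} : List (D g) → Prop
  | [] => True
  | s::Y => Red Y ∧ ∀ V, ¬ E g Y ((s + hf g)::V)

theorem fr_flip {g : ℕ} (hg : 2 ≤ g) (s ε : D g) (hε : ε = 1 ∨ ε = -1) (W : List (D g)) :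
    E g (fr (ε*(hf g+1)) s (2*g) ++ W) (fr (-(ε*(hf g+1))) (s-ε) (2*g) ++ W) := by
  rw [fr_pos _ _ _ (by omega), fr_pos _ (s-ε) _ (by omega)]
  simp only [List.cons_append]
  exact E.flip s ε hε W (E.rfl' _) (by rw [← sub_eq_add_neg]; exact E.rfl' _)

/-- going up the other side of a tile -/
theorem red_side {g : ℕ} (hg : 2 ≤ g) (s ε : D g) (hε : ε = 1 ∨ ε = -1) (W : List (D g))
    (hW : Red W) (h1 : ∀ V, ¬ E g W ((s + hf g)::V)) (h2 : ∀ V, ¬ E g W ((s - ε + hf g)::V)) :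
    ∀ k : ℕ, k ≤ 2*g → Red (fr (-(ε*(hf g+1))) (s + ((k:ℕ):D g)*(ε*(hf g+1)) - ε*(hf g+1)) k ++ W) := by
  have hh := hf_add g
  have hε2 : ε*hf g = hf g := by
    rcases hε with rfl | rfl
    · ring
    · linear_combination -hh
  intro k
  induction k with
  | zero => intro _; simpa [fr] using hW
  | succ k ih =>
    intro hk
    have ih := ih (by omega)
    have e1 : s + ((k+1:ℕ):D g)*(ε*(hf g+1)) - ε*(hf g+1) = s + k*(ε*(hf g+1)) := by
      push_cast; ring
    rw [e1]
    simp only [fr, List.cons_append, Red]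
    rw [← sub_eq_add_neg]
    refine ⟨ih, ?_⟩
    intro V hV
    rcases k with _ | k
    · apply h1 V; simpa [fr] using hV
    · have e2 : s + ((k+1:ℕ):D g)*(ε*(hf g+1)) - ε*(hf g+1) = s + k*(ε*(hf g+1)) := by
        push_cast; ring
      rw [e2] at hV
      simp only [fr, List.cons_append] at hV
      rcases hV.inv with ⟨h, _⟩ | ⟨ε', W', hε', h, ha, hb⟩
      · apply eps_ne hg hε
        push_cast at h
        linear_combination -h - hε2 - hh
      · have hee : ε' = -ε := by
          push_cast at h
          linear_combination h - hε2 - hh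
        subst hee
        have e3 : 2*g-1 = k + (2*g-1-k) := by omega
        rw [e3, fr_add, List.append_assoc] at ha
        have e4 : -ε*(hf g+1) = -(ε*(hf g+1)) := by ring
        rw [e4] at ha
        have ha' := E.peel hg _ ha
        rw [fr_pos _ _ _ (by omega)] at ha'
        apply h2 _
        simp only [List.cons_append] at ha'
        convert ha' using 2
        linear_combination hε2 + hh

theorem red_flip {g : ℕ} (hg : 2 ≤ g) (s ε : D g) (hε : ε = 1 ∨ ε = -1) (W : List (D g))
    (h : Red (fr (ε*(hf g+1)) s (2*g) ++ W)) :
    Red (fr (-(ε*(hf g+1))) (s-ε) (2*g) ++ W) := by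
  have hh := hf_add g
  have hm := hf_mul g
  have hε2 : ε*hf g = hf g := by
    rcases hε with rfl | rfl
    · ring
    · linear_combination -hh
  have hc : ((2*g:ℕ):D g) = hf g := rfl
  have hsuf : ∀ (F G : List (D g)), Red (F++G) → Red G := by
    intro F G h
    induction F with
    | nil => exact h
    | cons a F ih => exact ih h.1
  have hW : Red W := hsuf _ _ h
  have hlast : ∀ V, ¬ E g W ((s - ε + hf g)::V) := by
    have h' := h
    obtain ⟨k, hk⟩ : ∃ k, 2*g = k+1 := ⟨2*g-1, by omega⟩
    rw [hk, fr_succ_right, List.append_assoc] at h'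
    have h'' := (hsuf _ _ h').2
    have hk2 : (k:D g) = hf g - 1 := by
      have : ((2*g:ℕ):D g) = ((k+1:ℕ):D g) := by rw [hk]
      rw [hc] at this; push_cast at this; linear_combination -this
    intro V hV
    apply h'' V
    have e5 : s + (k:D g) * (ε*(hf g+1)) + hf g = s - ε + hf g := by
      rw [hk2]; linear_combination ε * hm
    rw [e5]; exact hV
  have hfirst : ∀ V, ¬ E g W ((s + hf g)::V) := by
    intro V hV
    rw [fr_pos _ _ _ (by omega)] at h
    refine h.2 (fr (-(ε*(hf g+1))) (s+ε*(hf g+1)-ε-ε*(hf g+1)) (2*g-1) ++ V) ?_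
    refine E.trans hg (E.app _ hV) ?_
    have := fr_flip hg (s+ε*(hf g+1)) ε hε V
    obtain ⟨k, hk⟩ : ∃ k, 2*g = k+1 := ⟨2*g-1, by omega⟩
    have hk2 : (k:D g) = hf g - 1 := by
      have : ((2*g:ℕ):D g) = ((k+1:ℕ):D g) := by rw [hk]
      rw [hc] at this; push_cast at this; linear_combination -this
    have hk3 : 2*g-1 = k := by omega
    rw [hk3]
    rw [hk] at this
    nth_rewrite 1 [fr_succ_right] at this
    simp only [fr, List.append_assoc, List.cons_append, List.nil_append] at this
    convert this using 3
    · rw [hk2]; linear_combination -ε*hm - hε2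
    · linear_combination -hε2
    · rw [sub_eq_add_neg _ (ε*(hf g+1))]
  have key := red_side hg s ε hε W hW hfirst hlast (2*g) le_rfl
  convert key using 3
  rw [hc]; linear_combination -ε*hm

theorem Red.congr' {g : ℕ} (hg : 2 ≤ g) : ∀ (n : ℕ) {Y Z : List (D g)}, Y.length = n →
    E g Y Z → Red Y → Red Z := by
  intro n
  induction n with
  | zero =>
    intro Y Z hn h1 h2
    have e1 : Z = [] := List.eq_nil_of_length_eq_zero (by rw [← h1.len, hn])
    subst e1; trivial
  | succ n ih =>
    intro Y Z hn h1 hR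
    rcases Y with _ | ⟨s, Y⟩
    · simp at hn
    rcases Z with _ | ⟨t, Z⟩
    · cases h1
    have hY : Y.length = n := by simpa using hn
    have hZ : Z.length = n := by have := h1.len; simp at this; omega
    have same : ∀ {s : D g} {Y Z : List (D g)}, Y.length = n → E g Y Z → Red (s::Y) → Red (s::Z) := by
      intro s Y Z hY h hr
      refine ⟨ih hY h hr.1, fun V hV => hr.2 V (E.trans hg h hV)⟩
    rcases h1.inv with ⟨rfl, h⟩ | ⟨ε, W, hε, rfl, ha, hb⟩
    · exact same hY h hR
    · have r1 := same hY ha hR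
      have r2 : Red (fr (ε*(hf g+1)) s (2*g) ++ W) := by
        rw [fr_pos _ _ _ (by omega)]; exact r1
      have r3 := red_flip hg s ε hε W r2
      rw [fr_pos _ _ _ (by omega), ← sub_eq_add_neg] at r3
      exact same (by rw [← hb.len, hZ]) hb.symm' r3

theorem Red.congr {g : ℕ} (hg : 2 ≤ g) {Y Z : List (D g)} (h : E g Y Z) (hY : Red Y) : Red Z :=
  Red.congr' hg _ rfl h hY

end SGP


namespace SGP

/-- reduced words as a setoid -/
def rwS (g : ℕ) (hg : 2 ≤ g) : Setoid {Y : List (D g) // Red Y} where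
  r a b := E g a.1 b.1
  iseqv := ⟨fun _ => E.rfl' _, fun h => h.symm', fun h h' => E.trans hg h h'⟩

/-- vertices of the tiling -/
def Om (g : ℕ) (hg : 2 ≤ g) : Type := Quotient (rwS g hg)

def cl {g : ℕ} (hg : 2 ≤ g) (Y : List (D g)) (h : Red Y) : Om g hg :=
  Quotient.mk (rwS g hg) ⟨Y, h⟩

theorem cl_eq {g : ℕ} (hg : 2 ≤ g) {Y Z : List (D g)} (h : Red Y) (h' : Red Z) (e : E g Y Z) :
    cl hg Y h = cl hg Z h' := Quotient.sound (s := rwS g hg) e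

def lenO {g : ℕ} (hg : 2 ≤ g) : Om g hg → ℕ :=
  Quotient.lift (s := rwS g hg) (fun a => a.1.length) (fun _ _ h => E.len h)

open Classical in
noncomputable def act0 {g : ℕ} (hg : 2 ≤ g) (s : D g) (Y : {Y : List (D g) // Red Y}) :
    {Y : List (D g) // Red Y} :=
  if h : ∃ V, E g Y.1 ((s + hf g)::V) then ⟨h.choose, (Red.congr hg h.choose_spec Y.2).1⟩
  else ⟨s::Y.1, Y.2, fun V hV => h ⟨V, hV⟩⟩

noncomputable def act {g : ℕ} (hg : 2 ≤ g) (s : D g) : Om g hg → Om g hg :=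
  Quotient.map' (s₁ := rwS g hg) (s₂ := rwS g hg) (act0 hg s) (by
    intro a b hab
    have hab : E g a.1 b.1 := hab
    change E g (act0 hg s a).1 (act0 hg s b).1
    unfold act0
    by_cases h : ∃ V, E g a.1 ((s + hf g)::V)
    · have h' : ∃ V, E g b.1 ((s + hf g)::V) := ⟨h.choose, E.trans hg hab.symm' h.choose_spec⟩
      rw [dif_pos h, dif_pos h']
      exact E.tail hg (E.trans hg h.choose_spec.symm' (E.trans hg hab h'.choose_spec))
    · have h' : ¬ ∃ V, E g b.1 ((s + hf g)::V) := by
        rintro ⟨V, hV⟩; exact h ⟨V, E.trans hg hab hV⟩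
      rw [dif_neg h, dif_neg h']
      exact E.cons s hab)

theorem act_up {g : ℕ} (hg : 2 ≤ g) (s : D g) (Y : List (D g)) (h : Red Y) (h' : Red (s::Y)) :
    act hg s (cl hg Y h) = cl hg (s::Y) h' := by
  change Quotient.mk (rwS g hg) (act0 hg s ⟨Y, h⟩) = _
  unfold act0
  rw [dif_neg (by rintro ⟨V, hV⟩; exact h'.2 V hV)]
  rfl

theorem act_down {g : ℕ} (hg : 2 ≤ g) (s : D g) (Y V : List (D g)) (h : Red Y) (h' : Red V)
    (e : E g Y ((s + hf g)::V)) :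
    act hg s (cl hg Y h) = cl hg V h' := by
  change Quotient.mk (rwS g hg) (act0 hg s ⟨Y, h⟩) = _
  unfold act0
  have hx : ∃ V, E g Y ((s + hf g)::V) := ⟨V, e⟩
  rw [dif_pos hx]
  apply cl_eq
  exact E.tail hg (E.trans hg hx.choose_spec.symm' e)

theorem act_inv {g : ℕ} (hg : 2 ≤ g) (s : D g) (ω : Om g hg) :
    act hg (s + hf g) (act hg s ω) = ω := by
  induction ω using Quotient.inductionOn with
  | h a =>
    obtain ⟨Y, h⟩ := a
    change act hg (s + hf g) (act hg s (cl hg Y h)) = cl hg Y h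
    by_cases hx : ∃ V, E g Y ((s + hf g)::V)
    · obtain ⟨V, hV⟩ := hx
      have r := Red.congr hg hV h
      rw [act_down hg s Y V h r.1 hV, act_up hg _ V r.1 r]
      exact cl_eq hg _ _ hV.symm'
    · have r : Red (s::Y) := ⟨h, fun V hV => hx ⟨V, hV⟩⟩
      rw [act_up hg s Y h r, act_down hg (s + hf g) (s::Y) Y r h]
      rw [add_assoc, hf_add, add_zero]; exact E.rfl' _

theorem act_inv' {g : ℕ} (hg : 2 ≤ g) (s : D g) (ω : Om g hg) :
    act hg s (act hg (s + hf g) ω) = ω := by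
  have := act_inv hg (s + hf g) ω
  rwa [add_assoc, hf_add, add_zero] at this

theorem act_len {g : ℕ} (hg : 2 ≤ g) (s : D g) (ω : Om g hg) :
    lenO hg (act hg s ω) ≤ lenO hg ω + 1 := by
  induction ω using Quotient.inductionOn with
  | h a =>
    obtain ⟨Y, h⟩ := a
    change lenO hg (act hg s (cl hg Y h)) ≤ lenO hg (cl hg Y h) + 1
    by_cases hx : ∃ V, E g Y ((s + hf g)::V)
    · obtain ⟨V, hV⟩ := hx
      have r := Red.congr hg hV h
      rw [act_down hg s Y V h r.1 hV]
      have := hV.len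
      change V.length ≤ Y.length + 1
      simp at this; omega
    · have r : Red (s::Y) := ⟨h, fun V hV => hx ⟨V, hV⟩⟩
      rw [act_up hg s Y h r]
      change (s::Y).length ≤ Y.length + 1
      simp

noncomputable def actW {g : ℕ} (hg : 2 ≤ g) (L : List (D g)) (ω : Om g hg) : Om g hg :=
  L.foldr (act hg) ω

theorem actW_cons {g : ℕ} (hg : 2 ≤ g) (s : D g) (L : List (D g)) (ω : Om g hg) :
    actW hg (s::L) ω = act hg s (actW hg L ω) := rfl

theorem actW_app {g : ℕ} (hg : 2 ≤ g) (L M : List (D g)) (ω : Om g hg) :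
    actW hg (L++M) ω = actW hg L (actW hg M ω) := by
  simp [actW, List.foldr_append]

theorem actW_len {g : ℕ} (hg : 2 ≤ g) (L : List (D g)) (ω : Om g hg) :
    lenO hg (actW hg L ω) ≤ lenO hg ω + L.length := by
  induction L with
  | nil => simp [actW]
  | cons s L ih =>
    rw [actW_cons]; have := act_len hg s (actW hg L ω); simp; omega

theorem actW_red {g : ℕ} (hg : 2 ≤ g) (L Y : List (D g)) (h : Red Y) (h' : Red (L++Y)) :
    actW hg L (cl hg Y h) = cl hg (L++Y) h' := by
  induction L with
  | nil => rfl
  | cons s L ih =>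
    rw [actW_cons, ih h'.1]
    exact act_up hg s _ _ h'

theorem actW_cancel {g : ℕ} (hg : 2 ≤ g) (c a : D g) (k : ℕ) (ω : Om g hg) :
    actW hg (fr c a k) (actW hg (fr (-c) (a + hf g + k*c - c) k) ω) = ω := by
  induction k with
  | zero => rfl
  | succ k ih =>
    rw [fr_succ_right, actW_app]
    simp only [fr, actW_cons]
    have e : a + hf g + ((k+1:ℕ):D g)*c - c = (a + k*c) + hf g := by push_cast; ring
    rw [e]
    change actW hg (fr c a k) (act hg (a + k*c) (act hg (a + k*c + hf g) _)) = ω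
    rw [act_inv']
    have e2 : a + k*c + hf g + -c = a + hf g + k*c - c := by ring
    rw [e2]; exact ih

theorem actW_rel {g : ℕ} (hg : 2 ≤ g) (N : ℕ) (hN : N = 2*g+2*g) : ∀ (n : ℕ) (d : D g) (Y : List (D g)) (h : Red Y),
    Y.length = n → actW hg (fr (hf g + 1) d N) (cl hg Y h) = cl hg Y h := by
  have hh := hf_add g
  have hm := hf_mul g
  have hc : ((2*g:ℕ):D g) = hf g := rfl
  intro n
  induction n using Nat.strong_induction_on with
  | _ n ih =>
  intro d Y h hn
  obtain ⟨k, hk⟩ : ∃ k, N = k+1 := ⟨N-1, by omega⟩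
  have hk2 : (k:D g) = -1 := by
    have : ((k+1:ℕ):D g) = 0 := by
      rw [← hk, hN]; push_cast; have := hf_add g; unfold hf at this; push_cast at this; exact this
    push_cast at this; linear_combination this
  by_cases hA : ∃ V, E g Y ((d - 1)::V)
  · obtain ⟨V, hV⟩ := hA
    have r := Red.congr hg hV h
    have h0 := ih V.length (by have := hV.len; simp at this; omega) (d-(hf g+1)) V r.1 rfl
    rw [hk] at h0 ⊢
    have e1 : d - (hf g + 1) + (hf g + 1) = d := by ring
    have e2 : d + (k:D g)*(hf g+1) = d - (hf g + 1) := by rw [hk2]; ring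
    have e3 : d - (hf g + 1) + hf g = d - 1 := by ring
    simp only [fr, actW_cons, e1] at h0
    rw [fr_succ_right, actW_app, e2]
    simp only [actW_cons]
    change actW hg (fr (hf g + 1) d k) (act hg (d - (hf g + 1)) (cl hg Y h)) = _
    rw [act_down hg _ Y V h r.1 (by rw [e3]; exact hV)]
    have h1 := congrArg (act hg (d - (hf g + 1) + hf g)) h0
    rw [act_inv, e3, act_up hg _ V r.1 r] at h1
    rw [h1]; exact cl_eq hg _ _ hV.symm'
  by_cases hB : ∃ V, E g Y (d::V)
  · obtain ⟨V, hV⟩ := hB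
    have r := Red.congr hg hV h
    have h0 := ih V.length (by have := hV.len; simp at this; omega) (d+(hf g+1)) V r.1 rfl
    rw [hk] at h0 ⊢
    have e2 : d + (hf g + 1) + (k:D g)*(hf g+1) = d := by rw [hk2]; ring
    rw [fr_succ_right, actW_app, e2] at h0
    change actW hg _ (act hg d (cl hg V r.1)) = _ at h0
    rw [act_up hg d V r.1 r, ← cl_eq hg h r hV] at h0
    simp only [fr, actW_cons]
    rw [h0, act_up hg d V r.1 r]
    exact cl_eq hg _ _ hV.symm'
  · have rs := red_side hg (d + hf g - 1) (-1) (.inr rfl) Y h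
      (fun V hV => hA ⟨V, by convert hV using 2; linear_combination -hh⟩)
      (fun V hV => hB ⟨V, by convert hV using 2; linear_combination -hh⟩) (2*g) le_rfl
    rw [hc] at rs
    have e1 : -(-1*(hf g + 1)) = hf g + 1 := by ring
    have e2 : d + hf g - 1 + hf g * (-1*(hf g+1)) - (-1*(hf g + 1)) = d + hf g := by
      linear_combination -hm
    rw [e1, e2] at rs
    have ff := fr_flip hg (d + hf g) 1 (.inl rfl) Y
    rw [one_mul] at ff
    have rs' := Red.congr hg ff rs
    rw [hN, fr_add, actW_app, hc]
    have e3 : d + hf g*(hf g+1) = d + hf g := by linear_combination hm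
    rw [e3, actW_red hg _ Y h rs, cl_eq hg rs rs' ff, ← actW_red hg _ Y h rs']
    have := actW_cancel hg (hf g+1) d (2*g) (cl hg Y h)
    rw [hc] at this
    have e4 : d + hf g + hf g*(hf g+1) - (hf g+1) = d + hf g - 1 := by linear_combination hm
    rwa [e4] at this

/-- the direction of a letter -/
def dir {g : ℕ} (a : SG.Letter g) : D g :=
  (hf g + 1) * ((a.1 : ℕ) : D g) + if a.2 then 0 else hf g

noncomputable def perm {g : ℕ} (hg : 2 ≤ g) (s : D g) : Equiv.Perm (Om g hg) where
  toFun := act hg s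
  invFun := act hg (s + hf g)
  left_inv := act_inv hg s
  right_inv := act_inv' hg s

theorem perm_inv {g : ℕ} (hg : 2 ≤ g) (s : D g) : (perm hg s)⁻¹ = perm hg (s + hf g) := by
  ext ω; rfl

theorem perm_prod {g : ℕ} (hg : 2 ≤ g) (L : List (D g)) (ω : Om g hg) :
    (L.map (perm hg)).prod ω = actW hg L ω := by
  induction L with
  | nil => rfl
  | cons s L ih => simp only [List.map_cons, List.prod_cons, Equiv.Perm.mul_apply, ih]; rfl

theorem ofFn_fr {g : ℕ} (c d : D g) (n : ℕ) :
    List.ofFn (fun i : Fin n => d + c * ((i : ℕ) : D g)) = fr c d n := by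
  induction n generalizing d with
  | zero => rfl
  | succ n ih =>
    rw [List.ofFn_succ, fr, ← ih]
    simp only [Fin.val_zero, Nat.cast_zero, mul_zero, add_zero, Fin.val_succ]
    congr 2; ext i; push_cast; ring

theorem Rword_dir {g : ℕ} : (SG.Rword g).map dir = fr (hf g + 1) 0 (2*g+2*g) := by
  have hm := hf_mul g
  have hc : ((2*g:ℕ):D g) = hf g := rfl
  rw [fr_add, SG.Rword, List.map_append, List.map_ofFn, List.map_ofFn,
    ← ofFn_fr, ← ofFn_fr, hc]
  congr 2
  · ext i; simp [dir]
  · ext i; simp only [Function.comp, dir]; simp; linear_combination -hm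

noncomputable def phi {g : ℕ} (hg : 2 ≤ g) : SG.SurfaceGroup g →* Equiv.Perm (Om g hg) :=
  PresentedGroup.toGroup (f := fun i => perm hg (dir (i, true))) (by
    intro r hr
    rw [Set.mem_singleton_iff] at hr
    subst hr
    have h : FreeGroup.lift (fun i => perm hg (dir (i, true))) (SG.relator g)
        = (((SG.Rword g).map dir).map (perm hg)).prod := by
      rw [SG.relator, SG.Rword, map_mul, map_list_prod, map_list_prod, List.map_append,
        List.map_append, List.prod_append]
      simp only [List.map_ofFn]
      congr 3
      · ext i : 1
        simp [perm_inv, dir]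
    rw [h, Rword_dir]
    ext ω
    rw [perm_prod]
    induction ω using Quotient.inductionOn with
    | h a => exact actW_rel hg _ rfl _ 0 a.1 a.2 rfl)

theorem phi_eval {g : ℕ} (hg : 2 ≤ g) (W : SG.Word g) :
    phi hg (SG.eval g W) = ((W.map dir).map (perm hg)).prod := by
  rw [SG.eval, map_list_prod, List.map_map, List.map_map]
  congr 1
  apply List.map_congr_left
  rintro ⟨i, b⟩ _
  simp only [Function.comp, SG.evalLetter, SG.gen]
  have h : phi hg (PresentedGroup.of i) = perm hg (dir (i, true)) := PresentedGroup.toGroup.of _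
  cases b
  · simp only [Bool.false_eq_true, if_false, map_inv, h, perm_inv]
    simp [dir]
  · simp [h]

theorem red_geo {g : ℕ} (hg : 2 ≤ g) (W W' : SG.Word g) (h : Red (W.map dir))
    (e : SG.eval g W' = SG.eval g W) : W.length ≤ W'.length := by
  have h1 := congrArg (phi hg) e
  rw [phi_eval, phi_eval] at h1
  have h2 := congrArg (fun p => p (cl hg [] trivial)) h1
  simp only [perm_prod] at h2
  have h' : Red (W.map dir ++ []) := by simpa using h
  rw [actW_red hg (W.map dir) [] trivial h'] at h2
  have h3 := actW_len hg (W'.map dir) (cl hg [] trivial)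
  rw [h2] at h3
  change (W.map dir ++ []).length ≤ 0 + (W'.map dir).length at h3
  simpa using h3

end SGP


namespace SGP

/-- turns of a path starting after the letter `y` -/
def tf {g : ℕ} : D g → List (D g) → List (D g)
  | _, [] => []
  | y, s::L => (s - y - hf g) :: tf s L

/-- counter -/
def step {g : ℕ} (k : ℕ) (τ : D g) : ℕ :=
  if τ = 1 then k+1 else if τ = 2 ∧ 2*g-1 ≤ k then 1 else 0

/-- the automaton accepting turn sequences of geodesics -/
def Ok {g : ℕ} : ℕ → ℕ → List (D g) → Prop
  | _, _, [] => True
  | k, l, τ::L => τ ≠ 0 ∧ step k τ < 2*g ∧ step l (-τ) < 2*g ∧ Ok (step k τ) (step l (-τ)) L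

theorem step_mono {g : ℕ} {k k' : ℕ} (h : k ≤ k') (τ : D g) : step k τ ≤ step k' τ := by
  unfold step
  split_ifs <;> first | omega | (exfalso; simp_all; omega)

theorem Ok.mono {g : ℕ} {k k' l l' : ℕ} {L : List (D g)} (hk : k ≤ k') (hl : l ≤ l')
    (h : Ok k' l' L) : Ok k l L := by
  induction L generalizing k k' l l' with
  | nil => trivial
  | cons τ L ih =>
    obtain ⟨h0, h1, h2, h3⟩ := h
    exact ⟨h0, (step_mono hk τ).trans_lt h1, (step_mono hl _).trans_lt h2,
      ih (step_mono hk τ) (step_mono hl _) h3⟩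

theorem Ok.neg {g : ℕ} {k l : ℕ} {L : List (D g)} (h : Ok k l L) :
    Ok l k (L.map (fun x => -x)) := by
  induction L generalizing k l with
  | nil => trivial
  | cons τ L ih =>
    obtain ⟨h0, h1, h2, h3⟩ := h
    refine ⟨by simpa using h0, h2, by simpa using h1, ?_⟩
    simpa using ih h3

theorem Ok.neg_iff {g : ℕ} {k l : ℕ} {L : List (D g)} :
    Ok l k (L.map (fun x => -x)) ↔ Ok k l L := by
  constructor
  · intro h; simpa [Function.comp_def] using h.neg
  · exact Ok.neg

theorem Ok.ne0 {g : ℕ} {k l : ℕ} {L : List (D g)} (h : Ok k l L) : (0 : D g) ∉ L := by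
  induction L generalizing k l with
  | nil => simp
  | cons τ L ih =>
    obtain ⟨h0, h1, h2, h3⟩ := h
    simp only [List.mem_cons, not_or]
    exact ⟨fun h => h0 h.symm, ih h3⟩

theorem eps_hf {g : ℕ} {ε : D g} (hε : ε = 1 ∨ ε = -1) : ε * hf g = hf g := by
  have hh := hf_add g
  rcases hε with rfl | rfl
  · ring
  · linear_combination -hh

theorem eps_sq {g : ℕ} {ε : D g} (hε : ε = 1 ∨ ε = -1) : ε * ε = 1 := by
  rcases hε with rfl | rfl <;> ring

theorem two_ne_one {g : ℕ} (hg : 2 ≤ g) : (2 : D g) ≠ 1 := by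
  intro h
  apply sm hg 1 (by norm_num) (by norm_num) (by norm_num)
  push_cast; linear_combination h

/-- dichotomy for paths equivalent to one following a tile -/
theorem follow {g : ℕ} (hg : 2 ≤ g) {ε : D g} (hε : ε = 1 ∨ ε = -1) (W : List (D g)) (j : ℕ) :
    ∀ (y : D g) (Y : List (D g)), E g Y (fr (ε*(hf g+1)) (y+ε*(hf g+1)) (j+1) ++ W) →
    0 ∈ tf y Y ∨ (∃ T, tf y Y = List.replicate (j+1) ε ++ T) ∨
    (∃ t Y' W', tf y Y = List.replicate j ε ++ (2*ε) :: tf t Y' ∧ Y'.length < Y.length ∧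
      E g Y' (fr (ε*(hf g+1)) (t+ε*(hf g+1)) (2*g-1) ++ W')) := by
  have hh := hf_add g
  have he := eps_hf hε
  induction j with
  | zero =>
    intro y Y h
    rcases Y with _ | ⟨t, Y⟩
    · exact absurd h.len (by simp [fr])
    simp only [fr, List.cons_append, List.nil_append] at h
    rcases h.inv with ⟨rfl, h'⟩ | ⟨ε', W', hε', h', ha, hb⟩
    · right; left
      refine ⟨tf (y+ε*(hf g+1)) Y, ?_⟩
      simp only [tf, List.replicate, List.cons_append, List.nil_append]
      congr 1; linear_combination he
    · by_cases hee : ε' = ε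
      · subst hee
        right; right
        refine ⟨t, Y, W', ?_, by simp, ha⟩
        simp only [tf, List.replicate, List.nil_append]
        congr 1; linear_combination he - h'
      · have hee' : ε' = -ε := by
          rcases hε with rfl | rfl <;> rcases hε' with rfl | rfl <;> simp_all
        left
        simp only [tf, List.mem_cons]; left
        subst hee'
        linear_combination h' - he
  | succ j ih =>
    intro y Y h
    rcases Y with _ | ⟨t, Y⟩
    · exact absurd h.len (by simp [fr])
    rw [fr] at h
    simp only [List.cons_append] at h
    rcases h.inv with ⟨rfl, h'⟩ | ⟨ε', W', hε', h', ha, hb⟩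
    · have e : y + ε*(hf g+1) - y - hf g = ε := by linear_combination he
      simp only [tf, e]
      rcases ih _ Y h' with h1 | ⟨T, h1⟩ | ⟨u, Y', W', h1, h2, h3⟩
      · left; simp [h1]
      · right; left; refine ⟨T, ?_⟩; rw [h1]; rfl
      · right; right; refine ⟨u, Y', W', ?_, by simp; omega, h3⟩
        rw [h1]; rfl
    · by_cases hee : ε' = ε
      · subst hee
        exfalso
        rw [fr_pos (-(ε'*(hf g+1))) _ _ (by omega), fr] at hb
        simp only [List.cons_append] at hb
        rw [← h'] at hb
        exact E.no3 hg hε hb.symm'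
      · have hee' : ε' = -ε := by
          rcases hε with rfl | rfl <;> rcases hε' with rfl | rfl <;> simp_all
        left
        simp only [tf, List.mem_cons]; left
        subst hee'
        linear_combination h' - he

theorem Ok_rep {g : ℕ} {k l j : ℕ} {T : List (D g)} (h : Ok k l (List.replicate j 1 ++ T)) :
    ∃ l', Ok (k+j) l' T ∧ (0 < j → k + j < 2*g) := by
  induction j generalizing k l with
  | zero => exact ⟨l, by simpa using h, by simp⟩
  | succ j ih =>
    simp only [List.replicate_succ, List.cons_append] at h
    obtain ⟨h0, h1, h2, h3⟩ := h
    simp only [step, if_true] at h1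
    have h3' := h3
    obtain ⟨l', h4, h5⟩ := ih h3
    refine ⟨l', ?_, ?_⟩
    · simp only [step, if_true] at h4; convert h4 using 1; omega
    · intro _
      rcases Nat.eq_zero_or_pos j with rfl | hj
      · simpa using h1
      · have := h5 hj; simp only [step, if_true] at this; omega

theorem bad_follow {g : ℕ} (hg : 2 ≤ g) {ε : D g} (hε : ε = 1 ∨ ε = -1) : ∀ (n : ℕ)
    (y : D g) (Y W : List (D g)), Y.length = n →
    E g Y (fr (ε*(hf g+1)) (y+ε*(hf g+1)) (2*g-1) ++ W) →
    ∀ l, ¬ Ok 1 l ((tf y Y).map (fun x => ε*x)) := by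
  intro n
  induction n using Nat.strong_induction_on with
  | _ n ih =>
  intro y Y W hn h l hok
  have e : 2*g-1 = (2*g-2)+1 := by omega
  rw [e] at h
  have hs := eps_sq hε
  rcases follow hg hε W _ y Y h with h1 | ⟨T, h1⟩ | ⟨t, Y', W', h1, h2, h3⟩
  · exact hok.ne0 (List.mem_map.2 ⟨0, h1, by simp⟩)
  · rw [h1, List.map_append, List.map_replicate, hs] at hok
    obtain ⟨_, _, h⟩ := Ok_rep hok
    have := h (by omega); omega
  · rw [h1, List.map_append, List.map_replicate, hs] at hok
    obtain ⟨l', hok', _⟩ := Ok_rep hok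
    simp only [List.map_cons] at hok'
    have e2 : ε * (2*ε) = 2 := by linear_combination 2*hs
    rw [e2] at hok'
    obtain ⟨_, _, _, h4⟩ := hok'
    have e3 : step (1 + (2*g-2)) (2 : D g) = 1 := by
      unfold step; rw [if_neg (two_ne_one hg), if_pos ⟨rfl, by omega⟩]
    rw [e3] at h4
    exact ih _ (by omega) t Y' W' rfl h3 _ h4

theorem good_red {g : ℕ} (hg : 2 ≤ g) (y : D g) (Y : List (D g)) (h : Ok 0 0 (tf y Y)) :
    Red (y::Y) := by
  induction Y generalizing y with
  | nil => exact ⟨trivial, fun V hV => by cases hV⟩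
  | cons t Y ih =>
    refine ⟨ih t ?_, ?_⟩
    · exact h.2.2.2.mono (Nat.zero_le _) (Nat.zero_le _)
    · intro V hV
      rcases hV.inv with ⟨rfl, h'⟩ | ⟨ε, W, hε, h', ha, hb⟩
      · exact h.1 (by ring)
      · have e : t - y - hf g = ε := by linear_combination -h'
        have hs := eps_sq hε
        have hok : Ok 0 0 ((tf y (t::Y)).map (fun x => ε*x)) := by
          rcases hε with rfl | rfl
          · simpa using h
          · simpa using h.neg
        simp only [tf, List.map_cons, e, hs] at hok
        have h4 := hok.2.2.2
        have e3 : step 0 (1 : D g) = 1 := by simp [step]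
        rw [e3] at h4
        exact bad_follow hg hε _ t Y W rfl ha _ h4

theorem good_geo {g : ℕ} (hg : 2 ≤ g) (y : SG.Letter g) (W W' : SG.Word g)
    (h : Ok 0 0 (tf (dir y) (W.map dir)))
    (e : SG.eval g W' = SG.eval g (y::W)) : W.length + 1 ≤ W'.length := by
  have := red_geo hg (y::W) W' (good_red hg _ _ h) e
  simpa using this

end SGP


namespace SGP

theorem dir_surj {g : ℕ} (hg : 2 ≤ g) : Function.Surjective (dir (g := g)) := by
  intro d
  have hh := hf_add g
  have hm := hf_mul g
  have : NeZero (4*g) := ⟨by omega⟩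
  set n := ((hf g + 1) * d).val with hn
  have hlt : n < 4*g := ZMod.val_lt _
  have hcast : (n : D g) = (hf g + 1) * d := ZMod.natCast_zmod_val _
  by_cases h : n < 2*g
  · refine ⟨(⟨n, h⟩, true), ?_⟩
    simp only [dir, if_true, hcast]
    linear_combination d*hm + d*hh
  · refine ⟨(⟨n-2*g, by omega⟩, false), ?_⟩
    have e : ((n-2*g:ℕ) : D g) = n - hf g := by
      rw [Nat.cast_sub (by omega)]; rfl
    simp only [dir, e, hcast]
    simp only [Bool.false_eq_true, if_false]
    linear_combination d*hm + d*hh - hm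

theorem dir_bij {g : ℕ} (hg : 2 ≤ g) : Function.Bijective (dir (g := g)) := by
  have : NeZero (4*g) := ⟨by omega⟩
  apply (Nat.bijective_iff_surjective_and_card _).2
  refine ⟨dir_surj hg, ?_⟩
  simp [Nat.card_eq_fintype_card, ZMod.card]; ring

/-- the letter of a direction -/
noncomputable def ltr {g : ℕ} (hg : 2 ≤ g) (d : D g) : SG.Letter g := (dir_surj hg d).choose

theorem dir_ltr {g : ℕ} (hg : 2 ≤ g) (d : D g) : dir (ltr hg d) = d := (dir_surj hg d).choose_spec

theorem ltr_dir {g : ℕ} (hg : 2 ≤ g) (a : SG.Letter g) : ltr hg (dir a) = a :=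
  (dir_bij hg).1 (dir_ltr hg _)

theorem dir_inv {g : ℕ} (a : SG.Letter g) : dir (SG.invLetter g a) = dir a + hf g := by
  have hh := hf_add g
  obtain ⟨i, b⟩ := a
  cases b <;> simp [dir, SG.invLetter]
  linear_combination -hh

theorem ltr_hf {g : ℕ} (hg : 2 ≤ g) (d : D g) : ltr hg (d + hf g) = SG.invLetter g (ltr hg d) := by
  apply (dir_bij hg).1
  rw [dir_ltr, dir_inv, dir_ltr]

noncomputable def ev {g : ℕ} (hg : 2 ≤ g) (d : D g) : SG.SurfaceGroup g :=
  SG.evalLetter g (ltr hg d)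

theorem ev_hf {g : ℕ} (hg : 2 ≤ g) (d : D g) : ev hg (d + hf g) = (ev hg d)⁻¹ := by
  unfold ev
  rw [ltr_hf]
  generalize ltr hg d = a
  obtain ⟨i, b⟩ := a
  cases b <;> simp [SG.evalLetter, SG.invLetter]

noncomputable def pr {g : ℕ} (hg : 2 ≤ g) (L : List (D g)) : SG.SurfaceGroup g :=
  (L.map (ev hg)).prod

theorem pr_cons {g : ℕ} (hg : 2 ≤ g) (d : D g) (L : List (D g)) :
    pr hg (d::L) = ev hg d * pr hg L := by simp [pr]

theorem pr_app {g : ℕ} (hg : 2 ≤ g) (L M : List (D g)) :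
    pr hg (L++M) = pr hg L * pr hg M := by simp [pr]

theorem eval_pr {g : ℕ} (hg : 2 ≤ g) (W : SG.Word g) : SG.eval g W = pr hg (W.map dir) := by
  simp only [SG.eval, pr, List.map_map]
  congr 1
  apply List.map_congr_left
  intro a _
  simp [ev, ltr_dir]

theorem pr_eval {g : ℕ} (hg : 2 ≤ g) (L : List (D g)) : SG.eval g (L.map (ltr hg)) = pr hg L := by
  rw [eval_pr hg, List.map_map]
  congr 1
  simp [Function.comp_def, dir_ltr]

theorem pr_rel0 {g : ℕ} (hg : 2 ≤ g) : pr hg (fr (hf g + 1) 0 (2*g+2*g)) = 1 := by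
  rw [← Rword_dir, ← eval_pr]
  have h : (PresentedGroup.mk ({SG.relator g} : Set (FreeGroup (Fin (2*g))))
      ((List.ofFn fun i : Fin (2*g) => FreeGroup.of i).prod *
        (List.ofFn fun i : Fin (2*g) => (FreeGroup.of i)⁻¹).prod)) = 1 :=
    PresentedGroup.one_of_mem (Set.mem_singleton _)
  rw [← h, SG.eval, SG.Rword, map_mul, map_list_prod, map_list_prod, List.map_append,
    List.prod_append]
  simp only [List.map_ofFn]
  congr 3

theorem pr_rel {g : ℕ} (hg : 2 ≤ g) (N : ℕ) (hN : N = 2*g+2*g) (d : D g) :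
    pr hg (fr (hf g + 1) d N) = 1 := by
  have hh := hf_add g
  have hm := hf_mul g
  have : NeZero (4*g) := ⟨by omega⟩
  have key : ∀ n : ℕ, pr hg (fr (hf g + 1) (n*(hf g + 1)) N) = 1 := by
    intro n
    induction n with
    | zero => simpa [hN] using pr_rel0 hg
    | succ n ih =>
      obtain ⟨k, hk⟩ : ∃ k, N = k+1 := ⟨N-1, by omega⟩
      have hk2 : (k:D g) = -1 := by
        have : ((k+1:ℕ):D g) = 0 := by
          rw [← hk, hN]; push_cast; have := hf_add g; unfold hf at this; push_cast at this; exact this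
        push_cast at this; linear_combination this
      rw [hk] at ih ⊢
      rw [fr, pr_cons] at ih
      rw [fr_succ_right, pr_app, pr_cons]
      have e1 : ((n+1:ℕ):D g)*(hf g+1) = n*(hf g+1) + (hf g+1) := by push_cast; ring
      have e2 : n*(hf g+1) + (hf g+1) + (k:D g)*(hf g+1) = n*(hf g+1) := by rw [hk2]; ring
      rw [e1, e2]
      simp only [pr, List.map_nil, List.prod_nil, mul_one] at ih ⊢
      exact mul_eq_one_iff_eq_inv.2 (eq_inv_of_mul_eq_one_right ih)
  have h := key ((hf g+1)*d).val
  rw [ZMod.natCast_zmod_val] at h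
  convert h using 3
  linear_combination -d*hm - d*hh

theorem pr_cancel {g : ℕ} (hg : 2 ≤ g) (c a : D g) (k : ℕ) :
    pr hg (fr c a k) * pr hg (fr (-c) (a + hf g + k*c - c) k) = 1 := by
  induction k with
  | zero => simp [pr, fr]
  | succ k ih =>
    rw [fr_succ_right, pr_app]
    simp only [fr, pr_cons]
    have e : a + hf g + ((k+1:ℕ):D g)*c - c = (a + k*c) + hf g := by push_cast; ring
    rw [e, ev_hf]
    have e2 : a + k*c + hf g + -c = a + hf g + k*c - c := by ring
    rw [e2]
    simp only [pr, List.map_nil, List.prod_nil, mul_one] at ih ⊢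
    rw [mul_assoc, mul_inv_cancel_left]; exact ih

theorem pr_flip {g : ℕ} (hg : 2 ≤ g) (s : D g) :
    pr hg (fr (hf g + 1) s (2*g)) = pr hg (fr (-(hf g + 1)) (s-1) (2*g)) := by
  have hh := hf_add g
  have hm := hf_mul g
  have hc : ((2*g:ℕ):D g) = hf g := rfl
  have h1 := pr_rel hg _ rfl s
  rw [fr_add, pr_app, hc] at h1
  have e1 : s + hf g*(hf g+1) = s + hf g := by linear_combination hm
  rw [e1] at h1
  have h2 := pr_cancel hg (hf g+1) (s + hf g) (2*g)
  rw [hc] at h2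
  have e2 : s + hf g + hf g + hf g*(hf g+1) - (hf g+1) = s - 1 := by linear_combination hm + hh
  rw [e2] at h2
  rw [mul_eq_one_iff_eq_inv] at h1
  rw [h1]
  exact (eq_inv_of_mul_eq_one_right h2).symm

/-- path with given turns -/
def path {g : ℕ} : D g → List (D g) → List (D g)
  | _, [] => []
  | d, τ::L => (d + hf g + τ) :: path (d + hf g + τ) L

/-- last direction -/
def fin {g : ℕ} : D g → List (D g) → D g
  | d, [] => d
  | d, τ::L => fin (d + hf g + τ) L

theorem path_app {g : ℕ} (d : D g) (L M : List (D g)) :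
    path d (L++M) = path d L ++ path (fin d L) M := by
  induction L generalizing d with
  | nil => rfl
  | cons τ L ih => simp [path, fin, ih]

theorem fin_app {g : ℕ} (d : D g) (L M : List (D g)) :
    fin d (L++M) = fin (fin d L) M := by
  induction L generalizing d with
  | nil => rfl
  | cons τ L ih => simp [fin, ih]

theorem path_tf {g : ℕ} (d : D g) (Y : List (D g)) : path d (tf d Y) = Y := by
  induction Y generalizing d with
  | nil => rfl
  | cons s Y ih =>
    have e : d + hf g + (s - d - hf g) = s := by ring
    simp only [tf, path, e, ih]

theorem tf_path {g : ℕ} (d : D g) (L : List (D g)) : tf d (path d L) = L := by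
  induction L generalizing d with
  | nil => rfl
  | cons s Y ih =>
    have e : d + hf g + s - d - hf g = s := by ring
    simp only [tf, path, e, ih]

theorem path_length {g : ℕ} (d : D g) (L : List (D g)) : (path d L).length = L.length := by
  induction L generalizing d with
  | nil => rfl
  | cons s Y ih => simp [path, ih]

theorem tf_length {g : ℕ} (d : D g) (L : List (D g)) : (tf d L).length = L.length := by
  induction L generalizing d with
  | nil => rfl
  | cons s Y ih => simp [tf, ih]

theorem path_rep {g : ℕ} (d ε : D g) (hε : ε = 1 ∨ ε = -1) (k : ℕ) :
    path d (List.replicate k ε) = fr (ε*(hf g+1)) (d + ε*(hf g+1)) k := by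
  have he := eps_hf hε
  induction k generalizing d with
  | zero => rfl
  | succ k ih =>
    have e : d + hf g + ε = d + ε*(hf g+1) := by linear_combination -he
    simp only [List.replicate_succ, path, fr, ih, e]

theorem fin_rep {g : ℕ} (d ε : D g) (hε : ε = 1 ∨ ε = -1) (k : ℕ) :
    fin d (List.replicate k ε) = d + k * (ε*(hf g+1)) := by
  have he := eps_hf hε
  induction k generalizing d with
  | zero => simp [fin]
  | succ k ih =>
    simp only [List.replicate_succ, fin, ih]
    push_cast; linear_combination -he

/-- equality of turn sequences in the group -/
inductive Eqv (g : ℕ) : List (D g) → List (D g) → Prop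
  | refl (L) : Eqv g L L
  | symm {L M} : Eqv g L M → Eqv g M L
  | trans {L M N} : Eqv g L M → Eqv g M N → Eqv g L N
  | ctx (u v) {L M} : Eqv g L M → Eqv g (u ++ L ++ v) (u ++ M ++ v)
  | pop (t t' : D g) : Eqv g [t, 0, t'] [t + t']
  | flip (t t' : D g) : Eqv g (t :: (List.replicate (2*g-1) 1 ++ [t']))
      ((t-1) :: (List.replicate (2*g-1) (-1) ++ [t'-1]))

theorem Eqv.neg {g : ℕ} {L M : List (D g)} (h : Eqv g L M) :
    Eqv g (L.map (fun x => -x)) (M.map (fun x => -x)) := by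
  induction h with
  | refl L => exact .refl _
  | symm _ ih => exact ih.symm
  | trans _ _ ih1 ih2 => exact ih1.trans ih2
  | ctx u v _ ih => simp only [List.map_append]; exact ih.ctx _ _
  | pop t t' =>
    have := Eqv.pop (-t) (-t')
    simpa [add_comm] using this
  | flip t t' =>
    have := (Eqv.flip (-t+1) (-t'+1)).symm
    simpa [add_comm, sub_eq_add_neg] using this

theorem Eqv.sound {g : ℕ} (hg : 2 ≤ g) {L M : List (D g)} (h : Eqv g L M) :
    ∀ d, pr hg (path d L) = pr hg (path d M) ∧ fin d L = fin d M := by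
  have hh := hf_add g
  have hm := hf_mul g
  induction h with
  | refl L => intro d; exact ⟨rfl, rfl⟩
  | symm _ ih => intro d; exact ⟨(ih d).1.symm, (ih d).2.symm⟩
  | trans _ _ ih1 ih2 => intro d; exact ⟨(ih1 d).1.trans (ih2 d).1, (ih1 d).2.trans (ih2 d).2⟩
  | ctx u v _ ih =>
    intro d
    simp only [path_app, fin_app, pr_app]
    rw [(ih _).1, (ih _).2]; exact ⟨rfl, rfl⟩
  | pop t t' =>
    intro d
    simp only [path, fin, pr_cons]
    have e : d + hf g + t + hf g + 0 + hf g + t' = d + hf g + (t + t') := by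
      linear_combination hh
    rw [e, add_zero, ev_hf, mul_inv_cancel_left]; exact ⟨rfl, rfl⟩
  | flip t t' =>
    intro d
    obtain ⟨k, hk⟩ : ∃ k, 2*g = k+1 := ⟨2*g-1, by omega⟩
    have hk3 : 2*g-1 = k := by omega
    have hk2 : (k:D g) = hf g - 1 := by
      have : ((2*g:ℕ):D g) = ((k+1:ℕ):D g) := by rw [hk]
      have hc : ((2*g:ℕ):D g) = hf g := rfl
      rw [hc] at this; push_cast at this; linear_combination -this
    have hfl := pr_flip hg (d + hf g + t)
    rw [hk] at hfl
    simp only [fr, pr_cons] at hfl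
    simp only [hk3, path, fin, pr_cons, path_app, fin_app, pr_app]
    rw [path_rep _ _ (.inl rfl), path_rep _ _ (.inr rfl), fin_rep _ _ (.inl rfl),
      fin_rep _ _ (.inr rfl), ← mul_assoc, ← mul_assoc, one_mul]
    have e1 : d + hf g + (t - 1) = d + hf g + t - 1 := by ring
    have e2 : -1 * (hf g + 1) = -(hf g+1) := by ring
    rw [e1, e2, hfl, hk2]
    have e3 : d + hf g + t + (hf g - 1)*(hf g+1) + hf g + t' =
      d + hf g + t - 1 + (hf g - 1)*(-(hf g+1)) + hf g + (t' - 1) := by linear_combination 2*hm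
    rw [e3]; exact ⟨by simp only [mul_assoc], rfl⟩

end SGP


namespace SGP

theorem ne_of_sub {g : ℕ} (hg : 2 ≤ g) (k l : ℤ) (h : k ≠ l) (h1 : k - l < 8) (h2 : -8 < k - l) :
    (k : D g) ≠ (l : D g) := by
  intro e
  apply sm hg (k-l) (by omega) h1 h2
  push_cast; rw [e]; ring

/-- block of ones -/
abbrev o (g : ℕ) (j : ℕ) : List (D g) := List.replicate j 1

/-- block of minus ones -/
abbrev n (g : ℕ) (j : ℕ) : List (D g) := List.replicate j (-1)

/-- negation of turn lists -/
abbrev ng {g : ℕ} (L : List (D g)) : List (D g) := L.map (fun x => -x)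

def S (g : ℕ) : ℕ → List (D g)
  | 0 => o g (2*g-2)
  | m+1 => o g (2*g-2) ++ 2 :: S g m

abbrev nS (g : ℕ) (m : ℕ) : List (D g) := ng (S g m)

theorem S_snoc (g m : ℕ) : S g m ++ 2 :: S g 0 = S g (m+1) := by
  induction m with
  | zero => rfl
  | succ m ih =>
    show (o g (2*g-2) ++ 2 :: S g m) ++ 2 :: S g 0 = o g (2*g-2) ++ 2 :: S g (m+1)
    rw [List.append_assoc, List.cons_append, ih]

theorem S_len (g m : ℕ) : (S g m).length = (m+1)*(2*g-2) + m := by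
  induction m with
  | zero => simp [S]
  | succ m ih => simp [S, ih]; ring

def rp {g : ℕ} (k : ℕ) (L : List (D g)) : ℕ := L.foldl step k
def rn {g : ℕ} (k : ℕ) (L : List (D g)) : ℕ := L.foldl (fun k t => step k (-t)) k

theorem Ok_app {g : ℕ} {k l : ℕ} {A B : List (D g)} :
    Ok k l (A++B) ↔ Ok k l A ∧ Ok (rp k A) (rn l A) B := by
  induction A generalizing k l with
  | nil => simp [Ok, rp, rn]
  | cons t A ih => simp only [List.cons_append, Ok, ih, rp, rn, List.foldl_cons]; tauto

theorem rp_app {g : ℕ} (k : ℕ) (A B : List (D g)) : rp k (A++B) = rp (rp k A) B := by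
  simp [rp]
theorem rn_app {g : ℕ} (k : ℕ) (A B : List (D g)) : rn k (A++B) = rn (rn k A) B := by
  simp [rn]
theorem rp_cons {g : ℕ} (k : ℕ) (t : D g) (B : List (D g)) : rp k (t::B) = rp (step k t) B := rfl
theorem rn_cons {g : ℕ} (k : ℕ) (t : D g) (B : List (D g)) : rn k (t::B) = rn (step k (-t)) B := rfl

theorem rp_neg {g : ℕ} (k : ℕ) (A : List (D g)) : rp k (ng A) = rn k A := by
  simp [rp, rn, List.foldl_map]
theorem rn_neg {g : ℕ} (k : ℕ) (A : List (D g)) : rn k (ng A) = rp k A := by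
  simp [rp, rn, List.foldl_map]

theorem Ok_lt {g : ℕ} {k l : ℕ} {A : List (D g)} (h : Ok k l A) (hk : k < 2*g) (hl : l < 2*g) :
    rp k A < 2*g ∧ rn l A < 2*g := by
  induction A generalizing k l with
  | nil => exact ⟨hk, hl⟩
  | cons t A ih => exact ih h.2.2.2 h.2.1 h.2.2.1

theorem step_one {g : ℕ} (k : ℕ) : step k (1 : D g) = k+1 := by simp [step]

theorem step_neg1 {g : ℕ} (hg : 2 ≤ g) (k : ℕ) : step k (-1 : D g) = 0 := by
  have h1 := ne_of_sub hg (-1) 1 (by norm_num) (by norm_num) (by norm_num)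
  have h2 := ne_of_sub hg (-1) 2 (by norm_num) (by norm_num) (by norm_num)
  push_cast at h1 h2
  simp [step, h1, h2]

theorem step_neg2 {g : ℕ} (hg : 2 ≤ g) (k : ℕ) : step k (-2 : D g) = 0 := by
  have h1 := ne_of_sub hg (-2) 1 (by norm_num) (by norm_num) (by norm_num)
  have h2 := ne_of_sub hg (-2) 2 (by norm_num) (by norm_num) (by norm_num)
  push_cast at h1 h2
  simp [step, h1, h2]

theorem step_two {g : ℕ} (hg : 2 ≤ g) (k : ℕ) : step k (2 : D g) = if 2*g-1 ≤ k then 1 else 0 := by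
  simp [step, two_ne_one hg]

theorem step_le_one {g : ℕ} {k : ℕ} {t : D g} (h : t ≠ 1) : step k t ≤ 1 := by
  unfold step; rw [if_neg h]; split_ifs <;> omega

theorem step_small {g : ℕ} {k : ℕ} {t : D g} (h : t ≠ 1) (hk : k < 2*g-1) : step k t = 0 := by
  unfold step; rw [if_neg h, if_neg]; omega

theorem step_ne2 {g : ℕ} {k : ℕ} {t : D g} (h : t ≠ 1) (h2 : t ≠ 2) : step k t = 0 := by
  simp [step, h, h2]

theorem one_ne0 {g : ℕ} (hg : 2 ≤ g) : (1 : D g) ≠ 0 := by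
  have := sm hg 1 (by norm_num) (by norm_num) (by norm_num); simpa using this
theorem two_ne0 {g : ℕ} (hg : 2 ≤ g) : (2 : D g) ≠ 0 := by
  have := sm hg 2 (by norm_num) (by norm_num) (by norm_num); simpa using this

theorem rp_o {g : ℕ} (k j : ℕ) : rp k (o g j) = k + j := by
  induction j generalizing k with
  | zero => rfl
  | succ j ih => rw [o, List.replicate_succ, rp_cons, step_one, ih]; omega

theorem rn_o {g : ℕ} (hg : 2 ≤ g) (k j : ℕ) : rn k (o g (j+1)) = 0 := by
  induction j generalizing k with
  | zero => simp [rn, step_neg1 hg]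
  | succ j ih => rw [o, List.replicate_succ, rn_cons, ih]

theorem rn_o0 {g : ℕ} (hg : 2 ≤ g) (j : ℕ) : rn 0 (o g j) = 0 := by
  cases j with
  | zero => rfl
  | succ j => exact rn_o hg _ _

theorem Ok_o {g : ℕ} (hg : 2 ≤ g) (k l j : ℕ) (h : k + j < 2*g) : Ok k l (o g j) := by
  induction j generalizing k l with
  | zero => trivial
  | succ j ih =>
    rw [o, List.replicate_succ]
    refine ⟨one_ne0 hg, by rw [step_one]; omega, by rw [step_neg1 hg]; omega, ?_⟩
    exact ih _ _ (by rw [step_one]; omega)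

theorem S_run {g : ℕ} (hg : 2 ≤ g) (m l : ℕ) :
    Ok 0 l (S g m) ∧ rp 0 (S g m) = 2*g-2 ∧ rn l (S g m) = 0 := by
  obtain ⟨j, hj⟩ : ∃ j, 2*g-2 = j+1 := ⟨2*g-3, by omega⟩
  induction m generalizing l with
  | zero =>
    simp only [S]
    refine ⟨Ok_o hg _ _ _ (by omega), by rw [rp_o]; omega, by rw [hj, rn_o hg]⟩
  | succ m ih =>
    have hr : rp 0 (o g (2*g-2)) = 2*g-2 := by rw [rp_o]; omega
    have hn : rn l (o g (2*g-2)) = 0 := by rw [hj, rn_o hg]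
    have hs : step (2*g-2) (2:D g) = 0 := by rw [step_two hg, if_neg]; omega
    simp only [S]
    rw [Ok_app, rp_app, rn_app, hr, hn, rp_cons, rn_cons, hs, step_neg2 hg]
    refine ⟨⟨Ok_o hg _ _ _ (by omega), two_ne0 hg, by rw [hs]; omega,
      by rw [step_neg2 hg]; omega, ?_⟩, (ih 0).2.1, (ih 0).2.2⟩
    rw [hs, step_neg2 hg]; exact (ih 0).1

theorem nS_run {g : ℕ} (hg : 2 ≤ g) (m k : ℕ) :
    Ok k 0 (nS g m) ∧ rp k (nS g m) = 0 ∧ rn 0 (nS g m) = 2*g-2 := by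
  rw [rp_neg, rn_neg, Ok.neg_iff]
  have := S_run hg m k
  tauto

/-- partial patterns -/
def Part (g : ℕ) (k : ℕ) (M : List (D g)) : Prop := M = o g k ∨ ∃ m, M = S g m ++ 2 :: o g k

theorem Part.S {g k : ℕ} {M : List (D g)} (h : Part g k M) (hk : k = 2*g-2) : ∃ m, M = S g m := by
  subst hk
  rcases h with h | ⟨m, h⟩
  · exact ⟨0, h⟩
  · exact ⟨m+1, by rw [h, ← S_snoc]; rfl⟩

theorem Part.one {g k : ℕ} {M : List (D g)} (h : Part g k M) : Part g (k+1) (M ++ [1]) := by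
  rcases h with h | ⟨m, h⟩
  · left; rw [h]; exact (List.replicate_succ').symm
  · right; exact ⟨m, by rw [h, o, o, List.replicate_succ']; simp⟩

theorem Part.ones {g k : ℕ} {M : List (D g)} (h : Part g k M) (j : ℕ) : Part g (k+j) (M ++ o g j) := by
  induction j with
  | zero => simpa using h
  | succ j ih =>
    have := ih.one
    rw [o, List.replicate_succ']
    simpa [add_assoc] using this

theorem Part.two {g : ℕ} (m : ℕ) : Part g 0 (SGP.S g m ++ [2]) := .inr ⟨m, rfl⟩

theorem struct {g : ℕ} (hg : 2 ≤ g) (C : List (D g)) :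
    ∀ j, Ok 0 0 C → rp 0 C = j+1 → ∃ D M, C = D ++ 1 :: M ∧ Part g j M := by
  induction C using List.reverseRecOn with
  | nil => intro j _ h; simp [rp] at h
  | append_singleton C t ih =>
    intro j hok h
    rw [rp_app, rp_cons] at h
    change step (rp 0 C) t = j+1 at h
    rw [Ok_app] at hok
    have hlt := (Ok_lt hok.1 (by omega) (by omega)).1
    by_cases h1 : t = 1
    · subst h1
      rw [step_one] at h
      rcases j with _ | j
      · exact ⟨C, [], rfl, .inl rfl⟩
      · obtain ⟨D, M, rfl, hM⟩ := ih j hok.1 (by omega)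
        exact ⟨D, M ++ [1], by simp, hM.one⟩
    · by_cases h2 : t = 2
      · subst h2
        rw [step_two hg] at h
        split_ifs at h with hh
        have hj : j = 0 := by omega
        subst hj
        obtain ⟨D, M, rfl, hM⟩ := ih (2*g-2) hok.1 (by omega)
        obtain ⟨m, rfl⟩ := hM.S rfl
        exact ⟨D, SGP.S g m ++ [2], by simp, Part.two m⟩
      · rw [step_ne2 h1 h2] at h; omega

/-! ### moves -/

theorem Eqv.app_right {g : ℕ} {L M : List (D g)} (h : Eqv g L M) (v : List (D g)) :
    Eqv g (L ++ v) (M ++ v) := by simpa using h.ctx [] v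

theorem Eqv.app_left {g : ℕ} {L M : List (D g)} (h : Eqv g L M) (u : List (D g)) :
    Eqv g (u ++ L) (u ++ M) := by simpa using h.ctx u []

theorem eqv_S {g : ℕ} (hg : 2 ≤ g) (m : ℕ) (t t' : D g) :
    Eqv g (t :: 1 :: (S g m ++ [1, t'])) ((t-1) :: (nS g m ++ [t'-1])) := by
  have hj : 2*g-1 = (2*g-2)+1 := by omega
  have e0 : ∀ r : D g, Eqv g (t :: 1 :: (o g (2*g-2) ++ [r]))
      ((t-1) :: (n g (2*g-2) ++ [-1, r-1])) := by
    intro r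
    have h := Eqv.flip t r
    rw [hj] at h
    convert h using 1
    · rfl
    · rw [List.replicate_succ' (a := (-1 : D g))]; simp
  induction m generalizing t with
  | zero =>
    simp only [S, nS, ng, List.map_replicate]
    have h1 := (e0 1).app_right [t']
    simp only [List.cons_append, List.append_assoc, List.nil_append] at h1
    refine h1.trans ?_
    have h2 := (Eqv.pop (-1) t').app_left ((t-1) :: n g (2*g-2))
    simpa [sub_eq_add_neg, add_comm] using h2
  | succ m ih =>
    simp only [S, nS, ng, List.map_append, List.map_replicate, List.map_cons]
    have h1 := (e0 2).app_right (S g m ++ [1, t'])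
    have e2 : (2:D g) - 1 = 1 := by ring
    simp only [List.cons_append, List.append_assoc, List.nil_append, e2] at h1 ⊢
    refine h1.trans ?_
    have h2 := (ih (-1) ?_).app_left ((t-1) :: n g (2*g-2))
    · have e3 : (-1:D g) - 1 = -2 := by ring
      simpa [e3] using h2
    · intro r
      have h := Eqv.flip (-1) r
      rw [hj] at h
      convert h using 1
      · rfl
      · rw [List.replicate_succ' (a := (-1 : D g))]; simp

theorem eqv_zip {g : ℕ} (j : ℕ) (τ : D g) :
    Eqv g (n g (j+1) ++ 0 :: (o g j ++ [τ])) [τ - 1] := by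
  induction j with
  | zero =>
    have := Eqv.pop (-1) τ
    simpa [sub_eq_add_neg, add_comm] using this
  | succ j ih =>
    refine Eqv.trans ?_ ih
    have h := ((Eqv.pop (-1) (1:D g)).app_right (o g j ++ [τ])).app_left (n g (j+1))
    rw [n, List.replicate_succ']
    simpa [List.replicate_succ] using h

/-- decrease the last entry -/
def dL {g : ℕ} : List (D g) → List (D g)
  | [] => []
  | [t] => [t-1]
  | t::s::L => t :: dL (s::L)

theorem dL_snoc {g : ℕ} (L : List (D g)) (t : D g) : dL (L ++ [t]) = L ++ [t-1] := by
  induction L with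
  | nil => rfl
  | cons a L ih =>
    cases L with
    | nil => rfl
    | cons b L => simp only [List.cons_append, dL] at ih ⊢; rw [ih]

theorem dL_length {g : ℕ} (L : List (D g)) : (dL L).length = L.length := by
  induction L using List.reverseRecOn with
  | nil => rfl
  | append_singleton L t _ => simp [dL_snoc]

theorem dL_app {g : ℕ} (L M : List (D g)) (h : M ≠ []) : dL (L ++ M) = L ++ dL M := by
  induction M using List.reverseRecOn with
  | nil => simp at h
  | append_singleton M t _ => rw [← List.append_assoc, dL_snoc, dL_snoc, List.append_assoc]

theorem dL_cons {g : ℕ} (s : D g) (L : List (D g)) : ∃ s', dL (s::L) = s' :: dL L := by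
  cases L with
  | nil => exact ⟨s-1, rfl⟩
  | cons b L => exact ⟨s, rfl⟩

/-- removal move -/
theorem eqv_rem {g : ℕ} (hg : 2 ≤ g) (m : ℕ) (s t' : D g) (D v : List (SGP.D g)) :
    Eqv g (s :: (D ++ 1 :: (S g m ++ 1 :: t' :: v))) (dL (s::D) ++ nS g m ++ (t'-1) :: v) := by
  have key : ∀ (L : List (SGP.D g)), L ≠ [] →
      Eqv g (L ++ 1 :: (S g m ++ 1 :: t' :: v)) (dL L ++ nS g m ++ (t'-1) :: v) := by
    intro L hL
    induction L using List.reverseRecOn with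
    | nil => simp at hL
    | append_singleton L t _ =>
      rw [dL_snoc]
      have := (eqv_S hg m t t').ctx L v
      simpa using this
  simpa using key (s::D) (by simp)

theorem G1 {g : ℕ} (hg : 2 ≤ g) (D : List (D g)) (m : ℕ) (h : Ok 0 0 (D ++ 1 :: S g m)) :
    Ok 0 0 (dL D) ∧ rn 0 (dL D) = 0 := by
  obtain ⟨j, hj⟩ : ∃ j, 2*g-2 = j+1 := ⟨2*g-3, by omega⟩
  induction D using List.reverseRecOn with
  | nil => exact ⟨trivial, rfl⟩
  | append_singleton D t _ =>
    rw [dL_snoc, Ok_app, rn_app]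
    rw [List.append_assoc, Ok_app] at h
    obtain ⟨hD, ht⟩ := h
    have hlt := Ok_lt hD (by omega) (by omega)
    set k := rp 0 D
    set l := rn 0 D
    obtain ⟨h0, h1, h2, h3⟩ := ht
    have hS : ∃ T, S g m = o g (2*g-2) ++ T := by
      cases m with
      | zero => exact ⟨[], by simp [S]⟩
      | succ m => exact ⟨_, rfl⟩
    obtain ⟨T, hT⟩ := hS
    have h4 : step k t + 1 + (2*g-2) < 2*g := by
      have h5 : Ok (step k t) (step l (-t)) (o g (2*g-1) ++ T) := by
        have : o g (2*g-1) = 1 :: o g (2*g-2) := by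
          rw [show 2*g-1 = (2*g-2)+1 by omega]; rfl
        rw [this]; simpa [hT] using h3
      obtain ⟨_, _, h6⟩ := Ok_rep h5
      have := h6 (by omega); omega
    have h5 : step k t = 0 := by omega
    have t1 : t ≠ 1 := by rintro rfl; rw [step_one] at h5; omega
    have hs2 : step l (-(t-1)) = 0 := by
      by_cases ht : t = -1
      · subst ht
        rw [show -(-1 - 1 : SGP.D g) = 2 by ring, step_two hg, if_neg]
        rw [neg_neg, step_one] at h2; omega
      · apply step_ne2
        · intro h; exact h0 (by linear_combination -h)
        · intro h; exact ht (by linear_combination -h)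
    refine ⟨⟨hD, ?_, ?_, ?_, trivial⟩, ?_⟩
    · intro h; exact t1 (by linear_combination h)
    · by_cases ht : t = 2
      · subst ht
        rw [show (2 - 1 : SGP.D g) = 1 by ring, step_one]
        rw [step_two hg] at h5
        split_ifs at h5 with h; omega
      · have : step k (t-1) ≤ 1 := step_le_one (fun h => ht (by linear_combination h))
        omega
    · omega
    · exact hs2

theorem G1' {g : ℕ} (hg : 2 ≤ g) (D : List (D g)) (m : ℕ) (h : Ok 0 0 (D ++ 1 :: S g m)) :
    Ok 0 0 (dL D ++ nS g m) ∧ rp 0 (dL D ++ nS g m) = 0 ∧ rn 0 (dL D ++ nS g m) = 2*g-2 := by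
  obtain ⟨h1, h2⟩ := G1 hg D m h
  have h3 := nS_run hg m (rp 0 (dL D))
  rw [Ok_app, rp_app, rn_app, h2]
  exact ⟨⟨h1, h3.1⟩, h3.2.1, h3.2.2⟩

theorem Plem {g : ℕ} (hg : 2 ≤ g) (Z : List (D g)) : ∀ (D M : List (SGP.D g)) (k l : ℕ), Part g k M →
    Ok 0 0 (D ++ 1 :: M) → rp 0 (D ++ 1 :: M) = k+1 → rn 0 (D ++ 1 :: M) = 0 → Ok k l Z →
    Z.getLast? ≠ some 1 →
    Ok 0 0 (D ++ 1 :: M ++ Z) ∨ ((Z.head? = some 1 ∨ Z.head? = some 2) ∧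
      ∃ m τ Z'', M ++ Z = S g m ++ 1 :: τ :: Z'' ∧ Z'' <:+ Z ∧
      (Z'' = [] → Z.getLast? = some τ) ∧
      Ok 0 0 (dL D ++ nS g m ++ (τ-1) :: Z'')) := by
  induction Z with
  | nil => intro D M k l _ h _ _ _ _; left; simpa using h
  | cons z Z ih =>
    intro D M k l hP hC hrp hrn hZ hlast
    obtain ⟨z0, z1, z2, z3⟩ := hZ
    have hklt : k+1 < 2*g := by
      have := (Ok_lt hC (by omega) (by omega)).1; omega
    -- the step succeeds with low counters
    have easy : step (k+1) z = 0 → Ok 0 0 (D ++ 1 :: M ++ z :: Z) := by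
      intro hs
      rw [Ok_app, hrp, hrn]
      refine ⟨hC, z0, by omega, lt_of_le_of_lt (step_mono (Nat.zero_le l) _) z2, ?_⟩
      exact z3.mono (by omega) (step_mono (Nat.zero_le l) _)
    by_cases hz1 : z = 1
    · subst hz1
      rw [step_one] at z1 z3
      by_cases hk : k + 1 = 2*g-1
      · -- failure
        right
        refine ⟨.inl rfl, ?_⟩
        obtain ⟨m, rfl⟩ := hP.S (by omega)
        rcases Z with _ | ⟨τ, Z''⟩
        · simp at hlast
        refine ⟨m, τ, Z'', rfl, ?_, ?_, ?_⟩
        · exact ⟨[1, τ], rfl⟩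
        · rintro rfl; simp
        · obtain ⟨g1, g2, g3⟩ := G1' hg D m hC
          rw [Ok_app, g2, g3]
          refine ⟨g1, ?_⟩
          obtain ⟨y0, y1, y2, y3⟩ := z3
          have τ1 : τ ≠ 1 := by rintro rfl; rw [step_one] at y1; omega
          have hs : step (2*g-2) (-(τ-1)) = 0 := by
            apply step_small _ (by omega)
            intro h; exact y0 (by linear_combination -h)
          have hs2 : step 0 (τ-1) ≤ step (k+1) τ := by
            by_cases h2 : τ = 2
            · subst h2
              rw [show (2-1:SGP.D g) = 1 by ring, step_one, step_two hg, if_pos (by omega)]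
            · rw [step_small (k := 0) (fun h => h2 (by linear_combination h)) (by omega)]; omega
          refine ⟨fun h => τ1 (by linear_combination h), by omega, by omega, ?_⟩
          exact y3.mono hs2 (by omega)
      · have e : D ++ 1 :: M ++ 1 :: Z = D ++ 1 :: (M ++ [1]) ++ Z := by simp
        have e' : D ++ 1 :: (M ++ [1]) = (D ++ 1 :: M) ++ [1] := by simp
        have hC' : Ok 0 0 (D ++ 1 :: (M ++ [1])) := by
          rw [e', Ok_app, hrp, hrn]
          exact ⟨hC, z0, by rw [step_one]; omega, by rw [step_neg1 hg]; omega, trivial⟩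
        by_cases hZe : Z = []
        · subst hZe; left; rw [e]; simpa using hC'
        have f1 : rp 0 (D ++ 1 :: (M ++ [1])) = k+1+1 := by rw [e', rp_app, hrp]; simp [rp, step_one]
        have f2 : rn 0 (D ++ 1 :: (M ++ [1])) = 0 := by rw [e', rn_app, hrn]; simp [rn, step_neg1 hg]
        have f3 : Z.getLast? ≠ some 1 := by
          intro h; apply hlast; rw [List.getLast?_cons, h]; rfl
        rcases ih D (M ++ [1]) (k+1) _ hP.one hC' f1 f2 z3 f3 with h | ⟨_, m, τ, Z'', h1, h2, h3, h4⟩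
        · left; rw [e]; exact h
        · right
          refine ⟨.inl rfl, m, τ, Z'', by rw [← h1]; simp, h2.trans (List.suffix_cons _ _), ?_, h4⟩
          intro h; rw [List.getLast?_cons, h3 h]; rfl
    · by_cases hz2 : z = 2 ∧ k+1 = 2*g-1
      · obtain ⟨rfl, hk⟩ := hz2
        obtain ⟨m0, rfl⟩ := hP.S (by omega)
        have e : D ++ 1 :: S g m0 ++ 2 :: Z = D ++ 1 :: (S g m0 ++ [2]) ++ Z := by simp
        have e' : D ++ 1 :: (S g m0 ++ [2]) = (D ++ 1 :: S g m0) ++ [2] := by simp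
        have hC' : Ok 0 0 (D ++ 1 :: (S g m0 ++ [2])) := by
          rw [e', Ok_app, hrp, hrn]
          refine ⟨hC, z0, ?_, by rw [step_neg2 hg]; omega, trivial⟩
          have := step_le_one (k := k+1) hz1; omega
        by_cases hZe : Z = []
        · subst hZe; left; rw [e]; simpa using hC'
        have f1 : rp 0 (D ++ 1 :: (S g m0 ++ [2])) = 0+1 := by
          rw [e', rp_app, hrp]; simp [rp, step_two hg, hk]
        have f2 : rn 0 (D ++ 1 :: (S g m0 ++ [2])) = 0 := by
          rw [e', rn_app, hrn]; simp [rn, step_neg2 hg]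
        have f3 : Z.getLast? ≠ some 1 := by
          intro h; apply hlast; rw [List.getLast?_cons, h]; rfl
        rcases ih D (S g m0 ++ [2]) 0 _ (Part.two m0) hC' f1 f2
          (z3.mono (Nat.zero_le _) le_rfl) f3 with h | ⟨_, m, τ, Z'', h1, h2, h3, h4⟩
        · left; rw [e]; exact h
        · right
          refine ⟨.inr rfl, m, τ, Z'', by rw [← h1]; simp, h2.trans (List.suffix_cons _ _), ?_, h4⟩
          intro h; rw [List.getLast?_cons, h3 h]; rfl
      · left
        apply easy
        unfold step
        rw [if_neg hz1, if_neg]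
        rintro ⟨h, h'⟩; exact hz2 ⟨h, by omega⟩

end SGP


namespace SGP

theorem dec_ones {g : ℕ} (Z : List (D g)) : ∀ z, Z.getLast? = some z → z ≠ 1 →
    ∃ j τ Z', Z = o g j ++ τ :: Z' ∧ τ ≠ 1 := by
  induction Z with
  | nil => intro z h; simp at h
  | cons a Z ih =>
    intro z h hz
    by_cases ha : a = 1
    · subst ha
      rcases Z with _ | ⟨b, Z⟩
      · simp at h; exact absurd h.symm hz
      · obtain ⟨j, τ, Z', e, h'⟩ := ih z (by simpa using h) hz
        exact ⟨j+1, τ, Z', by rw [e]; rfl, h'⟩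
    · exact ⟨0, a, Z, rfl, ha⟩

theorem S_mem {g m : ℕ} {x : D g} (h : x ∈ S g m) : x = 1 ∨ x = 2 := by
  induction m with
  | zero => left; exact List.eq_of_mem_replicate h
  | succ m ih =>
    simp only [S, List.mem_append, List.mem_cons] at h
    rcases h with h | h | h
    · left; exact List.eq_of_mem_replicate h
    · right; exact h
    · exact ih h

theorem nS_mem {g m : ℕ} {x : D g} (h : x ∈ nS g m) : x = -1 ∨ x = -2 := by
  simp only [nS, ng, List.mem_map] at h
  obtain ⟨y, hy, rfl⟩ := h
  rcases S_mem hy with rfl | rfl <;> simp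

theorem nS_head {g : ℕ} (hg : 2 ≤ g) (m : ℕ) : ∃ T, nS g m = -1 :: T := by
  obtain ⟨j, hj⟩ : ∃ j, 2*g-2 = j+1 := ⟨2*g-3, by omega⟩
  cases m with
  | zero => exact ⟨n g j, by simp [nS, S, hj, List.replicate_succ]⟩
  | succ m => exact ⟨n g j ++ ng (2 :: S g m), by simp [nS, S, hj, List.replicate_succ]⟩

theorem S_end (g m : ℕ) : ∃ T, S g m = T ++ o g (2*g-2) := by
  cases m with
  | zero => exact ⟨[], rfl⟩
  | succ m => exact ⟨S g m ++ [2], by rw [← S_snoc]; simp [S]⟩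

theorem nS_split (g m j : ℕ) (h : j ≤ 2*g-2) : ∃ M', nS g m = M' ++ n g j := by
  obtain ⟨T, hT⟩ := S_end g m
  refine ⟨ng T ++ n g (2*g-2-j), ?_⟩
  have : n g (2*g-2) = n g (2*g-2-j) ++ n g j := by
    rw [n, n, n, List.replicate_append_replicate]; congr 1; omega
  rw [nS, hT, ng, List.map_append, List.append_assoc, ← this]; simp

theorem eqv_remz {g : ℕ} (hg : 2 ≤ g) (m j : ℕ) (s τ : D g) (D v M' : List (SGP.D g))
    (h : nS g m = M' ++ n g j) :
    Eqv g (s :: (D ++ 1 :: (S g m ++ 1 :: (o g j ++ τ :: v)))) (dL (s::D) ++ M' ++ (τ-1) :: v) := by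
  cases j with
  | zero =>
    have := eqv_rem hg m s τ D v
    rw [h] at this; simpa using this
  | succ j =>
    have h1 := eqv_rem hg m s 1 D (o g j ++ τ :: v)
    rw [h] at h1
    have h2 := (eqv_zip j τ).ctx (dL (s::D) ++ M') v
    refine Eqv.trans (M := dL (s::D) ++ (M' ++ n g (j+1)) ++ (1-1) :: (o g j ++ τ :: v)) ?_ ?_
    · simpa [List.replicate_succ] using h1
    · simpa using h2

/-- the reduced outcome -/
def Out (g c : ℕ) (e : D g) (Y Z : List (D g)) : Prop :=
  ∃ (D D' : List (SGP.D g)) (μ : SGP.D g) (B' : List (SGP.D g)), Y = D ++ D' ∧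
    (∀ s, Eqv g (s :: (Y ++ e :: Z)) (dL (s::D) ++ μ :: B')) ∧
    Ok 0 0 (dL D ++ μ :: B') ∧
    (Y ++ e :: Z).length ≤ D.length + 1 + B'.length + c ∧
    (μ = -1 ∨ μ = -2) ∧
    (Z.head? = some 1 ∨ Z.head? = some 2 ∨ (e = 1 ∧ μ = -1 ∧ ∃ m, D' = 1 :: S g m)) ∧
    ∀ z, Z.getLast? = some z → ∃ k : ℕ, k ≤ 2 ∧ (μ :: B').getLast? = some (z - k)

theorem Out.mono {g c c' : ℕ} {e : D g} {Y Z : List (D g)} (h : Out g c e Y Z) (hc : c ≤ c') :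
    Out g c' e Y Z := by
  obtain ⟨D, D', μ, B', h1, h2, h3, h4, h5⟩ := h
  exact ⟨D, D', μ, B', h1, h2, h3, by omega, h5⟩

theorem last_aux {g : ℕ} {z τ : D g} {Z'' : List (D g)} (P : List (D g)) (c : ℕ) (hc : c ≤ 2)
    (h : (τ :: Z'').getLast? = some z) :
    ∃ k : ℕ, k ≤ 2 ∧ (P ++ (τ - c) :: Z'').getLast? = some (z - k) := by
  rcases Z'' with _ | ⟨b, Z''⟩
  · simp only [List.getLast?_singleton, Option.some.injEq] at h
    subst h
    exact ⟨c, hc, by simp⟩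
  · refine ⟨0, by omega, ?_⟩
    rw [List.getLast?_append]
    rw [List.getLast?_cons_cons] at h ⊢
    rw [h]; simp

theorem suf_last {g : ℕ} {z τ : D g} {Z'' Zp : List (D g)} (h : Z'' <:+ Zp)
    (h2 : Z'' = [] → Zp.getLast? = some τ) (h3 : Zp.getLast? = some z) :
    (τ :: Z'').getLast? = some z := by
  rcases Z'' with _ | ⟨b, Z''⟩
  · rw [← h3, h2 rfl]; rfl
  · obtain ⟨t, rfl⟩ := h
    rw [List.getLast?_append, List.getLast?_cons] at h3
    rw [List.getLast?_cons_cons, List.getLast?_cons]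
    simpa using h3

theorem PO {g : ℕ} (hg : 2 ≤ g) (e : D g) (Y Z : List (D g)) (D D' M Zp : List (SGP.D g)) (k l : ℕ)
    (hP : Part g k M) (h1 : Ok 0 0 (D ++ 1 :: M)) (h2 : rp 0 (D ++ 1 :: M) = k+1)
    (h3 : rn 0 (D ++ 1 :: M) = 0) (h4 : Ok k l Zp) (h5 : Zp.getLast? ≠ some 1)
    (hY : Y = D ++ D') (hL : D ++ 1 :: M ++ Zp = Y ++ e :: Z)
    (hz : Zp ≠ [] → Zp.getLast? = Z.getLast?)
    (hh : Zp.head? = some 1 ∨ Zp.head? = some 2 → Z.head? = some 1 ∨ Z.head? = some 2) :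
    Ok 0 0 (Y ++ e :: Z) ∨ Out g 2 e Y Z := by
  rcases Plem hg Zp D M k l hP h1 h2 h3 h4 h5 with h | ⟨hd, m, τ, Z'', e1, e2, e3, e4⟩
  · left; rw [← hL]; exact h
  · right
    obtain ⟨T, hT⟩ := nS_head hg m
    have hLe : Y ++ e :: Z = D ++ 1 :: (S g m ++ 1 :: τ :: Z'') := by
      rw [← hL, ← e1]; simp
    have hTl : T.length + 1 = (S g m).length := by
      have := congrArg List.length hT
      simpa using this.symm
    have hne : Zp ≠ [] := by rintro rfl; simp at hd
    refine ⟨D, D', -1, T ++ (τ-1) :: Z'', hY, ?_, ?_, ?_, .inl rfl, ?_, ?_⟩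
    · intro s
      rw [hLe]
      have := eqv_rem hg m s τ D Z''
      rw [hT] at this; simpa using this
    · rw [hT] at e4; simpa using e4
    · rw [hLe]; simp; omega
    · rcases hh hd with h | h
      · exact .inl h
      · exact .inr (.inl h)
    · intro z h
      rw [← hz hne] at h
      have := last_aux (-1 :: T) 1 (by omega) (suf_last e2 e3 h)
      simpa using this

theorem J {g : ℕ} (hg : 2 ≤ g) (e : D g) (Y Z : List (D g)) (he0 : e ≠ 0) (he1 : e ≠ 1)
    (hY : Ok 0 0 Y) (hZ : Ok 0 0 Z) (hl : Z.getLast? ≠ some 1) :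
    step (rn 0 Y) (-e) = 0 → e ≠ -1 → Ok 0 0 (Y ++ e :: Z) ∨ Out g 2 e Y Z := by
  intro hn hem
  have hlt := Ok_lt hY (by omega) (by omega)
  by_cases hr : step (rp 0 Y) e = 0
  · left
    rw [Ok_app]
    exact ⟨hY, he0, by omega, by omega, by rw [hr, hn]; exact hZ⟩
  · have h2 : e = 2 := by
      by_contra h; exact hr (step_ne2 he1 h)
    subst h2
    rw [step_two hg] at hr
    have hr' : rp 0 Y = 2*g-1 := by
      split_ifs at hr with h
      · omega
      · simp at hr
    obtain ⟨D, M, rfl, hM⟩ := struct hg Y (2*g-2) hY (by omega)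
    obtain ⟨m, rfl⟩ := hM.S rfl
    have e' : D ++ 1 :: (S g m ++ [2]) = (D ++ 1 :: S g m) ++ [2] := by simp
    refine PO hg 2 _ Z D (1 :: S g m) (S g m ++ [2]) Z 0 0 (Part.two m) ?_ ?_ ?_ hZ hl rfl ?_ ?_ ?_
    · rw [e', Ok_app, hr']
      refine ⟨hY, he0, ?_, by omega, trivial⟩
      have := step_le_one (k := 2*g-1) he1; omega
    · rw [e', rp_app, hr']; simp [rp, step_two hg]
    · rw [e', rn_app]; exact hn
    · simp
    · intro _; rfl
    · exact id

end SGP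


namespace SGP

theorem rp_snoc {g : ℕ} (k : ℕ) (A : List (D g)) (c : D g) : rp k (A ++ [c]) = step (rp k A) c := by
  rw [rp_app]; rfl
theorem rn_snoc {g : ℕ} (k : ℕ) (A : List (D g)) (c : D g) : rn k (A ++ [c]) = step (rn k A) (-c) := by
  rw [rn_app]; rfl

theorem rn_n {g : ℕ} (k j : ℕ) : rn k (n g j) = k + j := by
  have : n g j = ng (o g j) := by simp
  rw [this, rn_neg, rp_o]

theorem nc {g : ℕ} (hg : 2 ≤ g) : (-1 : D g) ≠ 1 ∧ (-1 : D g) ≠ 2 ∧ (-1 : D g) ≠ 0 ∧ (-3 : D g) ≠ 0 ∧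
    (-3 : D g) ≠ 1 ∧ (-3 : D g) ≠ 2 ∧ (3 : D g) ≠ 1 ∧ (3 : D g) ≠ 2 ∧ (-2 : D g) ≠ 0 ∧ (-2 : D g) ≠ 1 := by
  have h1 := ne_of_sub hg (-1) 1 (by norm_num) (by norm_num) (by norm_num)
  have h2 := ne_of_sub hg (-1) 2 (by norm_num) (by norm_num) (by norm_num)
  have h3 := ne_of_sub hg (-1) 0 (by norm_num) (by norm_num) (by norm_num)
  have h4 := ne_of_sub hg (-3) 0 (by norm_num) (by norm_num) (by norm_num)
  have h5 := ne_of_sub hg (-3) 1 (by norm_num) (by norm_num) (by norm_num)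
  have h6 := ne_of_sub hg (-3) 2 (by norm_num) (by norm_num) (by norm_num)
  have h7 := ne_of_sub hg 3 1 (by norm_num) (by norm_num) (by norm_num)
  have h8 := ne_of_sub hg 3 2 (by norm_num) (by norm_num) (by norm_num)
  have h9 := ne_of_sub hg (-2) 0 (by norm_num) (by norm_num) (by norm_num)
  have h10 := ne_of_sub hg (-2) 1 (by norm_num) (by norm_num) (by norm_num)
  push_cast at *
  exact ⟨h1, h2, h3, h4, h5, h6, h7, h8, h9, h10⟩

def HR (g : ℕ) (L : List (D g)) : Prop :=
  ∀ u v, L = u ++ o g (4*g-2) ++ v → v.head? = some (-1)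

theorem o_add (g a b : ℕ) : o g a ++ o g b = o g (a+b) := by
  rw [o, o, List.replicate_append_replicate]

theorem o_one (g a : ℕ) : 1 :: o g a = o g (a+1) := rfl

/-- Case A of `Q` -/
theorem Q_A {g : ℕ} (hg : 2 ≤ g) (Y Z' : List (D g)) (τ z : D g) (j : ℕ)
    (hY : Ok 0 0 Y) (hZ : Ok 0 0 (o g j ++ τ :: Z')) (hτ : τ ≠ 1)
    (hl : (o g j ++ τ :: Z').getLast? = some z) (hz : z ≠ 1) (hc : rp 0 Y + 1 + j < 2*g) :
    Ok 0 0 (Y ++ 1 :: (o g j ++ τ :: Z')) ∨ Out g 2 1 Y (o g j ++ τ :: Z') := by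
  have hlt := Ok_lt hY (by omega) (by omega)
  have hlast : (τ :: Z').getLast? = some z := by
    rw [List.getLast?_append, List.getLast?_cons] at hl
    rw [List.getLast?_cons]; simpa using hl
  have hC : Ok 0 0 (Y ++ o g (j+1)) ∧ rp 0 (Y ++ o g (j+1)) = rp 0 Y + j + 1 ∧ rn 0 (Y ++ o g (j+1)) = 0 := by
    rw [Ok_app, rp_app, rn_app, rp_o, rn_o hg]
    exact ⟨⟨hY, Ok_o hg _ _ _ (by omega)⟩, by omega, rfl⟩
  rw [Ok_app, rp_o, rn_o0 hg] at hZ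
  have h4 : Ok (rp 0 Y + j) 0 (τ :: Z') := by
    obtain ⟨a1, a2, a3, a4⟩ := hZ.2
    have hs : step (rp 0 Y + j) τ = 0 := step_small hτ (by omega)
    exact ⟨a1, by omega, a3, a4.mono (by omega) le_rfl⟩
  have hh : (τ :: Z').head? = some 1 ∨ (τ :: Z').head? = some 2 →
      (o g j ++ τ :: Z').head? = some 1 ∨ (o g j ++ τ :: Z').head? = some 2 := by
    intro h
    rcases j with _ | j
    · exact h
    · left; rfl
  have hlz : (τ :: Z') ≠ [] → (τ :: Z').getLast? = (o g j ++ τ :: Z').getLast? := by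
    intro _; rw [hl, hlast]
  have h5 : (τ :: Z').getLast? ≠ some 1 := by
    rw [hlast]; intro h; exact hz (by simpa using h)
  rcases Nat.eq_zero_or_pos (rp 0 Y) with h0 | h0
  · refine PO hg 1 Y _ Y [] (o g j) (τ :: Z') (rp 0 Y + j) 0 (.inl (by rw [h0, Nat.zero_add])) ?_ ?_ ?_ h4 h5 (by simp)
      (by simp) hlz hh
    · exact hC.1
    · exact hC.2.1
    · exact hC.2.2
  · obtain ⟨k, hk⟩ : ∃ k, rp 0 Y = k+1 := ⟨rp 0 Y - 1, by omega⟩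
    obtain ⟨D, M, hDM, hM⟩ := struct hg Y k hY hk
    have e : D ++ 1 :: (M ++ o g (j+1)) = Y ++ o g (j+1) := by rw [hDM]; simp
    have hP := hM.ones (j+1)
    rw [show k + (j+1) = rp 0 Y + j by omega] at hP
    refine PO hg 1 Y _ D (1::M) (M ++ o g (j+1)) (τ :: Z') (rp 0 Y + j) 0 hP ?_ ?_ ?_ h4 h5 hDM ?_ hlz hh
    · rw [e]; exact hC.1
    · rw [e]; exact hC.2.1
    · rw [e]; exact hC.2.2
    · rw [e]; simp [List.replicate_succ]

theorem Q {g : ℕ} (hg : 2 ≤ g) (Y Z : List (D g)) (z : D g)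
    (hY : Ok 0 0 Y) (hZ : Ok 0 0 Z) 
    (hl : Z.getLast? = some z) (hz : z ≠ 1) (hHR : HR g (Y ++ 1 :: Z)) :
    Ok 0 0 (Y ++ 1 :: Z) ∨ Out g (4*g) 1 Y Z := by
  obtain ⟨j, τ, Z', rfl, hτ⟩ := dec_ones Z z hl hz
  by_cases hc : rp 0 Y + 1 + j < 2*g
  · exact (Q_A hg Y Z' τ z j hY hZ hτ hl hz hc).imp_right (fun h => h.mono (by omega))
  obtain ⟨q1, q2, q3, q4, q5, q6, q7, q8, q9, q10⟩ := nc hg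
  right
  have hlt := Ok_lt hY (by omega) (by omega)
  have hlast : (τ :: Z').getLast? = some z := by
    rw [List.getLast?_append, List.getLast?_cons] at hl
    rw [List.getLast?_cons]; simpa using hl
  rw [Ok_app, rp_o, rn_o0 hg] at hZ
  obtain ⟨hZ1, hτ0, hb1, hb2, hZ'⟩ := hZ
  have hj : j < 2*g := by
    have := (Ok_lt hZ1 (by omega) (by omega)).1
    rw [rp_o] at this; omega
  -- the block
  obtain ⟨r, hr⟩ : ∃ r, r + rp 0 Y = 2*g-1 := ⟨2*g-1-rp 0 Y, by omega⟩
  obtain ⟨i, hi⟩ : ∃ i, r + i = j := ⟨j - r, by omega⟩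
  have hC : Ok 0 0 (Y ++ o g r) ∧ rp 0 (Y ++ o g r) = (2*g-2)+1 := by
    rw [Ok_app, rp_app, rp_o]
    exact ⟨⟨hY, Ok_o hg _ _ _ (by omega)⟩, by omega⟩
  obtain ⟨D, M, hDM, hM⟩ := struct hg _ _ hC.1 hC.2
  obtain ⟨m, rfl⟩ := hM.S rfl
  have hSl := S_len g m
  have hSge : 2*g-2 ≤ (S g m).length := by
    rw [hSl]; nlinarith [Nat.zero_le (m*(2*g-2))]
  have hD : ∃ D', Y = D ++ D' := by
    have : D <+: Y := by
      apply List.prefix_of_prefix_length_le (l₃ := Y ++ o g r) ⟨_, hDM.symm⟩ (List.prefix_append _ _)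
      have := congrArg List.length hDM
      simp at this; omega
    obtain ⟨t, ht⟩ := this; exact ⟨t, ht.symm⟩
  obtain ⟨D', hD'⟩ := hD
  have hLe : Y ++ 1 :: (o g j ++ τ :: Z') = D ++ 1 :: (S g m ++ 1 :: (o g i ++ τ :: Z')) := by
    have e1 : 1 :: (o g j ++ τ :: Z') = o g r ++ (1 :: (o g i ++ τ :: Z')) := by
      have : o g (j+1) = o g r ++ o g (i+1) := by rw [o_add]; congr 1; omega
      rw [← List.cons_append, o_one, this, List.append_assoc]; rfl
    rw [e1, ← List.append_assoc, hDM]; simp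
  have hok1 : Ok 0 0 (D ++ 1 :: S g m) := by rw [← hDM]; exact hC.1
  have hhead : 0 < j → (o g j ++ τ :: Z').head? = some 1 := by
    intro h; obtain ⟨j', rfl⟩ : ∃ j', j = j'+1 := ⟨j-1, by omega⟩; rfl
  have hZ00 : Ok 0 0 Z' := hZ'.mono (Nat.zero_le _) (Nat.zero_le _)
  have hL : (Y ++ 1 :: (o g j ++ τ :: Z')).length = D.length + (S g m).length + i + Z'.length + 3 := by
    rw [hLe]; simp; omega
  -- run lemma
  have hrun : i = 2*g-2 → m = 0 → τ = -1 := by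
    intro h1 h2
    subst h2
    have := hHR D (τ :: Z') (by
      rw [hLe, h1]
      have : o g (4*g-2) = 1 :: (S g 0 ++ 1 :: o g (2*g-2)) := by
        rw [o_one, S, o_add, o_one]; congr 1; omega
      rw [this]; simp)
    simpa using this
  by_cases hi2 : i ≤ 2*g-2
  · obtain ⟨M', hM'⟩ := nS_split g m i hi2
    obtain ⟨G1a, G1b⟩ := G1 hg D m hok1
    obtain ⟨G2a, G2b, G2c⟩ := G1' hg D m hok1
    rw [hM', ← List.append_assoc] at G2a G2b G2c
    rw [Ok_app] at G2a
    rw [rn_app, rn_n] at G2c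
    have hMl : M'.length + i = (S g m).length := by
      have := congrArg List.length hM'; simpa using this.symm
    have hs1 : step (rn 0 (dL D ++ M')) (-(τ-1)) = 0 := by
      apply step_small _ (by omega)
      intro h; exact hτ0 (by linear_combination -h)
    have hτ1 : τ - 1 ≠ 0 := fun h => hτ (by linear_combination h)
    rcases List.eq_nil_or_concat M' with hMe | ⟨M1, c, hMc⟩
    · subst hMe
      have him : i = 2*g-2 ∧ m = 0 := by
        rcases Nat.eq_zero_or_pos m with h | h
        · simp at hMl; omega
        · exfalso
          simp at hMl
          have : (m+1)*(2*g-2) = m*(2*g-2) + (2*g-2) := by ring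
          have h2 : 0 ≤ m*(2*g-2) := Nat.zero_le _
          omega
      have hτm := hrun him.1 him.2
      subst hτm
      refine ⟨D, D', -1-1, Z', hD', ?_, ?_, ?_, .inr (by ring), .inl (hhead (by omega)), ?_⟩
      · intro s; rw [hLe]
        simpa using eqv_remz hg m i s (-1) D Z' [] hM'
      · rw [Ok_app]
        have : step (rp 0 (dL D)) (-1-1 : SGP.D g) = 0 := by
          rw [show (-1-1 : SGP.D g) = -2 by ring, step_neg2 hg]
        simp only [List.append_nil] at hs1
        refine ⟨G1a, hτ1, by omega, by omega, ?_⟩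
        rw [this, hs1]; exact hZ00
      · rw [hL]; simp at hMl; omega
      · intro z' h
        rw [hl] at h
        obtain rfl : z = z' := by simpa using h
        simpa using last_aux [] 1 (by omega) hlast
    · rw [List.concat_eq_append] at hMc
      have hM'ne : M' ≠ [] := by rw [hMc]; simp
      obtain ⟨T, hT⟩ := nS_head hg m
      obtain ⟨T', hT'⟩ : ∃ T', M' = -1 :: T' := by
        rcases M' with _ | ⟨a, T'⟩
        · exact absurd rfl hM'ne
        · rw [hT] at hM'; simp at hM'; exact ⟨T', by rw [← hM'.1]⟩
      have hrp : rp 0 (dL D ++ M') = 0 := by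
        rw [hMc, ← List.append_assoc, rp_snoc]
        have : c ∈ nS g m := by rw [hM', hMc]; simp
        rcases nS_mem this with rfl | rfl
        · exact step_neg1 hg _
        · exact step_neg2 hg _
      by_cases hτ2 : τ = 2
      · -- possible second removal
        subst hτ2
        have hinfo : (o g j ++ 2 :: Z').head? = some 1 ∨ (o g j ++ 2 :: Z').head? = some 2 := by
          rcases Nat.eq_zero_or_pos j with h | h
          · right; rw [h]; rfl
          · left; exact hhead h
        have hinfo' : ∀ μ : SGP.D g, (o g j ++ 2 :: Z').head? = some 1 ∨ (o g j ++ 2 :: Z').head? = some 2 ∨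
          ((1:SGP.D g) = 1 ∧ μ = -1 ∧ ∃ m, D' = 1 :: S g m) := by
          intro μ; rcases hinfo with h | h
          · exact .inl h
          · exact .inr (.inl h)
        have e21 : (2:SGP.D g) - 1 = 1 := by ring
        rw [e21] at hs1
        have P1 : Ok 0 0 ((dL D ++ M') ++ 1 :: []) := by
          rw [Ok_app, hrp]
          exact ⟨G2a.1, one_ne0 hg, by rw [step_one]; omega, by omega, trivial⟩
        have P2 : rp 0 ((dL D ++ M') ++ 1 :: []) = 0+1 := by rw [rp_snoc, hrp, step_one]
        have P3 : rn 0 ((dL D ++ M') ++ 1 :: []) = 0 := by rw [rn_snoc, hs1]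
        have P4 : Z'.getLast? ≠ some 1 := by
          intro h
          rcases Z' with _ | ⟨a, Z'⟩
          · simp at h
          · rw [List.getLast?_cons_cons] at hlast
            rw [hlast] at h; exact hz (by simpa using h)
        have heqv := fun s => eqv_remz hg m i s 2 D Z' M' hM'
        rw [e21] at heqv
        rcases Plem hg Z' (dL D ++ M') [] 0 0 (.inl rfl) P1 P2 P3 hZ00 P4 with
          h | ⟨_, m2, τ2, Z'', e1, e2, e3, e4⟩
        · refine ⟨D, D', -1, T' ++ 1 :: Z', hD', ?_, ?_, ?_, .inl rfl, hinfo' _, ?_⟩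
          · intro s; rw [hLe]; have := heqv s; rw [hT'] at this; simpa using this
          · rw [hT'] at h; simpa using h
          · rw [hL]; rw [hT'] at hMl; simp at hMl ⊢; omega
          · intro z' h'
            rw [hl] at h'
            obtain rfl : z = z' := by simpa using h'
            have := last_aux (-1 :: T') 1 (by omega) hlast
            simpa [e21] using this
        · -- second removal
          have hZ'ne : Z' ≠ [] := by
            rintro rfl
            have := congrArg List.length e1; simp at this
          have hZ'l : Z'.getLast? = some z := by
            rcases Z' with _ | ⟨a, Z'⟩
            · exact absurd rfl hZ'ne
            · rw [List.getLast?_cons_cons] at hlast; exact hlast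
          obtain ⟨μ, T'', hμ, hdM⟩ : ∃ μ T'', (μ = -1 ∨ μ = -2) ∧ dL M' = μ :: T'' := by
            rw [hT']
            rcases T' with _ | ⟨b, T'⟩
            · exact ⟨-1-1, [], .inr (by ring), rfl⟩
            · exact ⟨-1, dL (b::T'), .inl rfl, rfl⟩
          have hdl := dL_length M'
          rw [hdM] at hdl
          simp only [List.nil_append] at e1
          have e1l := congrArg List.length e1
          refine ⟨D, D', μ, T'' ++ nS g m2 ++ (τ2-1) :: Z'', hD', ?_, ?_, ?_, hμ, hinfo' _, ?_⟩
          · intro s; rw [hLe]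
            refine (heqv s).trans ?_
            obtain ⟨s', hs'⟩ := dL_cons s D
            have h := eqv_rem hg m2 s' τ2 (dL D ++ M') Z''
            have e5 : dL (s' :: (dL D ++ M')) = dL (s::D) ++ dL M' := by
              rw [hs', ← dL_app _ _ hM'ne]; simp
            rw [e5, ← e1, hdM] at h
            rw [hs'] at h ⊢
            simpa using h
          · rw [dL_app _ _ hM'ne, hdM] at e4; simpa using e4
          · rw [hL]; simp at e1l hdl ⊢; omega
          · intro z' h'
            rw [hl] at h'
            obtain rfl : z = z' := by simpa using h'
            have := last_aux (μ :: T'' ++ nS g m2) 1 (by omega) (suf_last e2 e3 hZ'l)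
            simpa using this
      · refine ⟨D, D', -1, T' ++ (τ-1) :: Z', hD', ?_, ?_, ?_, .inl rfl, ?_, ?_⟩
        · intro s; rw [hLe]
          have := eqv_remz hg m i s τ D Z' M' hM'
          rw [hT'] at this; simpa using this
        · have : Ok 0 0 ((dL D ++ M') ++ (τ-1) :: Z') := by
            rw [Ok_app, hrp]
            have hs0 : step 0 (τ-1) = 0 := step_small (fun h => hτ2 (by linear_combination h)) (by omega)
            exact ⟨G2a.1, hτ1, by omega, by omega, by rw [hs0, hs1]; exact hZ00⟩
          rw [hT'] at this; simpa using this
        · rw [hL]; rw [hT'] at hMl; simp at hMl ⊢; omega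
        · rcases Nat.eq_zero_or_pos j with h | h
          · right; right
            refine ⟨rfl, rfl, m, ?_⟩
            have : r = 0 := by omega
            rw [this] at hDM
            rw [hD'] at hDM
            simpa using hDM
          · left; exact hhead h
        · intro z' h'
          rw [hl] at h'
          obtain rfl : z = z' := by simpa using h'
          have := last_aux (-1 :: T') 1 (by omega) hlast
          simpa using this
  · have hi3 : i = (2*g-2)+1 := by omega
    have hr0 : r = 0 := by omega
    rcases m with _ | m
    · exfalso
      have := hHR D (1 :: τ :: Z') (by
        rw [hLe, hi3]
        have : o g (4*g-2) = 1 :: (S g 0 ++ 1 :: o g (2*g-2)) := by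
          rw [o_one, S, o_add, o_one]; congr 1; omega
        rw [this, ← o_add g _ 1]; simp)
      have := (Option.some.inj this).symm
      exact q1 this
    · have hτm : τ = -1 := by
        have := hHR (D ++ 1 :: (S g m ++ [2])) (τ :: Z') (by
          rw [hLe, hi3]
          have : o g (4*g-2) = S g 0 ++ 1 :: o g (2*g-2+1) := by
            rw [o_one, S, o_add]; congr 1; omega
          rw [this, ← S_snoc]; simp)
        simpa using this
      subst hτm
      have hok2 : Ok 0 0 (D ++ 1 :: S g m) := by
        rw [← S_snoc, ← List.cons_append, ← List.append_assoc, Ok_app] at hok1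
        exact hok1.1
      obtain ⟨G2a, G2b, G2c⟩ := G1' hg D m hok2
      obtain ⟨T, hT⟩ := nS_head hg m
      have hTl : T.length + 1 = (S g m).length := by
        have := congrArg List.length hT
        simpa using this.symm
      have hSS : (S g (m+1)).length = (S g m).length + (2*g-2) + 1 := by
        rw [← S_snoc]; simp [S]; omega
      have e3 : (-1 - 2 : SGP.D g) = -3 := by ring
      refine ⟨D, D', -1, T ++ (-1-2) :: Z', hD', ?_, ?_, ?_, .inl rfl, .inl (hhead (by omega)), ?_⟩
      · intro s; rw [hLe, hi3]
        have h1 : nS g (m+1) = (nS g m ++ [-2]) ++ n g (2*g-2) := by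
          rw [nS, ← S_snoc]; simp [S]
        have h2 := eqv_remz hg (m+1) (2*g-2) s 1 D (-1 :: Z') (nS g m ++ [-2]) h1
        have e4 : o g (2*g-2+1) ++ -1 :: Z' = o g (2*g-2) ++ 1 :: -1 :: Z' := by
          rw [← o_add g _ 1]; simp
        rw [e4]
        refine h2.trans ?_
        have h3 := (Eqv.pop (-2) (-1 : SGP.D g)).ctx (dL (s::D) ++ nS g m) Z'
        have e6 : (-2 + -1 : SGP.D g) = -1 - 2 := by ring
        rw [e6, hT] at h3
        rw [hT]
        simpa using h3
      · have : Ok 0 0 ((dL D ++ nS g m) ++ (-1-2) :: Z') := by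
          rw [Ok_app, G2b, G2c, e3]
          have hs0 : step 0 (-3 : SGP.D g) = 0 := step_ne2 q5 q6
          have hs3 : step (2*g-2) (-(-3) : SGP.D g) = 0 := by rw [neg_neg]; exact step_ne2 q7 q8
          exact ⟨G2a, q4, by omega, by omega, by rw [hs0, hs3]; exact hZ00⟩
        rw [hT] at this; simpa using this
      · rw [hL]; simp; omega
      · intro z' h'
        rw [hl] at h'
        obtain rfl : z = z' := by simpa using h'
        have := last_aux (-1 :: T) 2 (by omega) hlast
        simpa using this

end SGP


namespace SGP

theorem ng_ng {g : ℕ} (L : List (D g)) : ng (ng L) = L := by simp [Function.comp_def]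

theorem neg_hf (g : ℕ) : -hf g = hf g := by linear_combination -hf_add g

/-- clean junction -/
theorem CJ {g : ℕ} (hg : 2 ≤ g) (e : D g) (Y Z : List (D g)) (he0 : e ≠ 0) (he1 : e ≠ 1)
    (hem : e ≠ -1) (hY : Ok 0 0 Y) (hZ : Ok 0 0 Z) (hl : Z.getLast? ≠ some 1)
    (hl' : Z.getLast? ≠ some (-1)) :
    Ok 0 0 (Y ++ e :: Z) ∨ Out g 2 e Y Z ∨ Out g 2 (-e) (ng Y) (ng Z) := by
  by_cases hn : step (rn 0 Y) (-e) = 0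
  · rcases J hg e Y Z he0 he1 hY hZ hl hn hem with h | h
    · exact .inl h
    · exact .inr (.inl h)
  · have h2 : -e = 2 := by
      by_contra h; exact hn (step_ne2 (fun h' => hem (by linear_combination -h')) h)
    have h := J hg (-e) (ng Y) (ng Z) (by simpa using he0) (fun h' => hem (by linear_combination -h'))
      hY.neg hZ.neg (by
        intro h; rw [ng, List.getLast?_map] at h
        rw [Option.map_eq_some_iff] at h
        obtain ⟨a, ha, hb⟩ := h
        apply hl'; rw [ha]; congr 1; linear_combination -hb) (by
        rw [rn_neg, h2]; exact step_neg2 hg _) (by simpa using he1)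
    rcases h with h | h
    · left
      rw [← Ok.neg_iff]; simpa using h
    · right; right; exact h

theorem CL1 {g : ℕ} (hg : 2 ≤ g) (e : D g) (Y Z : List (D g)) (z : D g) (he0 : e ≠ 0)
    (hY : Ok 0 0 Y) (hZ : Ok 0 0 Z) (hl : Z.getLast? = some z) (hz : z ≠ 1) (hz' : z ≠ -1)
    (h1 : e = 1 → HR g (Y ++ 1 :: Z)) (h2 : e = -1 → HR g (ng Y ++ 1 :: ng Z)) :
    Ok 0 0 (Y ++ e :: Z) ∨ Out g (4*g) e Y Z ∨ Out g (4*g) (-e) (ng Y) (ng Z) := by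
  by_cases c1 : e = 1
  · subst c1
    rcases Q hg Y Z z hY hZ hl hz (h1 rfl) with h | h
    · exact .inl h
    · exact .inr (.inl h)
  by_cases c2 : e = -1
  · subst c2
    rcases Q hg (ng Y) (ng Z) (-z) hY.neg hZ.neg (by simp [hl])
      (fun h => hz' (by linear_combination -h)) (h2 rfl) with h | h
    · left; rw [← Ok.neg_iff]; simpa using h
    · right; right; simpa using h
  have k1 : Z.getLast? ≠ some 1 := by
    rw [hl]; intro h; exact hz (by simpa using h)
  have k2 : Z.getLast? ≠ some (-1) := by
    rw [hl]; intro h; exact hz' (by simpa using h)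
  rcases CJ hg e Y Z he0 c1 c2 hY hZ k1 k2 with h | h | h
  · exact .inl h
  · exact .inr (.inl (h.mono (by omega)))
  · exact .inr (.inr (h.mono (by omega)))

/-- final form -/
def Fin' (g c : ℕ) (s : D g) (L : List (D g)) : Prop :=
  ∃ s' B, Eqv g (s :: L) (s' :: B) ∧ Ok 0 0 B ∧ L.length ≤ B.length + c

theorem Fin'.of_out {g c : ℕ} {e : D g} {Y Z : List (D g)} (s : D g) (h : Out g c e Y Z) :
    Fin' g c s (Y ++ e :: Z) := by
  obtain ⟨D, D', μ, B', h1, h2, h3, h4, h5⟩ := h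
  obtain ⟨s', hs'⟩ := dL_cons s D
  refine ⟨s', dL D ++ μ :: B', ?_, h3, ?_⟩
  · have := h2 s; rw [hs'] at this; exact this
  · simp only [List.length_append, List.length_cons, dL_length] at h4 ⊢; omega

theorem Fin'.neg {g c : ℕ} {s : D g} {L : List (D g)} (h : Fin' g c (-s) (ng L)) : Fin' g c s L := by
  obtain ⟨s', B, h1, h2, h3⟩ := h
  refine ⟨-s', ng B, ?_, h2.neg, by simpa using h3⟩
  simpa [Function.comp_def] using h1.neg

theorem Fin'.of {g c : ℕ} {e : D g} {Y Z : List (D g)} (s : D g)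
    (h : Ok 0 0 (Y ++ e :: Z) ∨ Out g c e Y Z ∨ Out g c (-e) (ng Y) (ng Z)) :
    Fin' g c s (Y ++ e :: Z) := by
  rcases h with h | h | h
  · exact ⟨s, _, .refl _, h, by omega⟩
  · exact .of_out s h
  · apply Fin'.neg
    simpa using Fin'.of_out (-s) h

theorem Fin'.trans {g c c' : ℕ} {s : D g} {L M : List (D g)} (h : Fin' g c' s M)
    (he : Eqv g (s :: L) (s :: M)) (hl : L.length ≤ M.length + c) : Fin' g (c + c') s L := by
  obtain ⟨s', B, h1, h2, h3⟩ := h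
  exact ⟨s', B, he.trans h1, h2, by omega⟩

/-! runs -/

theorem Ok_run {g k l N : ℕ} {u v : List (D g)} (h : Ok k l (u ++ o g N ++ v)) (hN : 0 < N) :
    N < 2*g := by
  rw [List.append_assoc, Ok_app] at h
  obtain ⟨_, _, h2⟩ := Ok_rep h.2
  have := h2 hN; omega

theorem split_run {g N : ℕ} (hN : 0 < N) {c : D g} (hc : c ≠ 1) : ∀ {u v U V : List (D g)},
    u ++ o g N ++ v = U ++ c :: V →
    (∃ v1, U = u ++ o g N ++ v1 ∧ v = v1 ++ c :: V) ∨ (∃ u2, V = u2 ++ o g N ++ v) := by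
  intro u v U V h
  rw [List.append_eq_append_iff] at h
  rcases h with ⟨a, h1, h2⟩ | ⟨a, h1, h2⟩
  · exact .inl ⟨a, h1, h2⟩
  · -- u ++ o N = U ++ a, c :: V = a ++ v
    rcases a with _ | ⟨b, a⟩
    · left; exact ⟨[], by simpa using h1.symm, by simpa using h2.symm⟩
    · right
      simp only [List.cons_append, List.cons.injEq] at h2
      obtain ⟨rfl, rfl⟩ := h2
      rw [List.append_eq_append_iff] at h1
      rcases h1 with ⟨a', h1, h2⟩ | ⟨a', h1, h2⟩
      · exfalso
        have : c ∈ o g N := by rw [h2]; simp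
        exact hc (List.eq_of_mem_replicate this)
      · rcases a' with _ | ⟨b, a'⟩
        · exfalso
          have : c ∈ o g N := by
            simp only [List.nil_append] at h2; rw [← h2]; simp
          exact hc (List.eq_of_mem_replicate this)
        · simp only [List.cons_append, List.cons.injEq] at h2
          exact ⟨a', by rw [h2.2]⟩

theorem HR_split {g : ℕ} (hg : 2 ≤ g) {c : D g} (hc : c ≠ 1) (U V : List (D g)) (k l : ℕ)
    (hV : Ok k l V)
    (hU : ∀ u v1, U = u ++ o g (4*g-2) ++ v1 → v1 = [] ∧ c = -1) : HR g (U ++ c :: V) := by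
  intro u v h
  rcases split_run (by omega) hc h.symm with ⟨v1, h1, h2⟩ | ⟨u2, h1⟩
  · obtain ⟨rfl, rfl⟩ := hU _ _ h1
    rw [h2]; rfl
  · rw [h1] at hV
    have := Ok_run hV (by omega); omega

theorem run_cons {g : ℕ} {N : ℕ} {x : D g} {B u v : List (D g)} (h : x :: B = u ++ o g (N+1) ++ v) :
    ∃ u' v', B = u' ++ o g N ++ v' := by
  rcases u with _ | ⟨b, u⟩
  · simp only [o, List.replicate_succ, List.nil_append, List.cons_append, List.cons.injEq] at h
    exact ⟨[], v, by simpa using h.2⟩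
  · simp only [List.cons_append, List.cons.injEq] at h
    refine ⟨u, 1 :: v, ?_⟩
    rw [h.2, ← o_add g N 1]; simp

theorem run_snoc {g : ℕ} {N : ℕ} {x : D g} {B u v : List (D g)} (h : B ++ [x] = u ++ o g (N+1) ++ v) :
    ∃ u' v', B = u' ++ o g N ++ v' := by
  have h2 := congrArg List.reverse h
  simp only [List.reverse_append, List.reverse_replicate, List.reverse_cons, List.reverse_nil,
    List.nil_append, List.singleton_append] at h2
  rw [← List.append_assoc] at h2
  obtain ⟨u', v', h3⟩ := run_cons h2
  refine ⟨v'.reverse, u'.reverse, ?_⟩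
  have := congrArg List.reverse h3
  simpa using this

theorem HR_simple {g : ℕ} (hg : 2 ≤ g) (Y B : List (D g)) (hY : Ok 0 0 Y) (hB : Ok 0 0 B)
    (hl : Y.getLast? ≠ some 1) : HR g (Y ++ 1 :: B) := by
  have key : ∀ u v, 1 :: B ≠ u ++ o g (4*g-2) ++ v := by
    intro u v h
    rw [show 4*g-2 = (4*g-3)+1 by omega] at h
    obtain ⟨u', v', h'⟩ := run_cons h
    rw [h'] at hB
    have := Ok_run hB (by omega); omega
  rcases List.eq_nil_or_concat Y with rfl | ⟨Y', c, rfl⟩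
  · intro u v h; exact absurd h (key u v)
  · rw [List.concat_eq_append] at *
    have hc : c ≠ 1 := by rintro rfl; simp at hl
    intro u v h
    rw [List.append_assoc] at h
    rcases split_run (by omega) hc h.symm with ⟨v1, h1, h2⟩ | ⟨u2, h1⟩
    · rw [h1, List.append_assoc _ v1] at hY
      have := Ok_run hY (by omega); omega
    · exact absurd h1 (key _ _)

end SGP


namespace SGP

theorem hf_ne {g : ℕ} (hg : 2 ≤ g) (k : ℤ) (h1 : k ≤ 3) (h2 : -3 ≤ k) : hf g ≠ (k : D g) := by
  intro h
  apply cast_ne (g := g) (2*g - k) (by omega) (by omega) (by omega)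
  push_cast
  rw [← h]; simp [hf]

theorem sub_aux {g : ℕ} (hg : 2 ≤ g) (k : ℕ) (hk : k ≤ 2) :
    hf g - k ≠ 1 ∧ hf g - k ≠ -1 := by
  constructor
  · intro h; apply hf_ne hg (1+k) (by omega) (by omega); push_cast; linear_combination h
  · intro h; apply hf_ne hg (-1+k) (by omega) (by omega); push_cast; linear_combination h

theorem S_sum {g : ℕ} (hg : 2 ≤ g) (m : ℕ) : (S g m).sum + (S g m).length * hf g = hf g - 2 := by
  have h0 : ((2*g-2 : ℕ) : D g) = hf g - 2 := by
    rw [Nat.cast_sub (by omega)]; simp [hf]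
  induction m with
  | zero =>
    simp only [S, List.sum_replicate, List.length_replicate, nsmul_eq_mul, h0]
    linear_combination hf_mul g - hf_add g
  | succ m ih =>
    simp only [S, List.sum_append, List.sum_replicate, List.length_append, List.length_replicate, nsmul_eq_mul, List.sum_cons,
      List.length_cons]
    push_cast
    rw [h0]
    linear_combination ih + hf_mul g

theorem sum_contra {g : ℕ} (hg : 2 ≤ g) (m : ℕ) (a : List (D g)) (ha : a = 1 :: S g m)
    (h : 1 + 1 + a.sum + hf g * (a.length + 1) = 0) : False := by
  subst ha
  simp only [List.sum_cons, List.length_cons] at h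
  push_cast at h
  apply hf_ne hg (-1) (by omega) (by omega)
  push_cast
  linear_combination h - S_sum hg m - hf_add g

theorem comb1 {g : ℕ} (hg : 2 ≤ g) (w a Y2 : List (D g)) (p q : D g) (hY2 : Y2 = ng w.reverse)
    (ha : Ok 0 0 a) (hw : Ok 0 0 w) (hY : Ok 0 0 Y2) (hp : p ≠ 0) (hq : q ≠ 0)
    (I1 : ∀ u v, Y2 ++ p :: a ≠ u ++ o g (4*g-2) ++ v)
    (I2 : ∀ u v, a ++ q :: w ≠ u ++ o g (4*g-2) ++ v)
    (I2n : ∀ u v, ng a ++ (-q) :: ng w ≠ u ++ o g (4*g-2) ++ v)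
    (hsum : p + q + a.sum + hf g * (a.length + 1) = 0)
    (hx1 : w.head? ≠ some 1) :
    Fin' g (8*g) (hf g) (Y2 ++ p :: (a ++ q :: (w ++ [hf g]))) := by
  have hf1 : hf g ≠ 1 := by have := hf_ne hg 1 (by omega) (by omega); simpa using this
  have hfm : hf g ≠ -1 := by have := hf_ne hg (-1) (by omega) (by omega); simpa using this
  have hf2 : hf g ≠ 2 := by have := hf_ne hg 2 (by omega) (by omega); simpa using this
  have hfm2 : hf g ≠ -2 := by have := hf_ne hg (-2) (by omega) (by omega); simpa using this
  have hf0 : hf g ≠ 0 := by have := hf_ne hg 0 (by omega) (by omega); simpa using this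
  obtain ⟨q1, q2, q3, q4, q5, q6, q7, q8, q9, q10⟩ := nc hg
  -- heads
  have hxh : ∀ c : D g, c ≠ hf g → (w ++ [hf g]).head? = some c → ∃ w', w = c :: w' := by
    intro c hc h
    rcases w with _ | ⟨b, w⟩
    · simp at h; exact absurd h.symm hc
    · simp at h; exact ⟨w, by rw [h]⟩
  have hok : Ok 0 0 (w ++ [hf g]) := by
    rw [Ok_app]
    refine ⟨hw, hf0, ?_, ?_, trivial⟩
    · have := step_le_one (k := rp 0 w) hf1; omega
    · have := step_le_one (k := rn 0 w) (t := -hf g) (by rw [neg_hf]; exact hf1); omega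
  have hlx : (w ++ [hf g]).getLast? = some (hf g) := by simp
  have hYl : Y2.getLast? = some 1 → (w ++ [hf g]).head? = some (-1) := by
    intro h
    rw [hY2] at h
    rcases w with _ | ⟨b, w⟩
    · simp at h
    · simp at h ⊢; rw [← h]; simp
  have hnYl : (ng Y2).getLast? ≠ some 1 := by
    rw [hY2, ng_ng]
    rcases w with _ | ⟨b, w⟩
    · simp
    · simpa using hx1
  have I1' : ∀ U V u v, Y2 ++ p :: a = U ++ V → U ≠ u ++ o g (4*g-2) ++ v := by
    intro U V u v h h'
    apply I1 u (v ++ V); rw [h, h']; simp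
  -- second stage
  have st2 : ∀ p' B z, p' ≠ 0 → Ok 0 0 B → B.getLast? = some z → z ≠ 1 → z ≠ -1 →
      (p' = 1 → HR g (Y2 ++ 1 :: B)) → Eqv g (p :: (a ++ q :: (w ++ [hf g]))) (p' :: B) →
      (a ++ q :: (w ++ [hf g])).length ≤ B.length + 4*g →
      Fin' g (8*g) (hf g) (Y2 ++ p :: (a ++ q :: (w ++ [hf g]))) := by
    intro p' B z h1 h2 h3 h4 h5 h6 h7 h8
    have h := CL1 hg p' Y2 B z h1 hY h2 h3 h4 h5 h6
      (fun _ => HR_simple hg (ng Y2) (ng B) hY.neg h2.neg hnYl)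
    have := (Fin'.of (hf g) h).trans (L := Y2 ++ p :: (a ++ q :: (w ++ [hf g]))) (c := 4*g) ?_ ?_
    · rw [show 8*g = 4*g+4*g by ring]; exact this
    · simpa using h7.app_left (hf g :: Y2)
    · rw [List.length_append, List.length_cons, List.length_append (as := Y2), List.length_cons]
      omega
  -- simple
  have hsimple : ∀ B, Ok 0 0 B → ((w ++ [hf g]).head? = some (-1) → HR g (Y2 ++ 1 :: B)) →
      HR g (Y2 ++ 1 :: B) := by
    intro B hB h
    by_cases h' : Y2.getLast? = some 1
    · exact h (hYl h')
    · exact HR_simple hg _ _ hY hB h'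
  -- special
  have spec : ∀ Y3 c μ B' z, Y2 = Y3 ++ [c] → Ok 0 0 (μ :: B') → (μ :: B').getLast? = some z →
      z ≠ 1 → z ≠ -1 → c + μ ≠ 0 → c + μ ≠ 1 → c + μ ≠ -1 →
      Eqv g (p :: (a ++ q :: (w ++ [hf g]))) (0 :: μ :: B') →
      (a ++ q :: (w ++ [hf g])).length ≤ (μ :: B').length + 4*g →
      Fin' g (8*g) (hf g) (Y2 ++ p :: (a ++ q :: (w ++ [hf g]))) := by
    intro Y3 c μ B' z e1 h2 h3 h4 h5 c0 c1 cm h7 h8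
    have hY3 : Ok 0 0 Y3 := by rw [e1, Ok_app] at hY; exact hY.1
    have hB' : Ok 0 0 B' := h2.2.2.2.mono (Nat.zero_le _) (Nat.zero_le _)
    have hlB : ∀ t : D g, z ≠ t → B'.getLast? ≠ some t := by
      intro t ht h
      rw [List.getLast?_cons, h] at h3
      exact ht (by simpa using h3.symm)
    have h := CJ hg (c+μ) Y3 B' c0 c1 cm hY3 hB' (hlB _ h4) (hlB _ h5)
    have := (Fin'.of (hf g) h).trans (L := Y2 ++ p :: (a ++ q :: (w ++ [hf g]))) (c := 8*g-2) ?_ ?_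
    · rw [show 8*g = 8*g-2+2 by omega]; exact this
    · have e2 := h7.app_left (hf g :: Y2)
      have e3 := (Eqv.pop c μ).ctx (hf g :: Y3) B'
      rw [e1] at e2 ⊢
      refine Eqv.trans (by simpa using e2) ?_
      simpa using e3
    · rw [e1]
      simp only [List.length_append, List.length_cons, List.length_nil] at h8 ⊢
      omega
  -- first stage
  have H1 : HR g (a ++ q :: (w ++ [hf g])) := by
    have := HR_split hg hf1 (a ++ q :: w) [] 0 0 trivial (fun u v h => absurd h (I2 u v))
    simpa using this
  have H2 : HR g (ng a ++ (-q) :: ng (w ++ [hf g])) := by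
    have := HR_split hg hf1 (ng a ++ (-q) :: ng w) [] 0 0 trivial (fun u v h => absurd h (I2n u v))
    simpa [neg_hf] using this
  rcases CL1 hg q a (w ++ [hf g]) (hf g) hq ha hok hlx hf1 hfm (by rintro rfl; exact H1)
    (by rintro rfl; simpa using H2) with h | h | h
  · -- O0
    refine st2 p _ (hf g) hp h (by rw [show a ++ q :: (w ++ [hf g]) = (a ++ q :: w) ++ [hf g] by simp]; exact List.getLast?_concat) hf1 hfm ?_ (.refl _) (by omega)
    intro hp1
    apply hsimple _ h
    intro hh
    obtain ⟨w', hw'⟩ := hxh (-1) (Ne.symm hfm) hh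
    have e : Y2 ++ 1 :: (a ++ q :: (w ++ [hf g])) = (Y2 ++ 1 :: a ++ [q]) ++ (-1) :: (w' ++ [hf g]) := by
      rw [hw']; simp
    rw [e]
    have hV := (show Ok 0 0 (-1 :: (w' ++ [hf g])) by rw [hw'] at hok; exact hok).2.2.2
    refine HR_split hg q1 _ _ _ _ hV ?_
    intro u v1 h1
    refine ⟨?_, rfl⟩
    rcases List.eq_nil_or_concat v1 with h2 | ⟨v2, c, rfl⟩
    · exact h2
    · exfalso
      rw [List.concat_eq_append, ← List.append_assoc] at h1
      have := (List.append_inj' h1 rfl).1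
      exact I1 u v2 (by rw [hp1]; exact this)
  · -- O+
    obtain ⟨D, D', μ, B', e1, e2, e3, e4, e5, e6, e7⟩ := h
    obtain ⟨k, hk, hkl⟩ := e7 _ hlx
    obtain ⟨z1, z2⟩ := sub_aux hg k hk
    have hμ1 : μ ≠ 1 := by rcases e5 with rfl | rfl; exacts [q1, q10]
    rcases List.eq_nil_or_concat D with rfl | ⟨D1, t, hDt⟩
    · have hE := e2 p
      simp only [dL, List.singleton_append, List.nil_append] at hE e3
      by_cases hp0 : p - 1 = 0
      · have hp1 : p = 1 := by linear_combination hp0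
        rcases e6 with h | h | ⟨h1, h2, m, h3⟩
        · exfalso
          obtain ⟨w', hw'⟩ := hxh 1 (Ne.symm hf1) h
          rw [hw'] at hx1; simp at hx1
        · obtain ⟨w', hw'⟩ := hxh 2 (Ne.symm hf2) h
          rw [hp0] at hE
          have m1 := ne_of_sub hg (-2 + -1) 0 (by norm_num) (by norm_num) (by norm_num)
          have m2 := ne_of_sub hg (-2 + -1) 1 (by norm_num) (by norm_num) (by norm_num)
          have m3 := ne_of_sub hg (-2 + -1) (-1) (by norm_num) (by norm_num) (by norm_num)
          have m4 := ne_of_sub hg (-2 + -2) 0 (by norm_num) (by norm_num) (by norm_num)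
          have m5 := ne_of_sub hg (-2 + -2) 1 (by norm_num) (by norm_num) (by norm_num)
          have m6 := ne_of_sub hg (-2 + -2) (-1) (by norm_num) (by norm_num) (by norm_num)
          norm_num at m1 m2 m3 m4 m5 m6
          refine spec (ng w'.reverse) (-2) μ B' _ (by rw [hY2, hw']; simp) e3 hkl z1 z2 ?_ ?_ ?_ hE ?_
          · rcases e5 with rfl | rfl <;> norm_num <;> assumption
          · rcases e5 with rfl | rfl <;> norm_num <;> assumption
          · rcases e5 with rfl | rfl <;> norm_num <;> assumption
          · simp at e4 ⊢; omega
        · exfalso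
          rw [hp1, h1] at hsum
          exact sum_contra hg m a (by rw [e1, h3]; rfl) hsum
      · refine st2 (p-1) (μ :: B') _ hp0 e3 hkl z1 z2 ?_ hE (by simp at e4 ⊢; omega)
        intro _
        have e : Y2 ++ 1 :: μ :: B' = (Y2 ++ [1]) ++ μ :: B' := by simp
        rw [e]
        refine HR_split hg hμ1 _ _ _ _ e3.2.2.2 ?_
        intro u v1 h1
        exfalso
        rw [show 4*g-2 = (4*g-3)+1 by omega] at h1
        obtain ⟨u', v', h'⟩ := run_snoc h1
        rw [h'] at hY
        have := Ok_run hY (by omega); omega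
    · rw [List.concat_eq_append] at hDt
      subst hDt
      have hE := e2 p
      rw [show p :: (D1 ++ [t]) = (p :: D1) ++ [t] from rfl, dL_snoc] at hE
      rw [dL_snoc] at e3
      refine st2 p (D1 ++ [t-1] ++ μ :: B') _ hp e3 (by rw [List.getLast?_append, hkl]; rfl) z1 z2 ?_ (by simpa using hE) ?_
      · intro hp1
        apply hsimple _ e3
        intro hh
        have hμ : μ = -1 := by
          rcases e6 with h | h | h
          · rw [hh] at h; exact absurd (by simpa using h) q1
          · rw [hh] at h; exact absurd (by simpa using h) q2
          · exact h.2.1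
        have e : Y2 ++ 1 :: (D1 ++ [t-1] ++ μ :: B') = (Y2 ++ 1 :: D1 ++ [t-1]) ++ μ :: B' := by simp
        rw [e]
        rw [Ok_app] at e3
        refine HR_split hg hμ1 _ _ _ _ e3.2.2.2.2 ?_
        intro u v1 h1
        refine ⟨?_, hμ⟩
        rcases List.eq_nil_or_concat v1 with h2 | ⟨v2, c, rfl⟩
        · exact h2
        · exfalso
          rw [List.concat_eq_append, ← List.append_assoc] at h1
          have := (List.append_inj' h1 rfl).1
          exact I1' _ ([t] ++ D') u v2 (by rw [hp1, e1]; simp) this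
      · simp at e4 ⊢; omega
  · -- O-
    obtain ⟨D, D', μ, B', e1, e2, e3, e4, e5, e6, e7⟩ := h
    have e1' : a = ng D ++ ng D' := by
      have := congrArg ng e1; rw [ng_ng] at this; simpa using this
    obtain ⟨k, hk, hkl⟩ := e7 (hf g) (by simp [neg_hf])
    obtain ⟨z1, z2⟩ := sub_aux hg k hk
    have hμ1 : μ ≠ 1 := by rcases e5 with rfl | rfl; exacts [q1, q10]
    have hE := (e2 (-p)).neg
    have hl0 : (p :: (a ++ q :: (w ++ [hf g]))) = List.map (fun x => -x)
      (-p :: (ng a ++ -q :: ng (w ++ [hf g]))) := by simp [Function.comp_def]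
    rw [← hl0] at hE
    have e4' : (a ++ q :: (w ++ [hf g])).length ≤ D.length + 1 + B'.length + 4*g := by
      simp at e4 ⊢; omega
    rcases List.eq_nil_or_concat D with rfl | ⟨D1, t, hDt⟩
    · simp only [dL, List.singleton_append, List.nil_append, List.map_cons] at hE e3
      have e8 : -(-p - 1) = p + 1 := by ring
      rw [e8] at hE
      have e3n := e3.neg
      rw [List.map_cons] at e3n
      by_cases hp0 : p + 1 = 0
      · have hp1 : p = -1 := by linear_combination hp0
        rw [hp0] at hE
        have key : ∀ c : SGP.D g, (c = 1 ∨ c = 2) → (ng (w ++ [hf g])).head? = some c →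
            Fin' g (8*g) (hf g) (Y2 ++ p :: (a ++ q :: (w ++ [hf g]))) := by
          intro c hc h
          have hch : (w ++ [hf g]).head? = some (-c) := by
            rw [ng, List.head?_map, Option.map_eq_some_iff] at h
            obtain ⟨b, hb, hb2⟩ := h
            rw [hb, ← hb2]; simp
          obtain ⟨w', hw'⟩ := hxh (-c) (by rcases hc with rfl | rfl; exacts [Ne.symm hfm, Ne.symm hfm2]) hch
          have m1 := ne_of_sub hg (1 + 1) 0 (by norm_num) (by norm_num) (by norm_num)
          have m2 := ne_of_sub hg (1 + 1) 1 (by norm_num) (by norm_num) (by norm_num)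
          have m3 := ne_of_sub hg (1 + 1) (-1) (by norm_num) (by norm_num) (by norm_num)
          have m4 := ne_of_sub hg (1 + 2) 0 (by norm_num) (by norm_num) (by norm_num)
          have m5 := ne_of_sub hg (1 + 2) 1 (by norm_num) (by norm_num) (by norm_num)
          have m6 := ne_of_sub hg (1 + 2) (-1) (by norm_num) (by norm_num) (by norm_num)
          have m1' := ne_of_sub hg (2 + 1) 0 (by norm_num) (by norm_num) (by norm_num)
          have m2' := ne_of_sub hg (2 + 1) 1 (by norm_num) (by norm_num) (by norm_num)
          have m3' := ne_of_sub hg (2 + 1) (-1) (by norm_num) (by norm_num) (by norm_num)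
          have m4' := ne_of_sub hg (2 + 2) 0 (by norm_num) (by norm_num) (by norm_num)
          have m5' := ne_of_sub hg (2 + 2) 1 (by norm_num) (by norm_num) (by norm_num)
          have m6' := ne_of_sub hg (2 + 2) (-1) (by norm_num) (by norm_num) (by norm_num)
          norm_num at m1 m2 m3 m4 m5 m6 m1' m2' m3' m4' m5' m6'
          refine spec (ng w'.reverse) c (-μ) (ng B') (-(hf g - k)) (by rw [hY2, hw']; simp) e3n ?_
            (fun h => z2 (by linear_combination -h)) (fun h => z1 (by linear_combination -h)) ?_ ?_ ?_ hE ?_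
          · have := congrArg (Option.map (fun x => -x)) hkl
            rw [← List.getLast?_map] at this
            simpa using this
          · rcases e5 with rfl | rfl <;> rcases hc with rfl | rfl <;> rw [neg_neg] <;> norm_num <;> assumption
          · rcases e5 with rfl | rfl <;> rcases hc with rfl | rfl <;> rw [neg_neg] <;> norm_num <;> assumption
          · rcases e5 with rfl | rfl <;> rcases hc with rfl | rfl <;> rw [neg_neg] <;> norm_num <;> assumption
          · simp at e4' ⊢; omega
        rcases e6 with h | h | ⟨h1, h2, m, h3⟩
        · exact key 1 (.inl rfl) h
        · exact key 2 (.inr rfl) h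
        · exfalso
          have hq1 : q = -1 := by linear_combination -h1
          rw [hp1, hq1] at hsum
          refine sum_contra hg m (ng a) (by rw [e1, h3]; rfl) ?_
          have hs : (ng a).sum = - a.sum := by
            rw [ng, List.sum_neg]
          rw [hs, List.length_map]
          linear_combination -hsum + (a.length + 1) * hf_add g
      · refine st2 (p+1) (-μ :: ng B') (-(hf g - k)) hp0 e3n ?_ (fun h => z2 (by linear_combination -h))
          (fun h => z1 (by linear_combination -h)) ?_ hE (by simp at e4' ⊢; omega)
        · have := congrArg (Option.map (fun x => -x)) hkl
          rw [← List.getLast?_map] at this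
          simpa using this
        · intro h; exact absurd (by linear_combination h) hp
    · rw [List.concat_eq_append] at hDt
      subst hDt
      rw [show -p :: (D1 ++ [t]) = (-p :: D1) ++ [t] from rfl, dL_snoc] at hE
      rw [dL_snoc] at e3
      have e3n := e3.neg
      have ht0 : t ≠ 0 := by
        intro h
        apply ha.ne0
        rw [e1', h]; simp
      simp only [List.map_append, List.map_cons, List.map_nil, List.cons_append, neg_neg] at hE e3n
      refine st2 p _ (-(hf g - k)) hp e3n ?_ (fun h => z2 (by linear_combination -h))
          (fun h => z1 (by linear_combination -h)) ?_ hE ?_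
      · have := congrArg (Option.map (fun x => -x)) hkl
        rw [← List.getLast?_map, List.map_cons] at this
        rw [List.getLast?_append, this]; rfl
      · intro hp1
        rw [List.append_assoc, Ok_app] at e3n
        have e : Y2 ++ 1 :: (List.map (fun x => -x) D1 ++ [-(t-1)] ++ -μ :: List.map (fun x => -x) B')
          = (Y2 ++ 1 :: ng D1) ++ (-(t-1)) :: (-μ :: ng B') := by simp
        rw [e]
        refine HR_split hg (fun h => ht0 (by linear_combination -h)) _ _ _ _ e3n.2.2.2.2 ?_
        intro u v1 h1
        exact absurd h1 (I1' _ ([-t] ++ ng D') u v1 (by rw [hp1, e1']; simp))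
      · simp at e4' ⊢; omega

theorem comb {g : ℕ} (hg : 2 ≤ g) (w a Y2 : List (D g)) (p q : D g) (hY2 : Y2 = ng w.reverse)
    (ha : Ok 0 0 a) (hw : Ok 0 0 w) (hY : Ok 0 0 Y2) (hp : p ≠ 0) (hq : q ≠ 0)
    (I1 : ∀ u v, Y2 ++ p :: a ≠ u ++ o g (4*g-2) ++ v)
    (I2 : ∀ u v, a ++ q :: w ≠ u ++ o g (4*g-2) ++ v)
    (I1n : ∀ u v, ng Y2 ++ (-p) :: ng a ≠ u ++ o g (4*g-2) ++ v)
    (I2n : ∀ u v, ng a ++ (-q) :: ng w ≠ u ++ o g (4*g-2) ++ v)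
    (hsum : p + q + a.sum + hf g * (a.length + 1) = 0) :
    Fin' g (8*g) (hf g) (Y2 ++ p :: (a ++ q :: (w ++ [hf g]))) := by
  by_cases hx : w.head? = some 1
  · apply Fin'.neg
    have := comb1 hg (ng w) (ng a) (ng Y2) (-p) (-q) (by rw [hY2]; simp) ha.neg hw.neg hY.neg
      (by simpa using hp) (by simpa using hq) I1n I2n (by simpa [ng_ng] using I2) (by
        have hs : (ng a).sum = - a.sum := by
          rw [ng, List.sum_neg]
        rw [hs, List.length_map]
        linear_combination -hsum + (a.length + 1) * hf_add g) (by
        rw [ng, List.head?_map, hx]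
        intro h
        exact (nc hg).1 (by simpa using h))
    simpa [neg_hf] using this
  · exact comb1 hg w a Y2 p q hY2 ha hw hY hp hq I1 I2 I2n hsum hx

end SGP


namespace SGP

theorem short_pos {g : ℕ} (hg : 2 ≤ g) (C : List (D g)) (s r : D g) (hC : Ok 0 0 C)
    (h : 2*g ≤ step (rp 0 C) (1 : D g)) :
    ∃ M, Eqv g (s :: (C ++ [1] ++ [r])) M ∧ M.length = C.length + 1 := by
  rw [step_one] at h
  have h2 := (Ok_lt hC (by omega) (by omega)).1
  obtain ⟨D, M, e, hP⟩ := struct hg C (2*g-2) hC (by omega)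
  obtain ⟨m, rfl⟩ := hP.S rfl
  refine ⟨dL (s::D) ++ nS g m ++ (r-1) :: [], ?_, ?_⟩
  · have := eqv_rem hg m s r D []
    rw [e]; simpa using this
  · rw [e]; simp [dL_length]; omega

theorem short {g : ℕ} (hg : 2 ≤ g) (L : List (D g)) : ∀ (s r : D g), ¬ Ok 0 0 L →
    ∃ M, Eqv g (s :: (L ++ [r])) M ∧ M.length = L.length := by
  induction L using List.reverseRecOn with
  | nil => intro s r h; exact absurd trivial h
  | append_singleton C x ih =>
    intro s r h
    by_cases hC : Ok 0 0 C
    · by_cases hx : x = 0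
      · subst hx
        rcases List.eq_nil_or_concat C with rfl | ⟨D, t, rfl⟩
        · exact ⟨_, Eqv.pop s r, rfl⟩
        · refine ⟨s :: (D ++ [t + r]), ?_, ?_⟩
          · have := (Eqv.pop t r).ctx (s :: D) []
            simpa using this
          · simp
      · by_cases hp : 2*g ≤ step (rp 0 C) x
        · have hx1 : x = 1 := by
            by_contra hx1
            have := step_le_one (k := rp 0 C) hx1; omega
          subst hx1
          obtain ⟨M, h1, h2⟩ := short_pos hg C s r hC hp
          exact ⟨M, h1, by simp [h2]⟩
        · have hn : 2*g ≤ step (rn 0 C) (-x) := by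
            by_contra hn
            apply h
            rw [Ok_app]
            exact ⟨hC, hx, by omega, by omega, trivial⟩
          have hx1 : -x = 1 := by
            by_contra hx1
            have := step_le_one (k := rn 0 C) hx1; omega
          rw [hx1, ← rp_neg] at hn
          obtain ⟨M, h1, h2⟩ := short_pos hg (ng C) (-s) (-r) hC.neg hn
          refine ⟨ng M, ?_, ?_⟩
          · have := h1.neg
            have e : x = -1 := by rw [← hx1]; ring
            rw [e]
            simpa [Function.comp_def] using this
          · simpa using h2
    · obtain ⟨M, h1, h2⟩ := ih s x hC
      refine ⟨M ++ [r], ?_, by simp [h2]⟩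
      simpa using h1.app_right [r]

/-- turns of a list of directions -/
def tn {g : ℕ} : List (D g) → List (D g)
  | [] => []
  | y::Y => tf y Y

theorem tn_cons {g : ℕ} (a b : D g) (L : List (D g)) : tn (a::b::L) = (b-a-hf g) :: tn (b::L) := rfl

theorem tn_app {g : ℕ} (P : List (D g)) (u v : D g) (Q : List (D g)) :
    tn (P ++ u :: v :: Q) = tn (P ++ [u]) ++ (v - u - hf g) :: tn (v::Q) := by
  induction P with
  | nil => rfl
  | cons a P ih =>
    rcases P with _ | ⟨b, P⟩
    · rfl
    · simp only [List.cons_append, tn_cons] at ih ⊢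
      rw [ih]

theorem tn_rev {g : ℕ} (L : List (D g)) : tn (L.map (fun x => x + hf g)).reverse = ng (tn L).reverse := by
  induction L with
  | nil => rfl
  | cons a L ih =>
    rcases L with _ | ⟨b, L⟩
    · rfl
    · simp only [List.map_cons, List.reverse_cons, List.append_assoc, List.singleton_append, tn_cons, List.map_append] at ih ⊢
      rw [tn_app]
      simp only [List.map_reverse] at ih ⊢
      rw [ih]
      simp only [tn, tf, List.map_cons, List.map_nil]
      congr 2
      linear_combination - hf_add g

theorem tn_length {g : ℕ} (L : List (D g)) : (tn L).length = L.length - 1 := by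
  rcases L with _ | ⟨b, L⟩
  · rfl
  · simp [tn, tf_length]

theorem geo_ok {g : ℕ} (hg : 2 ≤ g) (W : SG.Word g)
    (h : ∀ W' : SG.Word g, SG.eval g W' = SG.eval g W → W.length ≤ W'.length) :
    Ok 0 0 (tn (W.map dir)) := by
  rcases W with _ | ⟨y, Y⟩
  · trivial
  by_contra hno
  simp only [List.map_cons, tn] at hno
  obtain ⟨M, h1, h2⟩ := short hg _ 0 0 hno
  rcases List.eq_nil_or_concat M with rfl | ⟨M0, r, hM⟩
  · apply hno
    have : tf (dir y) (Y.map dir) = [] := List.eq_nil_of_length_eq_zero h2.symm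
    rw [this]; trivial
  rw [List.concat_eq_append] at hM
  subst hM
  obtain ⟨e1, e2⟩ := h1.sound hg (dir y - hf g)
  have e3 : dir y - hf g + hf g + 0 = dir y := by ring
  simp only [path, fin, path_app, fin_app, path_tf, e3] at e1 e2
  rw [← e2, pr_cons, pr_app, pr_app, ← mul_assoc, ← pr_cons] at e1
  have e4 := mul_right_cancel e1
  have := h ((path (dir y - hf g) M0).map (ltr hg)) (by
    rw [pr_eval, eval_pr hg, List.map_cons, e4])
  simp [path_length, tf_length] at this h2
  omega

end SGP


namespace SGP

theorem fr_map_hf {g : ℕ} (c e d : D g) (k : ℕ) : (fr c d k).map (fun x => x + e) = fr c (d + e) k := by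
  induction k generalizing d with
  | zero => rfl
  | succ k ih => simp only [fr, List.map_cons, ih]; congr 2; ring

theorem fr_rev {g : ℕ} (c d : D g) (k : ℕ) : (fr c d k).reverse = fr (-c) (d + k*c - c) k := by
  induction k generalizing d with
  | zero => rfl
  | succ k ih =>
    rw [fr_succ_right, List.reverse_append, List.reverse_singleton, ih, List.singleton_append]
    simp only [fr]
    push_cast
    congr 1
    · ring
    · congr 1; ring

theorem fr_rot1 {g : ℕ} (c d : D g) (N : ℕ) (hN : 0 < N) (hc : (N : D g) * c = 0) :
    (fr c d N).rotate 1 = fr c (d + c) N := by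
  obtain ⟨M, rfl⟩ : ∃ M, N = M+1 := ⟨N-1, by omega⟩
  rw [fr_succ_right c (d+c)]
  simp only [fr, List.rotate_cons_succ, List.rotate_zero]
  congr 2
  push_cast at hc
  linear_combination -hc

theorem fr_rot {g : ℕ} (c d : D g) (N n : ℕ) (hN : 0 < N) (hc : (N : D g) * c = 0) :
    (fr c d N).rotate n = fr c (d + n*c) N := by
  induction n with
  | zero => simp
  | succ n ih =>
    rw [← List.rotate_rotate, ih, fr_rot1 c _ N hN hc]
    congr 1; push_cast; ring

theorem fr_take {g : ℕ} (c d : D g) (k N : ℕ) (h : k ≤ N) : (fr c d N).take k = fr c d k := by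
  obtain ⟨l, rfl⟩ := Nat.exists_eq_add_of_le h
  rw [fr_add, List.take_left' (fr_length _ _ _)]

theorem NN {g : ℕ} (N : ℕ) (hN : N = 2*g+2*g) : (N : D g) = 0 := by
  have := hf_add g
  rw [hN]; push_cast; simp only [hf] at this; push_cast at this; exact this

theorem Rinv_dir {g : ℕ} (N : ℕ) (hN : N = 2*g+2*g) :
    (SG.wordInv g (SG.Rword g)).map dir = fr (-(hf g + 1)) (hf g - (hf g + 1)) N := by
  rw [SG.wordInv, List.map_reverse, List.map_map]
  have : (dir ∘ SG.invLetter g) = (fun x => x + hf g) ∘ dir := by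
    funext a; exact dir_inv a
  rw [this, ← List.map_map, Rword_dir, ← hN, fr_map_hf, fr_rev, NN N hN]
  congr 1; ring

theorem RSet_dir {g : ℕ} (hg : 2 ≤ g) (N : ℕ) (hN : N = 2*g+2*g) (B : SG.Word g) (h : B ∈ SG.RSet g) :
    ∃ ε d : D g, (ε = 1 ∨ ε = -1) ∧ B.map dir = fr (ε*(hf g + 1)) d N := by
  have hz := NN N hN
  rcases h with ⟨n, hn⟩ | ⟨n, hn⟩
  · refine ⟨1, 0 + n * (hf g + 1), .inl rfl, ?_⟩
    rw [← hn, List.map_rotate, Rword_dir, ← hN, fr_rot _ _ _ _ (by omega) (by rw [hz, zero_mul]), one_mul]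
  · refine ⟨-1, (hf g - (hf g + 1)) + n * -(hf g + 1), .inr rfl, ?_⟩
    rw [← hn, List.map_rotate, Rinv_dir N hN, fr_rot _ _ _ _ (by omega) (by rw [hz, zero_mul]), neg_one_mul]

theorem exists_nat {g : ℕ} (hg : 2 ≤ g) (d : D g) : ∃ n : ℕ, (n : D g) = d := by
  have : NeZero (4*g) := ⟨by omega⟩
  exact ⟨d.val, ZMod.natCast_zmod_val _⟩

theorem RSet_ex {g : ℕ} (hg : 2 ≤ g) (N : ℕ) (hN : N = 2*g+2*g) (ε d : D g) (hε : ε = 1 ∨ ε = -1) :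
    ∃ B ∈ SG.RSet g, B.map dir = fr (ε*(hf g + 1)) d N := by
  have hz := NN N hN
  have hh := hf_add g
  have hm := hf_mul g
  rcases hε with rfl | rfl
  · obtain ⟨n, hn⟩ := exists_nat hg ((hf g + 1) * d)
    refine ⟨(SG.Rword g).rotate n, .inl ⟨n, rfl⟩, ?_⟩
    rw [List.map_rotate, Rword_dir, ← hN, fr_rot _ _ _ _ (by omega) (by rw [hz, zero_mul]), one_mul, hn]
    congr 1; linear_combination d * hm + d * hh
  · obtain ⟨n, hn⟩ := exists_nat hg (-(hf g + 1) * (d+1))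
    refine ⟨(SG.wordInv g (SG.Rword g)).rotate n, .inr ⟨n, rfl⟩, ?_⟩
    rw [List.map_rotate, Rinv_dir N hN, fr_rot _ _ _ _ (by omega) (by rw [hz, zero_mul]), neg_one_mul, hn]
    congr 1; linear_combination (d+1) * hm + (d+1) * hh

theorem tn_fr {g : ℕ} (ε d : D g) (hε : ε = 1 ∨ ε = -1) (k : ℕ) :
    tn (fr (ε*(hf g + 1)) d (k+1)) = List.replicate k ε := by
  induction k generalizing d with
  | zero => rfl
  | succ k ih =>
    simp only [fr] at ih ⊢
    rw [tn_cons, ih, List.replicate_succ]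
    congr 1
    linear_combination eps_hf hε

theorem fr_of_tn {g : ℕ} (ε y : D g) (Y : List (D g)) (hε : ε = 1 ∨ ε = -1) (k : ℕ)
    (h : tn (y::Y) = List.replicate k ε) : y::Y = fr (ε*(hf g + 1)) y (k+1) := by
  have := path_tf y Y
  rw [show tf y Y = List.replicate k ε from h, path_rep _ _ hε] at this
  rw [← this]; rfl

theorem FR_of {g : ℕ} (hg : 2 ≤ g) (k : ℕ) (W : SG.Word g) (ε : D g) (hε : ε = 1 ∨ ε = -1)
    (h1 : 1 ≤ k) (h2 : k + 1 ≤ 4*g) (hl : W.length = k+1) (h : tn (W.map dir) = List.replicate k ε) :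
    SG.IsFR g (k+1) W := by
  rcases W with _ | ⟨y, Y⟩
  · simp at hl
  have h3 := fr_of_tn ε (dir y) (Y.map dir) hε k h
  obtain ⟨B, hB, e⟩ := RSet_ex hg (2*g+2*g) rfl ε (dir y) hε
  refine ⟨by omega, h2, B, hB, ?_⟩
  apply List.map_injective_iff.2 (dir_bij hg).injective
  rw [List.map_take, e, fr_take _ _ _ _ (by omega), ← h3]; rfl

theorem FR_inv {g : ℕ} (hg : 2 ≤ g) (k : ℕ) (W : SG.Word g) (h : SG.IsFR g (k+1) W) :
    ∃ ε : D g, (ε = 1 ∨ ε = -1) ∧ tn (W.map dir) = List.replicate k ε := by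
  obtain ⟨h1, h2, B, hB, e⟩ := h
  obtain ⟨ε, d, hε, h3⟩ := RSet_dir hg (2*g+2*g) rfl B hB
  refine ⟨ε, hε, ?_⟩
  rw [e, List.map_take, h3, fr_take _ _ _ _ (by omega), tn_fr _ _ hε]

/-- split a list of directions along a split of its turns -/
theorem tn_split {g : ℕ} (L u r v : List (D g)) (h : tn L = u ++ r ++ v) (hr : r ≠ []) :
    ∃ P F Q, L = P ++ F ++ Q ∧ tn F = r ∧ F.length = r.length + 1 ∧ P.length = u.length ∧
      (∀ a P', P = P' ++ [a] → ∃ t u', tn (a::F) = t :: r ∧ u = u' ++ [t]) ∧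
      (∀ b Q', Q = b :: Q' → ∃ t v', tn (F++[b]) = r ++ [t] ∧ v = t :: v') := by
  induction u generalizing L with
  | nil =>
    rcases L with _ | ⟨y, Y⟩
    · simp [tn] at h; simp [h] at hr
    refine ⟨[], y :: path y r, path (fin y r) v, ?_, ?_, ?_, rfl, ?_, ?_⟩
    · have := path_tf y Y
      rw [show tf y Y = r ++ v from h, path_app] at this
      simp [this]
    · exact tf_path _ _
    · simp [path_length]
    · simp
    · intro b Q' hb
      rcases v with _ | ⟨t, v⟩
      · simp [path] at hb
      · refine ⟨t, v, ?_, rfl⟩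
        simp only [path, List.cons.injEq] at hb
        have := tf_path y (r ++ [t])
        rw [path_app] at this
        simp only [path, hb.1] at this
        exact this
  | cons x u ih =>
    rcases L with _ | ⟨y, _ | ⟨z, Y⟩⟩
    · simp [tn] at h
    · simp [tn, tf] at h
    · rw [tn_cons] at h
      simp only [List.cons_append, List.cons.injEq] at h
      obtain ⟨P, F, Q, e1, e2, e3, e6, e4, e5⟩ := ih (z::Y) h.2
      refine ⟨y::P, F, Q, by rw [e1]; simp, e2, e3, by simp [e6], ?_, e5⟩
      intro a P' hP
      rcases P with _ | ⟨c, P⟩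
      · rcases P' with _ | ⟨c', P'⟩
        · simp at hP; subst hP
          rcases F with _ | ⟨f, F⟩
          · simp at e3
          simp only [List.nil_append, List.cons_append, List.cons.injEq] at e1
          have hzf := e1.1
          subst hzf
          refine ⟨x, [], ?_, ?_⟩
          · rw [tn_cons, e2, h.1]
          · rcases u with _ | ⟨x', u⟩
            · rfl
            · exfalso
              simp at e6
        · simp at hP
      · rcases P' with _ | ⟨c', P'⟩
        · simp at hP
        · simp at hP
          obtain ⟨t, u', h1, h2⟩ := e4 a P' hP.2
          exact ⟨t, x::u', h1, by rw [h2]; rfl⟩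

end SGP


namespace SGP

theorem noLLFR {g : ℕ} (hg : 2 ≤ g) (W : SG.Word g) (ε : D g) (hε : ε = 1 ∨ ε = -1)
    (h : ¬ SG.HasLLFR g (4*g-1) W) (u v : List (D g))
    (e : tn (W.map dir) = u ++ List.replicate (4*g-2) ε ++ v) :
    ∃ u' v', tn (W.map dir) = u' ++ List.replicate (4*g-1) ε ++ v' := by
  obtain ⟨k, hk⟩ : ∃ k, 4*g-2 = k+1 := ⟨4*g-3, by omega⟩
  have hk2 : 4*g-1 = k+1+1 := by omega
  rw [hk] at e
  rw [hk2] at h ⊢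
  obtain ⟨P, F, Q, e1, e2, e3, _, e4, e5⟩ := tn_split _ u _ v e (by simp)
  obtain ⟨PF, Q', e6, e7, hQ⟩ := List.map_eq_append_iff.1 e1
  obtain ⟨P', F', e8, hP, hF⟩ := List.map_eq_append_iff.1 e7
  by_contra hno
  apply h
  refine ⟨P', F', Q', by rw [e6, e8], ?_, ?_, ?_⟩
  · refine FR_of hg (k+1) F' ε hε (by omega) (by omega) ?_ (by rw [hF, e2])
    have := congrArg List.length hF
    simp at this e3; omega
  · intro a ha hfr
    obtain ⟨P'', hP''⟩ := List.getLast?_eq_some_iff.1 ha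
    obtain ⟨t, u', h1, h2⟩ := e4 (dir a) (P''.map dir) (by rw [← hP, hP'']; simp)
    obtain ⟨ε', _, h3⟩ := FR_inv hg _ _ hfr
    rw [List.map_cons, hF, h1, List.replicate_succ (n := k+1), List.replicate_succ (n := k), List.replicate_succ (n := k)] at h3
    simp only [List.cons.injEq] at h3
    apply hno
    refine ⟨u', v, ?_⟩
    rw [e, h2, List.replicate_succ (n := k+1), h3.1, ← h3.2.1]; simp
  · intro b hb hfr
    obtain ⟨Q'', hQ''⟩ : ∃ Q'', Q' = b :: Q'' := by
      rcases Q' with _ | ⟨c, Q''⟩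
      · simp at hb
      · simp at hb; exact ⟨Q'', by rw [hb]⟩
    obtain ⟨t, v', h1, h2⟩ := e5 (dir b) (Q''.map dir) (by rw [← hQ, hQ'']; simp)
    obtain ⟨ε', _, h3⟩ := FR_inv hg _ _ hfr
    rw [List.map_append, hF, List.map_singleton, h1, List.replicate_succ' (n := k+1)] at h3
    obtain ⟨h4, h5⟩ := List.append_inj' h3 rfl
    rw [List.replicate_succ, List.replicate_succ] at h4
    simp only [List.cons.injEq] at h4 h5
    apply hno
    refine ⟨u, v', ?_⟩
    rw [e, h2, List.replicate_succ' (n := k+1), h5.1, ← h4.1]; simp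

theorem run_mid1 {g : ℕ} (hg : 2 ≤ g) (a w u v : List (D g)) (q : D g) (ha : Ok 0 0 a) (hw : Ok 0 0 w)
    (h : a ++ q :: w = u ++ o g (4*g-1) ++ v) :
    q = 1 ∧ (∃ u', a = u' ++ o g (2*g-1)) ∧ ∃ v', w = o g (2*g-1) ++ v' := by
  rw [List.append_assoc, List.append_eq_append_iff] at h
  rcases h with ⟨b, h1, h2⟩ | ⟨b, h1, h2⟩
  · exfalso
    rw [show 4*g-1 = (4*g-2)+1 by omega, ← List.append_assoc] at h2
    obtain ⟨u', v', h3⟩ := run_cons h2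
    rw [h3] at hw
    have := Ok_run hw (by omega); omega
  · rw [List.append_eq_append_iff] at h2
    rcases h2 with ⟨c, h3, h4⟩ | ⟨c, h3, h4⟩
    · exfalso
      rw [h1, h3, ← List.append_assoc] at ha
      have := Ok_run ha (by omega); omega
    · obtain ⟨hl, h5, h6⟩ := List.append_eq_replicate_iff.1 h3.symm
      rw [h5] at h1
      rw [h6] at h4
      have hi : b.length < 2*g := by
        rcases Nat.eq_zero_or_pos b.length with hz | hz
        · omega
        · rw [h1] at ha
          exact Ok_run (v := []) (by simpa using ha) hz
      obtain ⟨j, hj⟩ : ∃ j, c.length = j+1 := ⟨c.length-1, by omega⟩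
      rw [hj, List.replicate_succ, List.cons_append, List.cons.injEq] at h4
      have hj2 : j < 2*g := by
        rcases Nat.eq_zero_or_pos j with hz | hz
        · omega
        · rw [h4.2] at hw
          exact Ok_run (u := []) (by simpa using hw) hz
      have hj3 : j = 2*g-1 := by omega
      have hb3 : b.length = 2*g-1 := by omega
      rw [hj3] at h4
      rw [hb3] at h1
      exact ⟨h4.1, ⟨u, h1⟩, v, h4.2⟩

theorem run_mid {g : ℕ} (hg : 2 ≤ g) (a w u v : List (D g)) (q ε : D g) (hε : ε = 1 ∨ ε = -1)
    (ha : Ok 0 0 a) (hw : Ok 0 0 w) (h : a ++ q :: w = u ++ List.replicate (4*g-1) ε ++ v) :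
    q = ε ∧ (∃ u', a = u' ++ List.replicate (2*g-1) ε) ∧ ∃ v', w = List.replicate (2*g-1) ε ++ v' := by
  rcases hε with rfl | rfl
  · exact run_mid1 hg a w u v q ha hw h
  · have h' := congrArg ng h
    simp only [ng, List.map_append, List.map_cons, List.map_replicate, neg_neg] at h'
    obtain ⟨h1, ⟨u', h2⟩, v', h3⟩ := run_mid1 hg _ _ _ _ _ ha.neg hw.neg h'
    refine ⟨by rw [← h1]; ring, ⟨ng u', ?_⟩, ng v', ?_⟩
    · have := congrArg ng h2
      rw [ng_ng] at this; simpa using this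
    · have := congrArg ng h3
      rw [ng_ng] at this; simpa using this

theorem lex_irr {g : ℕ} (T : SG.Word g) : ¬ List.Lex (SG.letterLt g) T T := by
  induction T with
  | nil => intro h; cases h
  | cons a T ih =>
    intro h
    cases h with
    | cons h => exact ih h
    | rel h => exact lt_irrefl _ h

theorem lex_pre {g : ℕ} (P Q Q' : SG.Word g) (h : List.Lex (SG.letterLt g) (P ++ Q) (P ++ Q')) :
    List.Lex (SG.letterLt g) Q Q' := by
  induction P with
  | nil => exact h
  | cons a P ih =>
    cases h with
    | cons h => exact ih h
    | rel h => exact absurd h (lt_irrefl _)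

theorem lex_suf {g : ℕ} (T Q Q' : SG.Word g) (hl : Q.length = Q'.length)
    (h : List.Lex (SG.letterLt g) (Q ++ T) (Q' ++ T)) : List.Lex (SG.letterLt g) Q Q' := by
  induction Q generalizing Q' with
  | nil =>
    rcases Q' with _ | ⟨b, Q'⟩
    · exact absurd h (lex_irr T)
    · simp at hl
  | cons a Q ih =>
    rcases Q' with _ | ⟨b, Q'⟩
    · simp at hl
    · cases h with
      | cons h => exact .cons (ih Q' (by simpa using hl) h)
      | rel h => exact .rel h

theorem eval_app {g : ℕ} (P Q : SG.Word g) : SG.eval g (P ++ Q) = SG.eval g P * SG.eval g Q := by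
  simp [SG.eval]

theorem irr_sub {g : ℕ} (P Q T : SG.Word g) (h : SG.IrreducibleWord g (P ++ Q ++ T)) :
    SG.IrreducibleWord g Q := by
  intro Q' e
  rcases h (P ++ Q' ++ T) (by simp only [eval_app, e]) with h | h | ⟨h1, h2⟩
  · left; simpa using h
  · right; left; simp at h; omega
  · right; right
    simp only [List.length_append] at h1
    have hl : Q.length = Q'.length := by omega
    refine ⟨hl, lex_suf T _ _ hl (lex_pre P _ _ (by simpa using h2))⟩

theorem irr_geo {g : ℕ} (W : SG.Word g) (h : SG.IrreducibleWord g W) (W' : SG.Word g)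
    (e : SG.eval g W' = SG.eval g W) : W.length ≤ W'.length := by
  rcases h W' e with h | h | h
  · rw [h]
  · omega
  · omega

theorem pr_flip2 {g : ℕ} (hg : 2 ≤ g) (ε s : D g) (hε : ε = 1 ∨ ε = -1) :
    pr hg (fr (ε*(hf g + 1)) s (2*g)) = pr hg (fr (-ε*(hf g + 1)) (s-ε) (2*g)) := by
  rcases hε with rfl | rfl
  · rw [one_mul, neg_one_mul]; exact pr_flip hg s
  · have := pr_flip hg (s+1)
    rw [neg_neg, one_mul, neg_one_mul, sub_neg_eq_add, this]
    congr 2; ring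

theorem flip_rank {g : ℕ} (hg : 2 ≤ g) (W : SG.Word g) (ε u : D g) (hε : ε = 1 ∨ ε = -1)
    (hW : SG.IrreducibleWord g W) (e : W.map dir = fr (ε*(hf g+1)) u (2*g)) :
    SG.rank g (ltr hg u) < SG.rank g (ltr hg (u-ε)) := by
  have h := hW ((fr (-ε*(hf g + 1)) (u-ε) (2*g)).map (ltr hg)) (by
    rw [pr_eval, ← pr_flip2 hg ε u hε, ← e, eval_pr])
  have hl : W = (fr (ε*(hf g+1)) u (2*g)).map (ltr hg) := by
    rw [← e, List.map_map]
    conv_lhs => rw [← List.map_id W]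
    apply List.map_congr_left
    intro a _; exact (ltr_dir hg a).symm
  obtain ⟨k, hk⟩ : ∃ k, 2*g = k+1 := ⟨2*g-1, by omega⟩
  have hne : ltr hg u ≠ ltr hg (u-ε) := by
    intro hh
    have := congrArg dir hh
    rw [dir_ltr, dir_ltr] at this
    exact eps_ne hg hε (by linear_combination this)
  rw [hl, hk] at h
  simp only [fr, List.map_cons] at h
  rcases h with h | h | ⟨_, h⟩
  · simp only [List.cons.injEq] at h
    exact absurd h.1.symm hne
  · simp [fr_length] at h
  · generalize ltr hg u = a at h hne ⊢
    generalize ltr hg (u-ε) = b at h hne ⊢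
    cases h with
    | cons h => exact absurd rfl hne
    | rel h => exact h

theorem head_rank {g : ℕ} (hg : 2 ≤ g) (y : SG.Letter g) (Y : SG.Word g) (ε : D g) (hε : ε = 1 ∨ ε = -1)
    (hW : SG.IrreducibleWord g (y::Y)) (v : List (D g))
    (e : tn ((y::Y).map dir) = List.replicate (2*g-1) ε ++ v) :
    SG.rank g (ltr hg (dir y)) < SG.rank g (ltr hg (dir y-ε)) := by
  have hne : List.replicate (2*g-1) ε ≠ [] := by simp; omega
  obtain ⟨P, F, Q, e1, e2, e3, e4, _, _⟩ := tn_split _ [] _ v e hne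
  have hP : P = [] := by simpa using e4
  subst hP
  obtain ⟨F', Q', e6, hF, hQ⟩ := List.map_eq_append_iff.1 e1
  rcases F with _ | ⟨f, F⟩
  · simp at e3
  have h3 := fr_of_tn ε f F hε _ e2
  have hf : dir y = f := by simp at e1; exact e1.1
  rw [show 2*g-1+1 = 2*g by omega] at h3
  refine flip_rank hg F' ε _ hε (irr_sub [] F' Q' (by simpa [← e6] using hW)) ?_
  rw [hF, hf]; simpa using h3

theorem tail_rank {g : ℕ} (hg : 2 ≤ g) (W : SG.Word g) (ε : D g) (hε : ε = 1 ∨ ε = -1)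
    (hW : SG.IrreducibleWord g W) (u : List (D g))
    (e : tn (W.map dir) = u ++ List.replicate (2*g-1) ε) :
    ∃ y P, W.map dir = P ++ [y - ε] ∧ SG.rank g (ltr hg y) < SG.rank g (ltr hg (y-ε)) := by
  have hne : List.replicate (2*g-1) ε ≠ [] := by simp; omega
  obtain ⟨P, F, Q, e1, e2, e3, _, _, e5⟩ := tn_split _ u _ [] (by simpa using e) hne
  have hQ : Q = [] := by
    rcases Q with _ | ⟨b, Q⟩
    · rfl
    · obtain ⟨t, v', _, h⟩ := e5 b Q rfl
      simp at h
  subst hQ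
  rw [List.append_nil] at e1
  obtain ⟨P', F', e6, hP, hF⟩ := List.map_eq_append_iff.1 e1
  rcases F with _ | ⟨f, F⟩
  · simp at e3
  have h3 := fr_of_tn ε f F hε _ e2
  refine ⟨f, P ++ fr (ε*(hf g+1)) f (2*g-1), ?_, ?_⟩
  · rw [e1, h3, fr_succ_right, List.append_assoc]
    congr 3
    have h0 : ((2*g-1 : ℕ) : D g) = hf g - 1 := by
      rw [Nat.cast_sub (by omega)]; simp [hf]
    rw [h0]
    linear_combination ε * hf_mul g
  · rw [show 2*g-1+1 = 2*g by omega] at h3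
    exact flip_rank hg F' ε _ hε (irr_sub P' F' [] (by simpa [← e6] using hW)) (by rw [hF, h3])

theorem rank_inv {g : ℕ} (a : SG.Letter g) : SG.rank g (SG.invLetter g a) + SG.rank g a = 4*g-1 := by
  obtain ⟨i, b⟩ := a
  have := i.2
  cases b <;> simp [SG.rank, SG.invLetter] <;> omega

end SGP


namespace SGP

theorem fred_tn {g : ℕ} (W : SG.Word g) (h : SG.FreelyReduced g W) (hg : 2 ≤ g) :
    (0 : D g) ∉ tn (W.map dir) := by
  induction W with
  | nil => simp [tn]
  | cons a W ih =>
    rcases W with _ | ⟨b, W⟩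
    · simp [tn, tf]
    · unfold SG.FreelyReduced at h ih
      replace h := List.isChain_cons_cons.1 h
      simp only [List.map_cons, tn_cons, List.mem_cons, not_or] at ih ⊢
      refine ⟨?_, ih h.2⟩
      intro h0
      apply h.1
      apply (dir_bij hg).injective
      rw [dir_inv]; linear_combination -h0

theorem tn_sum {g : ℕ} (Y : List (D g)) : ∀ (y l : D g) (P : List (D g)), y :: Y = P ++ [l] →
    y + (tn (y::Y)).sum + (tn (y::Y)).length * hf g = l := by
  induction Y with
  | nil =>
    intro y l P h
    rcases P with _ | ⟨c, P⟩
    · simp at h; simp [tn, tf, h]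
    · simp at h
  | cons b Y ih =>
    intro y l P h
    rcases P with _ | ⟨c, P⟩
    · simp at h
    · simp only [List.cons_append, List.cons.injEq] at h
      have := ih b l P h.2
      rw [tn_cons, List.sum_cons, List.length_cons]
      push_cast
      linear_combination this

theorem tn_join {g : ℕ} (P Q dP dQ : List (D g)) (u v : D g) (h1 : dP = P ++ [u]) (h2 : dQ = v :: Q) :
    tn (dP ++ dQ) = tn dP ++ (v - u - hf g) :: tn dQ := by
  subst h1 h2
  rw [List.append_assoc, List.singleton_append, tn_app]

theorem inv_dirs {g : ℕ} (X : SG.Word g) :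
    (SG.wordInv g X).map dir = ((X.map dir).map (fun x => x + hf g)).reverse := by
  rw [SG.wordInv, List.map_reverse, List.map_map, List.map_map]
  congr 2
  funext a; exact dir_inv a

theorem eval_inv {g : ℕ} (X : SG.Word g) : SG.eval g (SG.wordInv g X) = (SG.eval g X)⁻¹ := by
  induction X with
  | nil => simp [SG.eval, SG.wordInv]
  | cons a X ih =>
    have e : SG.wordInv g (a::X) = SG.wordInv g X ++ [SG.invLetter g a] := by simp [SG.wordInv]
    have e2 : SG.eval g (a::X) = SG.evalLetter g a * SG.eval g X := by simp [SG.eval]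
    have e3 : SG.eval g [SG.invLetter g a] = (SG.evalLetter g a)⁻¹ := by
      obtain ⟨i, b⟩ := a
      cases b <;> simp [SG.eval, SG.evalLetter, SG.invLetter]
    rw [e, eval_app, ih, e2, e3, mul_inv_rev]

theorem inv_inv_word {g : ℕ} (X : SG.Word g) : SG.wordInv g (SG.wordInv g X) = X := by
  simp [SG.wordInv, Function.comp_def, SG.invLetter]

theorem len_ex {g : ℕ} (W : SG.Word g) :
    ∃ V : SG.Word g, V.length = SG.len g (SG.eval g W) ∧ SG.eval g V = SG.eval g W :=
  Nat.sInf_mem (s := {n | ∃ V : SG.Word g, V.length = n ∧ SG.eval g V = SG.eval g W}) ⟨_, W, rfl, rfl⟩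

theorem q_contra {g : ℕ} (hg : 2 ≤ g) (A X0 : SG.Word g) (x : SG.Letter g) (l ε : D g) (P : List (D g))
    (hε : ε = 1 ∨ ε = -1) (hA : SG.IrreducibleWord g A) (hX : SG.IrreducibleWord g (x::X0))
    (hP : A.map dir = P ++ [l])
    (h : ¬ SG.HasLLFR g (4*g-1) (A ++ x::X0)) (u v : List (D g)) :
    tn (A.map dir) ++ (dir x - l - hf g) :: tn ((x::X0).map dir)
      ≠ u ++ List.replicate (4*g-2) ε ++ v := by
  intro e
  have hj := tn_join P (X0.map dir) (A.map dir) ((x::X0).map dir) l (dir x) hP rfl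
  rw [← List.map_append] at hj
  obtain ⟨u', v', e2⟩ := noLLFR hg _ ε hε h u v (by rw [hj, e])
  rw [hj] at e2
  obtain ⟨hq, ⟨u2, hu⟩, v2, hv⟩ := run_mid hg _ _ _ _ _ ε hε (geo_ok hg _ (irr_geo _ hA))
    (geo_ok hg _ (irr_geo _ hX)) e2
  obtain ⟨y, P2, e3, r1⟩ := tail_rank hg A ε hε hA u2 hu
  have r2 := head_rank hg x X0 ε hε hX v2 hv
  rw [hP] at e3
  have hl : l = y - ε := by simpa using (List.append_inj' e3 rfl).2
  have e4 : dir x = y + hf g := by rw [hl] at hq; linear_combination hq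
  rw [e4, show y + hf g - ε = (y - ε) + hf g by ring, ltr_hf, ltr_hf] at r2
  have := rank_inv (ltr hg y)
  have := rank_inv (ltr hg (y - ε))
  omega

theorem p_contra {g : ℕ} (hg : 2 ≤ g) (A0 X0 : SG.Word g) (x a0 : SG.Letter g) (ε : D g)
    (hε : ε = 1 ∨ ε = -1) (hA : SG.IrreducibleWord g (a0::A0)) (hX : SG.IrreducibleWord g (x::X0))
    (hY : Ok 0 0 (ng (tn ((x::X0).map dir)).reverse))
    (h : ¬ SG.HasLLFR g (4*g-1) (SG.wordInv g (x::X0) ++ a0::A0)) (u v : List (D g)) :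
    ng (tn ((x::X0).map dir)).reverse ++ (dir a0 - (dir x + hf g) - hf g) :: tn ((a0::A0).map dir)
      ≠ u ++ List.replicate (4*g-2) ε ++ v := by
  intro e
  have hj := tn_join ((X0.map dir).map (fun x => x + hf g)).reverse (A0.map dir)
    ((SG.wordInv g (x::X0)).map dir) ((a0::A0).map dir) (dir x + hf g) (dir a0)
    (by rw [inv_dirs]; simp) rfl
  rw [← List.map_append, inv_dirs, tn_rev] at hj
  obtain ⟨u', v', e2⟩ := noLLFR hg _ ε hε h u v (by rw [hj, e])
  rw [hj] at e2
  obtain ⟨hp, ⟨u2, hu⟩, v2, hv⟩ := run_mid hg _ _ _ _ _ ε hε hY (geo_ok hg _ (irr_geo _ hA)) e2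
  have r1 := head_rank hg a0 A0 ε hε hA v2 hv
  have hw : tn ((x::X0).map dir) = List.replicate (2*g-1) (-ε) ++ (ng u2).reverse := by
    have h' := congrArg ng (congrArg List.reverse hu)
    rw [← List.map_reverse, List.reverse_reverse, ng_ng] at h'
    rw [h']; simp
  have r2 := head_rank hg x X0 (-ε) (by rcases hε with rfl | rfl <;> simp) hX _ hw
  have hh := hf_add g
  rw [show dir a0 - ε = dir x by linear_combination hp + hh] at r1
  rw [show dir x - -ε = dir a0 by linear_combination -hp - hh] at r2
  omega

theorem main_aux {g : ℕ} (hg : 2 ≤ g) (A0 X0 : SG.Word g) (x a0 : SG.Letter g)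
    (hA : SG.IrreducibleWord g (a0::A0)) (hX : SG.IrreducibleWord g (x::X0))
    (hfr : SG.FreelyReduced g (SG.wordInv g (x::X0) ++ (a0::A0) ++ (x::X0)))
    (h1 : ¬ SG.HasLLFR g (4*g-1) (SG.wordInv g (x::X0) ++ (a0::A0)))
    (h2 : ¬ SG.HasLLFR g (4*g-1) ((a0::A0) ++ (x::X0))) :
    2*(x::X0).length + (a0::A0).length ≤
      SG.len g (SG.eval g (SG.wordInv g (x::X0) ++ (a0::A0) ++ (x::X0))) + 8*g := by
  have hh := hf_add g
  obtain ⟨P, l, hP⟩ : ∃ P l, (a0::A0).map dir = P ++ [l] := by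
    rcases List.eq_nil_or_concat ((a0::A0).map dir) with h | ⟨P, l, h⟩
    · simp at h
    · exact ⟨P, l, by rw [h, List.concat_eq_append]⟩
  have hw := geo_ok hg _ (irr_geo _ hX)
  have ha := geo_ok hg _ (irr_geo _ hA)
  have hY := geo_ok hg (SG.wordInv g (x::X0)) (by
    intro W' e
    have := irr_geo _ hX (SG.wordInv g W') (by rw [eval_inv, e, eval_inv, inv_inv])
    simpa [SG.wordInv] using this)
  rw [inv_dirs, tn_rev] at hY
  have hP' := hP
  rw [List.map_cons] at hP'
  have hs := tn_sum _ _ _ _ hP'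
  rw [← List.map_cons] at hs
  have Iq := fun ε hε => q_contra hg (a0::A0) X0 x l ε P hε hA hX hP h2
  have Ip := fun ε hε => p_contra hg A0 X0 x a0 ε hε hA hX hY h1
  -- turns of the whole word
  have hW : tn ((SG.wordInv g (x::X0) ++ (a0::A0) ++ (x::X0)).map dir) =
      ng (tn ((x::X0).map dir)).reverse ++ (dir a0 - (dir x + hf g) - hf g) ::
        (tn ((a0::A0).map dir) ++ (dir x - l - hf g) :: tn ((x::X0).map dir)) := by
    have j1 := tn_join ((X0.map dir).map (fun x => x + hf g)).reverse
      ((A0 ++ x::X0).map dir) ((SG.wordInv g (x::X0)).map dir) ((a0::A0 ++ x::X0).map dir)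
      (dir x + hf g) (dir a0) (by rw [inv_dirs]; simp) rfl
    have j2 := tn_join P (X0.map dir) ((a0::A0).map dir) ((x::X0).map dir) l (dir x) hP rfl
    rw [List.append_assoc, List.map_append, j1, inv_dirs, tn_rev, List.map_append, j2]
  have h0 := fred_tn _ hfr hg
  have hlen : ((SG.wordInv g (x::X0) ++ (a0::A0) ++ (x::X0)).map dir).length =
      2*(x::X0).length + (a0::A0).length := by
    simp [SG.wordInv]; omega
  have hev := eval_pr hg (SG.wordInv g (x::X0) ++ (a0::A0) ++ (x::X0))
  obtain ⟨V, hV1, hV2⟩ := len_ex (SG.wordInv g (x::X0) ++ (a0::A0) ++ (x::X0))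
  generalize SG.wordInv g (x::X0) ++ (a0::A0) ++ (x::X0) = WW at *
  have h0' := h0
  rw [hW] at h0'
  simp only [List.mem_append, List.mem_cons, not_or] at h0'
  generalize tn ((x::X0).map dir) = w at *
  generalize tn ((a0::A0).map dir) = a at *
  generalize hpd : dir a0 - (dir x + hf g) - hf g = p at *
  generalize hqd : dir x - l - hf g = q at *
  have hfin := comb hg w a (ng w.reverse) p q rfl ha hw hY (Ne.symm h0'.2.1) (Ne.symm h0'.2.2.2.1)
    (Ip 1 (.inl rfl)) (Iq 1 (.inl rfl))
    (by
      intro u v h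
      refine Ip (-1) (.inr rfl) (ng u) (ng v) ?_
      simpa [Function.comp_def] using congrArg ng h)
    (by
      intro u v h
      refine Iq (-1) (.inr rfl) (ng u) (ng v) ?_
      simpa [Function.comp_def] using congrArg ng h)
    (by rw [← hpd, ← hqd]; linear_combination hs - hh)
  obtain ⟨s', B, hE, hB, hBl⟩ := hfin
  generalize hdW : WW.map dir = dW at *
  rcases dW with _ | ⟨d0, dW⟩
  · simp at hlen
  obtain ⟨e1, -⟩ := hE.sound hg d0
  have hL : ng w.reverse ++ p :: (a ++ q :: (w ++ [hf g])) = tf d0 dW ++ [hf g] := by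
    rw [show tf d0 dW = _ from hW]; simp
  rw [hL] at e1 hBl
  have e3 : d0 + hf g + hf g = d0 := by linear_combination hh
  simp only [path, path_app, path_tf, e3] at e1
  rw [pr_cons, pr_app, ← mul_assoc, ← pr_cons, ← hev, ← hV2] at e1
  have hgeo := good_geo hg (ltr hg (d0 + hf g + s')) ((path (d0 + hf g + s') B).map (ltr hg))
    (V ++ [ltr hg (fin d0 (tf d0 dW) + hf g + hf g)]) (by
      rw [dir_ltr, List.map_map]
      have : (dir ∘ ltr hg) = id := by funext d; exact dir_ltr hg d
      rw [this, List.map_id, tf_path]; exact hB) (by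
      rw [eval_app, ← List.map_cons, pr_eval, ← e1]
      congr 1)
  simp only [path_length, tf_length, List.length_append, List.length_map, List.length_cons,
    List.length_nil] at hgeo hBl hlen ⊢
  omega

end SGP

/-- If `X` is irreducible, `A` cyclically irreducible, `X⁻¹AX`
freely reduced, and neither `X⁻¹A` nor `AX` contains a `(4g−1)`-LLFR, then
`2|X| + |A| − |w| ≤ 8g`, where `w` is the element represented by `X⁻¹AX`. -/
theorem conjugation_length_loss_bound (g : ℕ) (hg : 2 ≤ g) (X A : SG.Word g)
    (hX : SG.IrreducibleWord g X) (hA : SG.CyclicallyIrreducibleWord g A)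
    (hfr : SG.FreelyReduced g (SG.wordInv g X ++ A ++ X))
    (h1 : ¬ SG.HasLLFR g (4*g-1) (SG.wordInv g X ++ A))
    (h2 : ¬ SG.HasLLFR g (4*g-1) (A ++ X)) :
    2*X.length + A.length - SG.len g (SG.eval g (SG.wordInv g X ++ A ++ X)) ≤ 8*g := by
  have hA' := hA A (List.IsRotated.refl A)
  rcases X with _ | ⟨x, X0⟩
  · have e : SG.wordInv g ([] : SG.Word g) ++ A ++ ([] : SG.Word g) = A := by simp [SG.wordInv]
    rw [e]
    obtain ⟨V, hV1, hV2⟩ := SGP.len_ex A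
    have := SGP.irr_geo _ hA' V hV2
    simp only [List.length_nil]
    omega
  · rcases A with _ | ⟨a0, A0⟩
    · exfalso
      have h0 := SGP.fred_tn _ hfr hg
      have j := SGP.tn_join ((X0.map SGP.dir).map (fun x => x + SGP.hf g)).reverse
        (X0.map SGP.dir) ((SG.wordInv g (x::X0)).map SGP.dir) ((x::X0).map SGP.dir)
        (SGP.dir x + SGP.hf g) (SGP.dir x) (by rw [SGP.inv_dirs]; simp) rfl
      rw [List.append_nil, List.map_append, j] at h0
      apply h0
      have : SGP.dir x - (SGP.dir x + SGP.hf g) - SGP.hf g = 0 := by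
        linear_combination - SGP.hf_add g
      rw [this]
      simp
    · have := SGP.main_aux hg A0 X0 x a0 hA' hX hfr h1 h2
      omega
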